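/- Let d ≥ 1, T ∈ (-∞, ∞], ν ∈ (0,1), α ∈ (0,2), λ > 0, p ∈ (1,∞), and γ ∈ (αp/2 - 1, 2p - 1). Then there exists a constant N > 0, depending only on d, ν, α, γ, p, such that for every choice of measurable coefficients μ, ā₀, c̄₀, ā_{ij} as in the context and every smooth function u : ℝ × ℝ^d → ℝ with compact support contained in (-∞,T) × ℝ^{d-1} × (0,∞), setting f(t,x) = μ(x_d)^{-1}(ā₀(x_d) u_t + λ c̄₀(x_d) u) - ā_{ij}(x_d) D_iD_j u, one has λ^{1/2} ‖χ^{-α/2} Du‖_{L_p(Ω_T, x_d^γ dz)} ≤ N ‖f‖_{L_p(Ω_T, x_d^γ dz)}. -/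

import Mathlib

open MeasureTheory ENNReal Set

noncomputable section

abbrev Ed (d : ℕ) : Type := EuclideanSpace ℝ (Fin d)

/-- The last coordinate `x_d` of a point `x ∈ ℝ^d` (junk value `0` if `d = 0`). -/
def xd {d : ℕ} (x : Ed d) : ℝ :=
  if h : 0 < d then x ⟨d - 1, Nat.sub_lt h one_pos⟩ else 0

/-- `Ω_T = (-∞, T) × ℝ^d_+`. -/
def OmegaT (d : ℕ) (T : EReal) : Set (ℝ × Ed d) :=
  {z | (z.1 : EReal) < T ∧ 0 < xd z.2}

/-- Time derivative `u_t`. -/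
def ut {d : ℕ} (u : ℝ × Ed d → ℝ) (z : ℝ × Ed d) : ℝ :=
  deriv (fun s => u (s, z.2)) z.1

/-- Spatial gradient `Du`. -/
def Du {d : ℕ} (u : ℝ × Ed d → ℝ) (z : ℝ × Ed d) : Ed d →L[ℝ] ℝ :=
  fderiv ℝ (fun y => u (z.1, y)) z.2

/-- Spatial Hessian `D²u`. -/
def D2u {d : ℕ} (u : ℝ × Ed d → ℝ) (z : ℝ × Ed d) : Ed d →L[ℝ] Ed d →L[ℝ] ℝ :=
  fderiv ℝ (fun y => Du u (z.1, y)) z.2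

/-- Spatial Laplacian `Δu`. -/
def lap {d : ℕ} (u : ℝ × Ed d → ℝ) (z : ℝ × Ed d) : ℝ :=
  ∑ i : Fin d, D2u u z (EuclideanSpace.single i 1) (EuclideanSpace.single i 1)

/-- Weighted Lebesgue norm `‖g‖_{L_p(Ω_T, x_d^γ dz)}`. -/
def wLp (d : ℕ) (T : EReal) (p γ : ℝ) (g : ℝ × Ed d → ℝ) : ℝ≥0∞ :=
  (∫⁻ z in OmegaT d T, ENNReal.ofReal (|g z| ^ p * xd z.2 ^ γ)) ^ (1 / p)

/-- Conditions (1.3)–(1.4) on the (measurable) coefficients `μ, ā₀, c̄₀, ā_{ij}`,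
depending only on the `x_d` variable. -/
def CoeffOK (d : ℕ) (ν α : ℝ) (μc a0 c0 : ℝ → ℝ) (aij : Fin d → Fin d → ℝ → ℝ) : Prop :=
  Measurable μc ∧ Measurable a0 ∧ Measurable c0 ∧ (∀ i j, Measurable (aij i j)) ∧
  (∀ s : ℝ, 0 < s →
      a0 s ∈ Set.Icc ν ν⁻¹ ∧ c0 s ∈ Set.Icc ν ν⁻¹ ∧ μc s / s ^ α ∈ Set.Icc ν ν⁻¹) ∧
  (∀ s : ℝ, 0 < s → ∀ ξ : Fin d → ℝ,
      ν * ∑ i, ξ i ^ 2 ≤ ∑ i, ∑ j, aij i j s * ξ i * ξ j) ∧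
  (∀ s : ℝ, 0 < s → ∀ i j, |aij i j s| ≤ ν⁻¹)

/-- `f = μ(x_d)⁻¹ (ā₀ u_t + λ c̄₀ u) - ā_{ij} D_i D_j u`, i.e. `𝓛₀ u = μ(x_d) f`. -/
def fL0 {d : ℕ} (μc a0 c0 : ℝ → ℝ) (aij : Fin d → Fin d → ℝ → ℝ) (lam : ℝ)
    (u : ℝ × Ed d → ℝ) (z : ℝ × Ed d) : ℝ :=
  (μc (xd z.2))⁻¹ * (a0 (xd z.2) * ut u z + lam * c0 (xd z.2) * u z) -
    ∑ i, ∑ j, aij i j (xd z.2) *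
      D2u u z (EuclideanSpace.single i 1) (EuclideanSpace.single j 1)

set_option linter.unusedSectionVars false
set_option linter.unusedVariables false

section Basics

variable {E : Type*} [NormedAddCommGroup E] [NormedSpace ℝ E]

/-- Directional derivative. -/
def dirD (v : E) (u : E → ℝ) (z : E) : ℝ := fderiv ℝ u z v

/-- Functions of class `C^n` whose support lies in `K`. -/
structure IsTest (n : WithTop ℕ∞) (K : Set E) (u : E → ℝ) : Prop where
  contDiff : ContDiff ℝ n u
  supp : tsupport u ⊆ K

/-- Measurable functions which are bounded on `K`. -/
@[fun_prop]
structure BddMeas {X : Type*} [MeasurableSpace X] (K : Set X) (f : X → ℝ) : Prop where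
  meas : Measurable f
  bdd : ∃ C, ∀ z ∈ K, |f z| ≤ C

namespace BddMeas

variable {X : Type*} [MeasurableSpace X] {K : Set X} {f g : X → ℝ}

@[fun_prop]
theorem const (c : ℝ) : BddMeas K (fun _ : X => c) := ⟨measurable_const, |c|, fun _ _ => le_rfl⟩

@[fun_prop]
theorem add (hf : BddMeas K f) (hg : BddMeas K g) : BddMeas K (fun z => f z + g z) := by
  obtain ⟨C, hC⟩ := hf.bdd
  obtain ⟨D, hD⟩ := hg.bdd
  exact ⟨hf.meas.add hg.meas, C + D, fun z hz =>
    (abs_add_le _ _).trans (add_le_add (hC z hz) (hD z hz))⟩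

@[fun_prop]
theorem neg (hf : BddMeas K f) : BddMeas K (fun z => -f z) := by
  obtain ⟨C, hC⟩ := hf.bdd
  exact ⟨hf.meas.neg, C, fun z hz => by simpa using hC z hz⟩

@[fun_prop]
theorem sub (hf : BddMeas K f) (hg : BddMeas K g) : BddMeas K (fun z => f z - g z) := by
  simpa only [sub_eq_add_neg] using hf.add hg.neg

@[fun_prop]
theorem mul (hf : BddMeas K f) (hg : BddMeas K g) : BddMeas K (fun z => f z * g z) := by
  obtain ⟨C, hC⟩ := hf.bdd
  obtain ⟨D, hD⟩ := hg.bdd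
  exact ⟨hf.meas.mul hg.meas, C * D, fun z hz => by
    rw [abs_mul]
    exact mul_le_mul (hC z hz) (hD z hz) (abs_nonneg _) ((abs_nonneg _).trans (hC z hz))⟩

@[fun_prop]
theorem sum {ι : Type*} {s : Finset ι} {F : ι → X → ℝ} (h : ∀ i, BddMeas K (F i)) :
    BddMeas K (fun z => ∑ i ∈ s, F i z) := by
  choose C hC using fun i => (h i).bdd
  exact ⟨Finset.measurable_sum s fun i _ => (h i).meas, ∑ i ∈ s, C i, fun z hz =>
    (Finset.abs_sum_le_sum_abs _ _).trans (Finset.sum_le_sum fun i _ => hC i z hz)⟩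

theorem cont_comp {h : ℝ → ℝ} (hh : Continuous h) (hf : BddMeas K f) :
    BddMeas K (fun z => h (f z)) := by
  obtain ⟨C, hC⟩ := hf.bdd
  obtain ⟨D, hD⟩ := isCompact_Icc.exists_bound_of_continuousOn
    (hh.continuousOn (s := Icc (-C) C))
  exact ⟨hh.measurable.comp hf.meas, D, fun z hz => hD _ (abs_le.1 (hC z hz))⟩

@[fun_prop]
theorem pow (hf : BddMeas K f) (n : ℕ) : BddMeas K (fun z => f z ^ n) :=
  cont_comp (continuous_pow n) hf

@[fun_prop]
theorem abs (hf : BddMeas K f) : BddMeas K (fun z => |f z|) :=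
  cont_comp continuous_abs hf

@[fun_prop]
theorem abs_rpow (hf : BddMeas K f) {p : ℝ} (hp : 0 ≤ p) : BddMeas K (fun z => |f z| ^ p) :=
  cont_comp (Real.continuous_rpow_const hp) hf.abs

theorem integrable {μ : Measure X} (hf : BddMeas K f) (hK : MeasurableSet K) (hμ : μ K ≠ ∞)
    (h0 : ∀ z, z ∉ K → f z = 0) : Integrable f μ := by
  obtain ⟨C, hC⟩ := hf.bdd
  have : f = K.indicator f := by
    ext z
    by_cases hz : z ∈ K
    · simp [hz]
    · simp [hz, h0 z hz]
  rw [this, integrable_indicator_iff hK]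
  exact IntegrableOn.of_bound hμ.lt_top hf.meas.aestronglyMeasurable C
    (ae_restrict_of_forall_mem hK fun z hz => hC z hz)

end BddMeas

namespace IsTest

variable {n : WithTop ℕ∞} {K : Set E} {u v : E → ℝ}

theorem zero_off (hu : IsTest n K u) {z : E} (hz : z ∉ K) : u z = 0 :=
  image_eq_zero_of_notMem_tsupport fun h => hz (hu.supp h)

theorem of_le (hu : IsTest n K u) {m : WithTop ℕ∞} (h : m ≤ n) : IsTest m K u :=
  ⟨hu.contDiff.of_le h, hu.supp⟩

theorem dirD_supp (hu : IsTest n K u) (w : E) : tsupport (dirD w u) ⊆ K :=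
  (tsupport_fderiv_apply_subset ℝ w).trans hu.supp

theorem dirD (hu : IsTest (⊤ : ℕ∞) K u) (w : E) : IsTest (⊤ : ℕ∞) K (dirD w u) :=
  ⟨(hu.contDiff.fderiv_right (m := (⊤ : ℕ∞)) (by simp)).clm_apply contDiff_const, hu.dirD_supp w⟩

theorem mul (hu : IsTest n K u) (hv : IsTest n K v) : IsTest n K (fun z => u z * v z) :=
  ⟨hu.contDiff.mul hv.contDiff, (tsupport_mul_subset_left).trans hu.supp⟩

theorem add (hu : IsTest n K u) (hv : IsTest n K v) : IsTest n K (fun z => u z + v z) :=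
  ⟨hu.contDiff.add hv.contDiff, (tsupport_add u v).trans (union_subset hu.supp hv.supp)⟩

theorem comp (hu : IsTest n K u) {h : ℝ → ℝ} (hh : ContDiff ℝ n h) (h0 : h 0 = 0) :
    IsTest n K (fun z => h (u z)) := by
  refine ⟨hh.comp hu.contDiff, (closure_mono ?_).trans hu.supp⟩
  intro z hz
  simp only [Function.mem_support] at hz ⊢
  exact fun h' => hz (by rw [h', h0])

theorem hasCompactSupport (hu : IsTest n K u) (hK : IsCompact K) : HasCompactSupport u :=
  hK.of_isClosed_subset (isClosed_tsupport _) hu.supp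

theorem differentiableAt (hu : IsTest n K u) (hn : 1 ≤ n) (z : E) : DifferentiableAt ℝ u z :=
  hu.contDiff.differentiable (by
    intro h; rw [h] at hn; simp at hn) z

theorem hasLineDerivAt (hu : IsTest n K u) (hn : 1 ≤ n) (z w : E) :
    HasLineDerivAt ℝ u (_root_.dirD w u z) z w :=
  (hu.differentiableAt hn z).hasFDerivAt.hasLineDerivAt w

variable [MeasurableSpace E] [BorelSpace E]

theorem bddMeas (hu : IsTest n K u) (hK : IsCompact K) : BddMeas K u := by
  obtain ⟨C, hC⟩ := hK.exists_bound_of_continuousOn hu.contDiff.continuous.continuousOn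
  exact ⟨hu.contDiff.continuous.measurable, C, hC⟩

theorem bddMeas_dirD (hu : IsTest n K u) (hn : 1 ≤ n) (hK : IsCompact K) (w : E) :
    BddMeas K (_root_.dirD w u) := by
  have hc : Continuous (_root_.dirD w u) :=
    ((hu.contDiff.of_le hn).continuous_fderiv (by simp)).clm_apply continuous_const
  obtain ⟨C, hC⟩ := hK.exists_bound_of_continuousOn hc.continuousOn
  exact ⟨hc.measurable, C, hC⟩

end IsTest

section rules

variable {u v : E → ℝ} {z : E}

theorem dirD_mul (hu : DifferentiableAt ℝ u z) (hv : DifferentiableAt ℝ v z) (w : E) :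
    dirD w (fun z => u z * v z) z = u z * dirD w v z + v z * dirD w u z := by
  simp [dirD, fderiv_fun_mul hu hv]

theorem dirD_comp (hu : DifferentiableAt ℝ u z) {h : ℝ → ℝ} {h' : ℝ}
    (hh : HasDerivAt h h' (u z)) (w : E) :
    dirD w (fun z => h (u z)) z = h' * dirD w u z := by
  have := (hh.comp_hasFDerivAt z hu.hasFDerivAt).fderiv
  unfold dirD
  change fderiv ℝ (h ∘ u) z w = _
  rw [this]; simp

theorem dirD_comm (hu : ContDiff ℝ (⊤ : ℕ∞) u) (v w : E) (z : E) :
    dirD v (dirD w u) z = dirD w (dirD v u) z := by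
  have hs : IsSymmSndFDerivAt ℝ u z :=
    hu.contDiffAt.isSymmSndFDerivAt (by
      rw [minSmoothness_of_isRCLikeNormedField]; exact WithTop.coe_le_coe.2 le_top)
  have hd : DifferentiableAt ℝ (fderiv ℝ u) z :=
    (hu.fderiv_right (m := (⊤ : ℕ∞)) (by simp)).differentiable (by simp) z
  have key : ∀ a b : E, dirD a (dirD b u) z = fderiv ℝ (fderiv ℝ u) z a b := by
    intro a b
    unfold dirD
    rw [fderiv_clm_apply hd (differentiableAt_const b)]
    simp
  rw [key, key]
  exact hs.eq v w

end rules

variable [MeasurableSpace E] [BorelSpace E] [FiniteDimensional ℝ E]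
  {μ : Measure E} [μ.IsAddHaarMeasure]

theorem integral_mul_dirD {K : Set E} (hK : IsCompact K) {f f' g : E → ℝ} {v : E}
    (hf : BddMeas K f) (hf' : BddMeas K f') (hg : IsTest 1 K g)
    (hd : ∀ z ∈ K, HasLineDerivAt ℝ f (f' z) z v) :
    ∫ z, f z * dirD v g z ∂μ = -∫ z, f' z * g z ∂μ := by
  have hm : MeasurableSet K := hK.measurableSet
  have hfin : μ K ≠ ∞ := hK.measure_lt_top.ne
  have b1 := hg.bddMeas hK
  have b2 := hg.bddMeas_dirD le_rfl hK v
  have z2 : ∀ z, z ∉ K → dirD v g z = 0 := fun z hz =>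
    image_eq_zero_of_notMem_tsupport fun h => hz (hg.dirD_supp v h)
  have := integral_bilinear_hasLineDerivAt_right_eq_neg_left_of_integrable
    (f := f) (f' := f') (g := g) (g' := dirD v g) (v := v) (μ := μ)
    (B := ContinuousLinearMap.mul ℝ ℝ) ?_ ?_ ?_ ?_ ?_
  · simpa using this
  · simp only [ContinuousLinearMap.mul_apply']
    exact (hf'.mul b1).integrable hm hfin fun z hz => by simp [hg.zero_off hz]
  · simp only [ContinuousLinearMap.mul_apply']
    exact (hf.mul b2).integrable hm hfin fun z hz => by simp [z2 z hz]
  · simp only [ContinuousLinearMap.mul_apply']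
    exact (hf.mul b1).integrable hm hfin fun z hz => by simp [hg.zero_off hz]
  · intro x hx; exact hd x (hg.supp hx)
  · intro x hx; exact hg.hasLineDerivAt le_rfl x v

/-- Integration by parts in a direction along which the coefficient is constant. -/
theorem integral_mul_dirD_eq_zero {K : Set E} (hK : IsCompact K) {f g : E → ℝ} {v : E}
    (hf : BddMeas K f) (hg : IsTest 1 K g) (hd : ∀ z, ∀ t : ℝ, f (z + t • v) = f z) :
    ∫ z, f z * dirD v g z ∂μ = 0 := by
  have := integral_mul_dirD (μ := μ) hK (f' := fun _ => 0) hf (by fun_prop) hg (v := v) (fun z _ => by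
    unfold HasLineDerivAt
    simp only [hd]
    exact hasDerivAt_const _ _)
  simpa using this

end Basics

section Powers

/-- A `C^1` function `ψ` vanishing at zero, with its derivative and its primitive. -/
structure PrimPair (ψ ψ' Ψ : ℝ → ℝ) : Prop where
  deriv_prim : ∀ y, HasDerivAt Ψ (ψ y) y
  deriv : ∀ y, HasDerivAt ψ (ψ' y) y
  cont : Continuous ψ'
  zero : ψ 0 = 0
  prim_zero : Ψ 0 = 0

theorem contDiff_one_of_hasDerivAt {f f' : ℝ → ℝ} (h : ∀ y, HasDerivAt f (f' y) y)
    (hc : Continuous f') : ContDiff ℝ 1 f := by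
  rw [contDiff_one_iff_deriv]
  refine ⟨fun y => (h y).differentiableAt, ?_⟩
  have : deriv f = f' := funext fun y => (h y).deriv
  rwa [this]

namespace PrimPair

variable {ψ ψ' Ψ : ℝ → ℝ}

theorem continuous (h : PrimPair ψ ψ' Ψ) : Continuous ψ :=
  continuous_iff_continuousAt.2 fun y => (h.deriv y).continuousAt

theorem contDiff (h : PrimPair ψ ψ' Ψ) : ContDiff ℝ 1 ψ :=
  contDiff_one_of_hasDerivAt h.deriv h.cont

theorem contDiff_prim (h : PrimPair ψ ψ' Ψ) : ContDiff ℝ 1 Ψ :=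
  contDiff_one_of_hasDerivAt h.deriv_prim h.continuous

end PrimPair

/-- The signed power `|y|^(p-2) y`. -/
def spow (p y : ℝ) : ℝ := |y| ^ (p - 2) * y

theorem abs_spow {p : ℝ} (hp : 1 < p) (y : ℝ) : |spow p y| = |y| ^ (p - 1) := by
  rcases eq_or_ne y 0 with rfl | hy
  · simp [spow, Real.zero_rpow (by linarith : p - 1 ≠ 0)]
  · have : 0 < |y| := abs_pos.2 hy
    rw [spow, abs_mul, abs_of_nonneg (Real.rpow_nonneg this.le _), ← Real.rpow_add_one this.ne']
    ring_nf

theorem mul_spow {p : ℝ} (hp : 1 < p) (y : ℝ) : y * spow p y = |y| ^ p := by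
  rcases eq_or_ne y 0 with rfl | hy
  · simp [Real.zero_rpow (by linarith : p ≠ 0)]
  · have : 0 < |y| := abs_pos.2 hy
    have h2 : |y| ^ p = |y| ^ (p - 2) * |y| ^ 2 := by
      rw [← Real.rpow_natCast, ← Real.rpow_add this]; norm_num
    rw [h2, sq_abs, spow]; ring

theorem spow_deriv_mul {p : ℝ} (hp : 1 < p) (y : ℝ) :
    y * ((p - 1) * |y| ^ (p - 2)) = (p - 1) * spow p y := by
  rw [spow]; ring

theorem hasDerivAt_spow {p : ℝ} (hp : 2 < p) (y : ℝ) :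
    HasDerivAt (spow p) ((p - 1) * |y| ^ (p - 2)) y := by
  rcases eq_or_ne y 0 with rfl | hy
  · have h0 : (p - 1) * |(0 : ℝ)| ^ (p - 2) = 0 := by
      simp [Real.zero_rpow (by linarith : p - 2 ≠ 0)]
    rw [h0, hasDerivAt_iff_tendsto_slope]
    have : Filter.Tendsto (fun y : ℝ => |y| ^ (p - 2)) (nhdsWithin 0 {0}ᶜ) (nhds 0) := by
      have hc : Continuous fun y : ℝ => |y| ^ (p - 2) :=
        continuous_abs.rpow_const fun _ => Or.inr (by linarith)
      have := hc.tendsto 0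
      simp only [abs_zero, Real.zero_rpow (by linarith : p - 2 ≠ 0)] at this
      exact this.mono_left nhdsWithin_le_nhds
    refine this.congr' ?_
    filter_upwards [self_mem_nhdsWithin] with y hy
    have hy' : y ≠ 0 := hy
    simp [slope_def_field, spow, hy']
  · rcases lt_or_gt_of_ne hy with h | h
    · have h1 : HasDerivAt (fun y : ℝ => (-y) ^ (p - 2) * y)
          (((-1) * (p - 2) * (-y) ^ (p - 2 - 1)) * y + (-y) ^ (p - 2) * 1) y :=
        ((hasDerivAt_neg y).rpow_const (Or.inl (by linarith))).mul (hasDerivAt_id y)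
      have h2 : (-y) ^ (p - 2) = (-y) ^ (p - 2 - 1) * (-y) := by
        rw [← Real.rpow_add_one (by linarith)]; ring_nf
      have h3 : HasDerivAt (spow p) (((-1) * (p - 2) * (-y) ^ (p - 2 - 1)) * y
          + (-y) ^ (p - 2) * 1) y := by
        refine h1.congr_of_eventuallyEq ?_
        filter_upwards [eventually_lt_nhds h] with z hz
        rw [spow, abs_of_neg hz]
      convert h3 using 1
      rw [abs_of_neg h, h2]; ring
    · have h1 : HasDerivAt (fun y : ℝ => y ^ (p - 2) * y)
          ((1 * (p - 2) * y ^ (p - 2 - 1)) * y + y ^ (p - 2) * 1) y :=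
        ((hasDerivAt_id y).rpow_const (Or.inl h.ne')).mul (hasDerivAt_id y)
      have h2 : y ^ (p - 2) = y ^ (p - 2 - 1) * y := by
        rw [← Real.rpow_add_one h.ne']; ring_nf
      have h3 : HasDerivAt (spow p) ((1 * (p - 2) * y ^ (p - 2 - 1)) * y + y ^ (p - 2) * 1) y := by
        refine h1.congr_of_eventuallyEq ?_
        filter_upwards [eventually_gt_nhds h] with z hz
        rw [spow, abs_of_pos hz]
      convert h3 using 1
      rw [abs_of_pos h, h2]; ring

theorem primPair_spow {p : ℝ} (hp : 2 < p) :
    PrimPair (spow p) (fun y => (p - 1) * |y| ^ (p - 2)) (fun y => |y| ^ p / p) where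
  deriv_prim y := by
    have := (hasDerivAt_abs_rpow y (by linarith : 1 < p)).div_const p
    refine this.congr_deriv ?_
    simp only [spow]; field_simp
  deriv y := hasDerivAt_spow hp y
  cont := continuous_const.mul (continuous_abs.rpow_const fun _ => Or.inr (by linarith))
  zero := by simp [spow]
  prim_zero := by simp [Real.zero_rpow (by linarith : p ≠ 0)]

/-- Regularised signed power. -/
def regPow (p ε y : ℝ) : ℝ := y * (y ^ 2 + ε ^ 2) ^ ((p - 2) / 2)

/-- Derivative of `regPow`. -/
def regPow' (p ε y : ℝ) : ℝ :=
  (y ^ 2 + ε ^ 2) ^ ((p - 2) / 2) + y * (2 * y * ((p - 2) / 2) * (y ^ 2 + ε ^ 2) ^ ((p - 2) / 2 - 1))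

/-- Primitive of `regPow`. -/
def regPrim (p ε y : ℝ) : ℝ := ((y ^ 2 + ε ^ 2) ^ (p / 2) - ε ^ p) / p

section reg

variable {p ε : ℝ} (hp : 1 < p) (hε : 0 < ε)
include hε

theorem reg_pos (y : ℝ) : 0 < y ^ 2 + ε ^ 2 := by positivity

theorem reg_hasDerivAt_base (y : ℝ) : HasDerivAt (fun y : ℝ => y ^ 2 + ε ^ 2) (2 * y) y := by
  simpa using (hasDerivAt_pow 2 y).add_const (ε ^ 2)

theorem reg_split (y : ℝ) (r : ℝ) :
    (y ^ 2 + ε ^ 2) ^ r = (y ^ 2 + ε ^ 2) ^ (r - 1) * (y ^ 2 + ε ^ 2) := by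
  rw [← Real.rpow_add_one (reg_pos hε y).ne']; ring_nf

include hp

theorem primPair_reg : PrimPair (regPow p ε) (regPow' p ε) (regPrim p ε) where
  deriv_prim y := by
    have := (((reg_hasDerivAt_base hε y).rpow_const (p := p / 2)
      (Or.inl (reg_pos hε y).ne')).sub_const (ε ^ p)).div_const p
    refine this.congr_deriv ?_
    simp only [regPow]
    rw [show (p - 2) / 2 = p / 2 - 1 by ring]
    have : p ≠ 0 := by linarith
    field_simp
  deriv y := by
    have := (hasDerivAt_id y).mul ((reg_hasDerivAt_base hε y).rpow_const (p := (p - 2) / 2)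
      (Or.inl (reg_pos hε y).ne'))
    refine this.congr_deriv ?_
    simp only [regPow', id]; ring
  cont := by
    have h : ∀ r : ℝ, Continuous fun y : ℝ => (y ^ 2 + ε ^ 2) ^ r := fun r =>
      (by fun_prop : Continuous fun y : ℝ => y ^ 2 + ε ^ 2).rpow_const
        fun y => Or.inl (reg_pos hε y).ne'
    have := h ((p - 2) / 2)
    have := h ((p - 2) / 2 - 1)
    unfold regPow'
    fun_prop
  zero := by simp [regPow]
  prim_zero := by
    have : (ε ^ 2) ^ (p / 2) = ε ^ p := by
      rw [← Real.rpow_natCast, ← Real.rpow_mul hε.le]; congr 1; push_cast; ring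
    simp [regPrim, this]

variable (hp2 : p ≤ 2)
include hp2

theorem regPow'_ge (y : ℝ) : (p - 1) * (y ^ 2 + ε ^ 2) ^ ((p - 2) / 2) ≤ regPow' p ε y := by
  have hs := reg_split hε y ((p - 2) / 2)
  have h0 : 0 < (y ^ 2 + ε ^ 2) ^ ((p - 2) / 2 - 1) := Real.rpow_pos_of_pos (reg_pos hε y) _
  rw [regPow', hs]
  have : 0 ≤ (2 - p) * ((y ^ 2 + ε ^ 2) ^ ((p - 2) / 2 - 1) * ε ^ 2) := by
    have : 0 ≤ 2 - p := by linarith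
    positivity
  nlinarith

theorem regPow'_nonneg (y : ℝ) : 0 ≤ regPow' p ε y := by
  refine le_trans ?_ (regPow'_ge hp hε hp2 y)
  have : 0 ≤ p - 1 := by linarith
  have := reg_pos hε y
  positivity

theorem reg_eps_le (y : ℝ) : ε ^ 2 * (y ^ 2 + ε ^ 2) ^ ((p - 2) / 2) ≤ ε ^ p := by
  have : ε ^ p = ε ^ 2 * (ε ^ 2) ^ ((p - 2) / 2) := by
    rw [← Real.rpow_natCast, ← Real.rpow_mul hε.le, ← Real.rpow_add hε]
    congr 1; push_cast; ring
  rw [this]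
  refine mul_le_mul_of_nonneg_left ?_ (by positivity)
  exact Real.rpow_le_rpow_of_nonpos (by positivity) (by nlinarith [sq_nonneg y]) (by linarith)

theorem reg_le (y : ℝ) : (y ^ 2 + ε ^ 2) ^ (p / 2) ≤ y * regPow p ε y + ε ^ p := by
  have hs := reg_split hε y (p / 2)
  rw [show p / 2 - 1 = (p - 2) / 2 by ring] at hs
  have := reg_eps_le hp hε hp2 y
  rw [hs, regPow]
  linarith

theorem regPrim_sub (y : ℝ) : |p * regPrim p ε y - y * regPow p ε y| ≤ ε ^ p := by
  have h1 : p * regPrim p ε y - y * regPow p ε y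
      = ε ^ 2 * (y ^ 2 + ε ^ 2) ^ ((p - 2) / 2) - ε ^ p := by
    have hs := reg_split hε y (p / 2)
    rw [show p / 2 - 1 = (p - 2) / 2 by ring] at hs
    have : p ≠ 0 := by linarith
    rw [regPrim, regPow, hs]; field_simp; ring
  have h2 := reg_eps_le hp hε hp2 y
  have h3 : 0 ≤ ε ^ 2 * (y ^ 2 + ε ^ 2) ^ ((p - 2) / 2) := by
    have := reg_pos hε y
    positivity
  have h4 : 0 ≤ ε ^ p := by positivity
  rw [h1, abs_le]; constructor <;> linarith

theorem regPow_young (y : ℝ) : |regPow p ε y| ^ (p / (p - 1)) ≤ y * regPow p ε y := by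
  rcases eq_or_ne y 0 with rfl | hy
  · have : p / (p - 1) ≠ 0 := div_ne_zero (by linarith) (by linarith)
    simp [regPow, Real.zero_rpow this]
  have hy' : 0 < |y| := abs_pos.2 hy
  set R := y ^ 2 + ε ^ 2 with hR
  have hRp : 0 < R := reg_pos hε y
  have e1 : |regPow p ε y| = |y| * R ^ ((p - 2) / 2) := by
    rw [regPow, abs_mul, abs_of_nonneg (Real.rpow_nonneg hRp.le _)]
  have e2 : y * regPow p ε y = |y| ^ 2 * R ^ ((p - 2) / 2) := by
    rw [sq_abs, regPow]; ring
  have hq : p / (p - 1) = 1 + 1 / (p - 1) := by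
    have : p - 1 ≠ 0 := by linarith
    field_simp; ring
  have hRy : R ^ ((p - 2) / 2) ≤ |y| ^ (p - 2) := by
    have : |y| ^ (p - 2) = (|y| ^ 2) ^ ((p - 2) / 2) := by
      rw [← Real.rpow_natCast, ← Real.rpow_mul hy'.le]; congr 1; push_cast; ring
    rw [this, sq_abs]
    exact Real.rpow_le_rpow_of_nonpos (by positivity) (by rw [hR]; nlinarith [sq_nonneg ε])
      (by linarith)
  have hpos : 0 < |y| * R ^ ((p - 2) / 2) := by positivity
  have h5 : (|y| * R ^ ((p - 2) / 2)) ^ (1 / (p - 1)) ≤ |y| := by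
    have : |y| * R ^ ((p - 2) / 2) ≤ |y| ^ (p - 1) := by
      calc _ ≤ |y| * |y| ^ (p - 2) := by gcongr
        _ = _ := by rw [mul_comm, ← Real.rpow_add_one hy'.ne']; ring_nf
    calc _ ≤ (|y| ^ (p - 1)) ^ (1 / (p - 1)) :=
          Real.rpow_le_rpow hpos.le this (by
            have : 0 < p - 1 := by linarith
            positivity)
      _ = |y| := by
          rw [← Real.rpow_mul hy'.le, mul_one_div_cancel (by linarith), Real.rpow_one]
  rw [e1, e2, hq, Real.rpow_add hpos, Real.rpow_one]
  calc _ ≤ |y| * R ^ ((p - 2) / 2) * |y| := by gcongr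
    _ = _ := by ring

end reg

end Powers

section Operator

/-- A linear height function together with a time direction, a normal direction and
tangential directions. -/
structure Geo (E ι : Type*) [NormedAddCommGroup E] [NormedSpace ℝ E] where
  ht : E →L[ℝ] ℝ
  τ : E
  n : E
  e : ι → E
  ht_τ : ht τ = 0
  ht_n : ht n = 1
  ht_e : ∀ i, ht (e i) = 0

/-- Coefficients depending on the height only. -/
structure Coef (ι : Type*) where
  m : ℝ → ℝ
  q : ℝ → ℝ
  b : ι → ℝ → ℝ
  a : ι → ι → ℝ → ℝ

/-- An integrable function with vanishing integral. -/
def ZeroInt {X : Type*} [MeasurableSpace X] (μ : Measure X) (F : X → ℝ) : Prop :=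
  Integrable F μ ∧ ∫ z, F z ∂μ = 0

namespace ZeroInt

variable {X : Type*} [MeasurableSpace X] {μ : Measure X} {F G : X → ℝ}

theorem add (hF : ZeroInt μ F) (hG : ZeroInt μ G) : ZeroInt μ (fun z => F z + G z) :=
  ⟨hF.1.add hG.1, by rw [integral_add hF.1 hG.1, hF.2, hG.2, add_zero]⟩

theorem sub (hF : ZeroInt μ F) (hG : ZeroInt μ G) : ZeroInt μ (fun z => F z - G z) :=
  ⟨hF.1.sub hG.1, by rw [integral_sub hF.1 hG.1, hF.2, hG.2, sub_zero]⟩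

theorem sum {ι : Type*} {s : Finset ι} {F : ι → X → ℝ} (h : ∀ i, ZeroInt μ (F i)) :
    ZeroInt μ (fun z => ∑ i ∈ s, F i z) :=
  ⟨integrable_finsetSum s fun i _ => (h i).1, by
    rw [integral_finsetSum s fun i _ => (h i).1]
    exact Finset.sum_eq_zero fun i _ => (h i).2⟩

theorem integral_eq (h : ZeroInt μ (fun z => F z - G z)) (hG : Integrable G μ) :
    ∫ z, F z ∂μ = ∫ z, G z ∂μ := by
  have hF : Integrable F μ := by
    have := h.1.add hG
    refine this.congr (Filter.Eventually.of_forall fun z => by simp)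
  have := h.2
  rw [integral_sub hF hG] at this
  linarith

end ZeroInt

variable {E ι : Type*} [NormedAddCommGroup E] [NormedSpace ℝ E] [MeasurableSpace E] [BorelSpace E]
  [FiniteDimensional ℝ E] [Fintype ι] (μ : Measure E) [μ.IsAddHaarMeasure]

/-- The operator `m ∂_τ u + q u - ∂_n ∂_n u - b_j ∂_j ∂_n u - a_{ij} ∂_i ∂_j u`. -/
def Geo.op (G : Geo E ι) (c : Coef ι) (u : E → ℝ) (z : E) : ℝ :=
  c.m (G.ht z) * dirD G.τ u z + c.q (G.ht z) * u z - dirD G.n (dirD G.n u) z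
    - ∑ j, c.b j (G.ht z) * dirD (G.e j) (dirD G.n u) z
    - ∑ i, ∑ j, c.a i j (G.ht z) * dirD (G.e i) (dirD (G.e j) u) z

/-- The quadratic form associated with the operator `Geo.op`. -/
def Geo.form (G : Geo E ι) (c : Coef ι) (v : E → ℝ) (z : E) : ℝ :=
  dirD G.n v z ^ 2 + ∑ j, c.b j (G.ht z) * (dirD (G.e j) v z * dirD G.n v z)
    + ∑ i, ∑ j, c.a i j (G.ht z) * (dirD (G.e i) v z * dirD (G.e j) v z)

/-- The squared length of the gradient in the spatial directions. -/
def Geo.gradSq (G : Geo E ι) (v : E → ℝ) (z : E) : ℝ :=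
  dirD G.n v z ^ 2 + ∑ j, dirD (G.e j) v z ^ 2

theorem Geo.gradSq_nonneg (G : Geo E ι) (v : E → ℝ) (z : E) : 0 ≤ G.gradSq v z :=
  add_nonneg (sq_nonneg _) (Finset.sum_nonneg fun _ _ => sq_nonneg _)

/-- The coefficients are measurable and bounded on compact sets of positive height. -/
structure Coef.Loc (c : Coef ι) (G : Geo E ι) (K : Set E) : Prop where
  m : BddMeas K (fun z => c.m (G.ht z))
  q : BddMeas K (fun z => c.q (G.ht z))
  b : ∀ j, BddMeas K (fun z => c.b j (G.ht z))
  a : ∀ i j, BddMeas K (fun z => c.a i j (G.ht z))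

/-- A function of the height with two derivatives on the positive half-line. -/
structure Weight (G : Geo E ι) (K : Set E) (s s' s'' : ℝ → ℝ) : Prop where
  bm : BddMeas K (fun z => s (G.ht z))
  bm' : BddMeas K (fun z => s' (G.ht z))
  bm'' : BddMeas K (fun z => s'' (G.ht z))
  d1 : ∀ t, 0 < t → HasDerivAt s (s' t) t
  d2 : ∀ t, 0 < t → HasDerivAt s' (s'' t) t

variable {μ} {G : Geo E ι} {c : Coef ι} {K : Set E} (hK : IsCompact K) (hpos : ∀ z ∈ K, 0 < G.ht z)
include hK

omit [Fintype ι] in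
theorem zeroInt_tan {f g : E → ℝ} {v : E} (hf : BddMeas K f) (hg : IsTest 1 K g)
    (hd : ∀ z, ∀ t : ℝ, f (z + t • v) = f z) : ZeroInt μ (fun z => f z * dirD v g z) :=
  ⟨(hf.mul (hg.bddMeas_dirD le_rfl hK v)).integrable hK.measurableSet hK.measure_lt_top.ne
    fun z hz => by
      rw [image_eq_zero_of_notMem_tsupport fun h => hz (hg.dirD_supp v h), mul_zero],
    integral_mul_dirD_eq_zero hK hf hg hd⟩

include hpos in
omit [Fintype ι] in
theorem zeroInt_nor {P P' : ℝ → ℝ} {g : E → ℝ} (hP : BddMeas K (fun z => P (G.ht z)))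
    (hP' : BddMeas K (fun z => P' (G.ht z))) (hd : ∀ t, 0 < t → HasDerivAt P (P' t) t)
    (hg : IsTest 1 K g) :
    ZeroInt μ (fun z => P (G.ht z) * dirD G.n g z + P' (G.ht z) * g z) := by
  have i1 : Integrable (fun z => P (G.ht z) * dirD G.n g z) μ :=
    (hP.mul (hg.bddMeas_dirD le_rfl hK G.n)).integrable hK.measurableSet hK.measure_lt_top.ne
    fun z hz => by
      rw [image_eq_zero_of_notMem_tsupport fun h => hz (hg.dirD_supp G.n h), mul_zero]
  have i2 : Integrable (fun z => P' (G.ht z) * g z) μ :=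
    (hP'.mul (hg.bddMeas hK)).integrable hK.measurableSet hK.measure_lt_top.ne
    fun z hz => by rw [hg.zero_off hz, mul_zero]
  refine ⟨i1.add i2, ?_⟩
  rw [integral_add i1 i2, integral_mul_dirD hK hP hP' hg, neg_add_cancel]
  intro z hz
  have h1 := (hd _ (hpos z hz)).comp_hasFDerivAt z G.ht.hasFDerivAt
  have h2 := h1.hasLineDerivAt G.n
  simpa [G.ht_n, Function.comp_def] using h2

omit hK

theorem Geo.ht_add_of_zero {v : E} (hv : G.ht v = 0) (z : E) (t : ℝ) :
    G.ht (z + t • v) = G.ht z := by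
  simp [hv]

theorem dirD_psi_mul {ψ ψ' Ψ : ℝ → ℝ} (h : PrimPair ψ ψ' Ψ) {y w : E → ℝ} {z : E}
    (hy : DifferentiableAt ℝ y z) (hw : DifferentiableAt ℝ w z) (v : E) :
    dirD v (fun z => ψ (y z) * w z) z = ψ (y z) * dirD v w z + ψ' (y z) * dirD v y z * w z := by
  have h1 : DifferentiableAt ℝ (fun z => ψ (y z)) z :=
    (h.contDiff.differentiable (by simp) _).comp z hy
  rw [dirD_mul h1 hw, dirD_comp hy (h.deriv _)]
  ring

section bdd

include hK

theorem Geo.bddMeas_op (hc : c.Loc G K) {y : E → ℝ} (hy : IsTest (⊤ : ℕ∞) K y) :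
    BddMeas K (G.op c y) := by
  have b7 := hc.m
  have b8 := hc.q
  have b9 := hc.b
  have b10 := hc.a
  have b1 := hy.bddMeas hK
  have b2 := fun v => (hy.dirD v).bddMeas hK
  have b3 := fun v w => ((hy.dirD v).dirD w).bddMeas hK
  exact ((((b7.mul (b2 _)).add (b8.mul b1)).sub (b3 _ _)).sub
    (BddMeas.sum fun j => (b9 j).mul (b3 _ _))).sub
    (BddMeas.sum fun i => BddMeas.sum fun j => (b10 i j).mul (b3 _ _))

theorem Geo.bddMeas_form (hc : c.Loc G K) {y : E → ℝ} (hy : IsTest (⊤ : ℕ∞) K y) :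
    BddMeas K (G.form c y) := by
  have b2 := fun v => (hy.dirD v).bddMeas hK
  exact (((b2 _).pow 2).add (BddMeas.sum fun j => (hc.b j).mul ((b2 _).mul (b2 _)))).add
    (BddMeas.sum fun i => BddMeas.sum fun j => (hc.a i j).mul ((b2 _).mul (b2 _)))

theorem Geo.bddMeas_gradSq {y : E → ℝ} (hy : IsTest (⊤ : ℕ∞) K y) :
    BddMeas K (G.gradSq y) := by
  have b2 := fun v => (hy.dirD v).bddMeas hK
  exact ((b2 _).pow 2).add (BddMeas.sum fun j => (b2 _).pow 2)

end bdd

theorem Geo.op_zero_off {y : E → ℝ} (hy : IsTest (⊤ : ℕ∞) K y) {z : E} (hz : z ∉ K) :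
    G.op c y z = 0 := by
  simp [Geo.op, hy.zero_off hz, (hy.dirD _).zero_off hz, ((hy.dirD _).dirD _).zero_off hz]

theorem Geo.gradSq_zero_off {y : E → ℝ} (hy : IsTest (⊤ : ℕ∞) K y) {z : E} (hz : z ∉ K) :
    G.gradSq y z = 0 := by
  simp [Geo.gradSq, (hy.dirD _).zero_off hz]

theorem Geo.form_zero_off {y : E → ℝ} (hy : IsTest (⊤ : ℕ∞) K y) {z : E} (hz : z ∉ K) :
    G.form c y z = 0 := by
  simp [Geo.form, (hy.dirD _).zero_off hz]

include hK hpos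

theorem energy_identity (hc : c.Loc G K) {ψ ψ' Ψ : ℝ → ℝ} (hψ : PrimPair ψ ψ' Ψ)
    {s s' s'' φ φ' φ'' : ℝ → ℝ} (hs : Weight G K s s' s'') (hφ : Weight G K φ φ' φ'')
    {y : E → ℝ} (hy : IsTest (⊤ : ℕ∞) K y) :
    ∫ z, φ (G.ht z) * ψ (y z) * (s (G.ht z) * G.op c y z - 2 * s' (G.ht z) * dirD G.n y z
        - s'' (G.ht z) * y z - ∑ j, c.b j (G.ht z) * s' (G.ht z) * dirD (G.e j) y z) ∂μ
      = ∫ z, (c.q (G.ht z) * s (G.ht z) * φ (G.ht z) * (y z * ψ (y z))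
        + s (G.ht z) * φ (G.ht z) * ψ' (y z) * G.form c y z
        + (s'' (G.ht z) * φ (G.ht z) - s (G.ht z) * φ'' (G.ht z)) * Ψ (y z)
        - s'' (G.ht z) * φ (G.ht z) * (y z * ψ (y z))) ∂μ := by
  have hle : (1 : WithTop ℕ∞) ≤ ((⊤ : ℕ∞) : WithTop ℕ∞) := WithTop.coe_le_coe.2 le_top
  have hn := hy.dirD G.n
  have he := fun j => hy.dirD (G.e j)
  have tψ : IsTest 1 K (fun z => ψ (y z)) := (hy.of_le hle).comp hψ.contDiff hψ.zero
  have tΨ : IsTest 1 K (fun z => Ψ (y z)) := (hy.of_le hle).comp hψ.contDiff_prim hψ.prim_zero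
  have b1 := hs.bm
  have b2 := hs.bm'
  have b3 := hs.bm''
  have b4 := hφ.bm
  have b5 := hφ.bm'
  have b6 := hφ.bm''
  have b7 := hc.m
  have b8 := hc.q
  have b9 := hc.b
  have b10 := hc.a
  have b11 := hy.bddMeas hK
  have b12 := tψ.bddMeas hK
  have b13 := tΨ.bddMeas hK
  have b14 : BddMeas K (fun z => ψ' (y z)) := b11.cont_comp hψ.cont
  have b15 := hn.bddMeas hK
  have b16 := fun j => (he j).bddMeas hK
  have Z1 : ZeroInt μ (fun z => (c.m (G.ht z) * s (G.ht z) * φ (G.ht z)) *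
      dirD G.τ (fun z => Ψ (y z)) z) :=
    zeroInt_tan hK (by solve_by_elim (maxDepth := 40) [BddMeas.mul, BddMeas.add, BddMeas.sub]) tΨ fun z t => by rw [Geo.ht_add_of_zero G.ht_τ]
  have Z2 : ZeroInt μ (fun z => (s (G.ht z) * φ (G.ht z)) *
      dirD G.n (fun z => ψ (y z) * dirD G.n y z) z
      + (s' (G.ht z) * φ (G.ht z) + s (G.ht z) * φ' (G.ht z)) * (ψ (y z) * dirD G.n y z)) :=
    zeroInt_nor (P := fun t => s t * φ t) (P' := fun t => s' t * φ t + s t * φ' t) hK hpos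
      (by solve_by_elim (maxDepth := 40) [BddMeas.mul, BddMeas.add, BddMeas.sub]) (by solve_by_elim (maxDepth := 40) [BddMeas.mul, BddMeas.add, BddMeas.sub]) (fun t ht => (hs.d1 t ht).mul (hφ.d1 t ht))
      (tψ.mul (hn.of_le hle))
  have Z3 : ZeroInt μ (fun z => (s (G.ht z) * φ' (G.ht z) - s' (G.ht z) * φ (G.ht z)) *
      dirD G.n (fun z => Ψ (y z)) z
      + (s (G.ht z) * φ'' (G.ht z) - s'' (G.ht z) * φ (G.ht z)) * Ψ (y z)) :=
    zeroInt_nor (P := fun t => s t * φ' t - s' t * φ t)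
      (P' := fun t => s t * φ'' t - s'' t * φ t) hK hpos (by solve_by_elim (maxDepth := 40) [BddMeas.mul, BddMeas.add, BddMeas.sub]) (by solve_by_elim (maxDepth := 40) [BddMeas.mul, BddMeas.add, BddMeas.sub])
      (fun t ht => (((hs.d1 t ht).mul (hφ.d2 t ht)).sub
        ((hs.d2 t ht).mul (hφ.d1 t ht))).congr_deriv (by ring)) tΨ
  have Z4 : ZeroInt μ (fun z => ∑ j, (c.b j (G.ht z) * s (G.ht z) * φ (G.ht z)) *
      dirD (G.e j) (fun z => ψ (y z) * dirD G.n y z) z) :=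
    ZeroInt.sum fun j => zeroInt_tan hK (by solve_by_elim (maxDepth := 40) [BddMeas.mul, BddMeas.add, BddMeas.sub]) (tψ.mul (hn.of_le hle)) fun z t => by
      rw [Geo.ht_add_of_zero (G.ht_e j)]
  have Z5 : ZeroInt μ (fun z => ∑ j, (c.b j (G.ht z) * s' (G.ht z) * φ (G.ht z)) *
      dirD (G.e j) (fun z => Ψ (y z)) z) :=
    ZeroInt.sum fun j => zeroInt_tan hK (by solve_by_elim (maxDepth := 40) [BddMeas.mul, BddMeas.add, BddMeas.sub]) tΨ fun z t => by
      rw [Geo.ht_add_of_zero (G.ht_e j)]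
  have Z6 : ZeroInt μ (fun z => ∑ i, ∑ j, (c.a i j (G.ht z) * s (G.ht z) * φ (G.ht z)) *
      dirD (G.e i) (fun z => ψ (y z) * dirD (G.e j) y z) z) :=
    ZeroInt.sum fun i => ZeroInt.sum fun j => zeroInt_tan hK (by solve_by_elim (maxDepth := 40) [BddMeas.mul, BddMeas.add, BddMeas.sub])
      (tψ.mul ((he j).of_le hle)) fun z t => by rw [Geo.ht_add_of_zero (G.ht_e i)]
  refine ZeroInt.integral_eq ?_ ?_
  · have Z := ((((Z1.sub Z2).add Z3).sub Z4).sub Z5).sub Z6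
    convert Z using 2 with z
    have dy := hy.differentiableAt hle z
    have dn := hn.differentiableAt hle z
    have de := fun j => (he j).differentiableAt hle z
    simp only [dirD_psi_mul hψ dy dn, dirD_psi_mul hψ dy (de _), dirD_comp dy (hψ.deriv_prim _),
      Geo.op, Geo.form]
    have e4 : ∑ j, (c.b j (G.ht z) * s (G.ht z) * φ (G.ht z)) *
        (ψ (y z) * dirD (G.e j) (dirD G.n y) z + ψ' (y z) * dirD (G.e j) y z * dirD G.n y z)
        = s (G.ht z) * φ (G.ht z) * ψ (y z) * (∑ j, c.b j (G.ht z) * dirD (G.e j) (dirD G.n y) z)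
        + s (G.ht z) * φ (G.ht z) * ψ' (y z) *
          ∑ j, c.b j (G.ht z) * (dirD (G.e j) y z * dirD G.n y z) := by
      rw [Finset.mul_sum, Finset.mul_sum, ← Finset.sum_add_distrib]
      exact Finset.sum_congr rfl fun j _ => by ring
    have e5 : ∑ j, (c.b j (G.ht z) * s' (G.ht z) * φ (G.ht z)) * (ψ (y z) * dirD (G.e j) y z)
        = φ (G.ht z) * ψ (y z) * ∑ j, c.b j (G.ht z) * s' (G.ht z) * dirD (G.e j) y z := by
      rw [Finset.mul_sum]
      exact Finset.sum_congr rfl fun j _ => by ring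
    have e6 : ∑ i, ∑ j, (c.a i j (G.ht z) * s (G.ht z) * φ (G.ht z)) *
        (ψ (y z) * dirD (G.e i) (dirD (G.e j) y) z
          + ψ' (y z) * dirD (G.e i) y z * dirD (G.e j) y z)
        = s (G.ht z) * φ (G.ht z) * ψ (y z) *
          (∑ i, ∑ j, c.a i j (G.ht z) * dirD (G.e i) (dirD (G.e j) y) z)
        + s (G.ht z) * φ (G.ht z) * ψ' (y z) *
          ∑ i, ∑ j, c.a i j (G.ht z) * (dirD (G.e i) y z * dirD (G.e j) y z) := by
      simp only [Finset.mul_sum, ← Finset.sum_add_distrib]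
      exact Finset.sum_congr rfl fun i _ => Finset.sum_congr rfl fun j _ => by ring
    rw [e4, e5, e6]
    ring
  · refine BddMeas.integrable (K := K) ?_ hK.measurableSet hK.measure_lt_top.ne ?_
    · have := Geo.bddMeas_form hK hc hy
      solve_by_elim (maxDepth := 40) [BddMeas.mul, BddMeas.add, BddMeas.sub]
    · intro z hz
      simp [hy.zero_off hz, hψ.zero, hψ.prim_zero, Geo.form_zero_off hy hz]

end Operator

section Weights

/-- The weight `A t^r (1 + κ t^β)^k`. -/
def wt (A r k κ β t : ℝ) : ℝ := A * (t ^ r * (1 + κ * t ^ β) ^ k)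

/-- The quantity `κ t^β / (1 + κ t^β)`. -/
def wfrac (κ β t : ℝ) : ℝ := κ * t ^ β / (1 + κ * t ^ β)

/-- First derivative of `wt`. -/
def wt' (A r k κ β t : ℝ) : ℝ := wt A r k κ β t * ((r + k * β * wfrac κ β t) / t)

/-- Second derivative of `wt`. -/
def wt'' (A r k κ β t : ℝ) : ℝ :=
  wt A r k κ β t * (((r + k * β * wfrac κ β t) ^ 2 - (r + k * β * wfrac κ β t)
    + k * β * β * (wfrac κ β t * (1 - wfrac κ β t))) / t ^ 2)

section derivs

variable {A r k κ β t : ℝ} (hκ : 0 ≤ κ) (ht : 0 < t)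
include hκ ht

theorem wt_base_pos : 0 < 1 + κ * t ^ β := by positivity

theorem wfrac_nonneg : 0 ≤ wfrac κ β t := by unfold wfrac; positivity

theorem wfrac_le_one : wfrac κ β t ≤ 1 := by
  unfold wfrac
  rw [div_le_one (wt_base_pos hκ ht)]; linarith

theorem wfrac_le : wfrac κ β t ≤ κ * t ^ β := by
  unfold wfrac
  exact div_le_self (by positivity) (by
    have : 0 ≤ κ * t ^ β := by positivity
    linarith)

theorem hasDerivAt_base : HasDerivAt (fun t : ℝ => 1 + κ * t ^ β) (κ * (β * t ^ β / t)) t := by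
  have := ((Real.hasDerivAt_rpow_const (p := β) (Or.inl ht.ne')).const_mul κ).const_add 1
  refine this.congr_deriv ?_
  rw [Real.rpow_sub_one ht.ne']; ring

theorem hasDerivAt_wt : HasDerivAt (wt A r k κ β) (wt' A r k κ β t) t := by
  have hb := wt_base_pos (β := β) hκ ht
  have h1 := (hasDerivAt_base (β := β) hκ ht).rpow_const (p := k) (Or.inl hb.ne')
  have h2 := Real.hasDerivAt_rpow_const (p := r) (Or.inl ht.ne')
  refine ((h2.mul h1).const_mul A).congr_deriv ?_
  rw [Real.rpow_sub_one ht.ne', Real.rpow_sub_one hb.ne', wt', wt, wfrac]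
  field_simp

theorem hasDerivAt_wfrac :
    HasDerivAt (wfrac κ β) (β * (wfrac κ β t * (1 - wfrac κ β t)) / t) t := by
  have hb := wt_base_pos (β := β) hκ ht
  have h0 := hasDerivAt_base (β := β) hκ ht
  have h1 : HasDerivAt (fun t : ℝ => κ * t ^ β) (κ * (β * t ^ β / t)) t := by
    simpa using h0.sub_const 1
  refine (h1.div h0 hb.ne').congr_deriv ?_
  rw [wfrac]
  field_simp

theorem hasDerivAt_wt' : HasDerivAt (wt' A r k κ β) (wt'' A r k κ β t) t := by
  have h1 := hasDerivAt_wt (A := A) (r := r) (k := k) (β := β) hκ ht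
  have h2 := (((hasDerivAt_wfrac (β := β) hκ ht).const_mul (k * β)).const_add r).div
    (hasDerivAt_id t) ht.ne'
  refine (h1.mul h2).congr_deriv ?_
  simp only [wt', wt'', id, Pi.div_apply]
  field_simp
  ring

end derivs

theorem measurable_wt (A r k κ β : ℝ) : Measurable (wt A r k κ β) := by
  unfold wt; fun_prop

theorem measurable_wfrac (κ β : ℝ) : Measurable (wfrac κ β) := by
  unfold wfrac; fun_prop

variable {E ι : Type*} [NormedAddCommGroup E] [NormedSpace ℝ E] [MeasurableSpace E] [BorelSpace E]
  {G : Geo E ι} {K : Set E} (hK : IsCompact K) (hpos : ∀ z ∈ K, 0 < G.ht z)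
include hK hpos

theorem bddMeas_ht {f : ℝ → ℝ} (hm : Measurable f) (hc : ContinuousOn f (Ioi 0)) :
    BddMeas K (fun z => f (G.ht z)) := by
  obtain ⟨C, hC⟩ := hK.exists_bound_of_continuousOn
    (hc.comp G.ht.continuous.continuousOn fun z hz => hpos z hz)
  exact ⟨hm.comp G.ht.measurable, C, hC⟩

theorem bddMeas_ht_rpow (r : ℝ) : BddMeas K (fun z => G.ht z ^ r) :=
  bddMeas_ht (f := fun t => t ^ r) hK hpos (by fun_prop)
    (ContinuousOn.rpow_const continuousOn_id fun t ht => Or.inl (ne_of_gt ht))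

theorem bddMeas_ht_of_le {f g : ℝ → ℝ} (hm : Measurable f)
    (hg : BddMeas K (fun z => g (G.ht z))) (hfg : ∀ t, 0 < t → |f t| ≤ g t) :
    BddMeas K (fun z => f (G.ht z)) := by
  obtain ⟨C, hC⟩ := hg.bdd
  exact ⟨hm.comp G.ht.measurable, C, fun z hz =>
    (hfg _ (hpos z hz)).trans ((le_abs_self _).trans (hC z hz))⟩

theorem weight_wt {κ : ℝ} (hκ : 0 ≤ κ) (A r k β : ℝ) :
    Weight G K (wt A r k κ β) (wt' A r k κ β) (wt'' A r k κ β) := by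
  have c1 : ContinuousOn (wt A r k κ β) (Ioi 0) := fun t ht =>
    (hasDerivAt_wt hκ ht).continuousAt.continuousWithinAt
  have c2 : ContinuousOn (wt' A r k κ β) (Ioi 0) := fun t ht =>
    (hasDerivAt_wt' hκ ht).continuousAt.continuousWithinAt
  have c3 : ContinuousOn (wfrac κ β) (Ioi 0) := fun t ht =>
    (hasDerivAt_wfrac hκ ht).continuousAt.continuousWithinAt
  have m1 := measurable_wt A r k κ β
  have m3 := measurable_wfrac κ β
  have hne : ∀ t ∈ Ioi (0 : ℝ), t ^ 2 ≠ 0 := fun t ht => pow_ne_zero 2 (ne_of_gt ht)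
  refine ⟨bddMeas_ht hK hpos m1 c1, bddMeas_ht hK hpos ?_ c2, bddMeas_ht hK hpos ?_ ?_,
    fun t ht => hasDerivAt_wt hκ ht, fun t ht => hasDerivAt_wt' hκ ht⟩
  · unfold wt'; fun_prop
  · unfold wt''; fun_prop
  · unfold wt''
    refine c1.mul (ContinuousOn.div ?_ ?_ hne) <;> fun_prop

end Weights

section Pointwise

/-- The scale-invariant size of the zero-order coefficient. -/
def rho (Λ β t : ℝ) : ℝ := Λ * t ^ β

/-- The reciprocal of the natural length scale at height `t`. -/
def th (Λ β t : ℝ) : ℝ := (1 + rho Λ β t) / t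

/-- The weight of the gradient term. -/
def wA (p γ Λ β t : ℝ) : ℝ := t ^ (γ - p) * rho Λ β t ^ p

section

variable {Λ β t : ℝ} (hΛ : 0 < Λ) (ht : 0 < t)
include hΛ ht

theorem rho_pos : 0 < rho Λ β t := by unfold rho; positivity

theorem th_pos : 0 < th Λ β t := by
  have := rho_pos (β := β) hΛ ht
  unfold th; positivity

theorem wA_pos (p γ : ℝ) : 0 < wA p γ Λ β t := by
  have := rho_pos (β := β) hΛ ht
  unfold wA; positivity

end

theorem one_add_mul_rpow_bounds {ε x : ℝ} (hε : 0 < ε) (hε1 : ε ≤ 1) (hx : 0 ≤ x) (k : ℝ) :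
    ε ^ |k| * (1 + x) ^ k ≤ (1 + ε * x) ^ k ∧
      (1 + ε * x) ^ k ≤ ε ^ (-|k|) * (1 + x) ^ k := by
  have h1 : ε * (1 + x) ≤ 1 + ε * x := by nlinarith
  have h2 : 1 + ε * x ≤ 1 + x := by nlinarith
  have hX : 0 < 1 + x := by linarith
  have hY : 0 < 1 + ε * x := by positivity
  have hp : 0 < (1 + x) ^ k := Real.rpow_pos_of_pos hX k
  have s1 : ε ^ |k| ≤ 1 := Real.rpow_le_one hε.le hε1 (abs_nonneg k)
  have s2 : 1 ≤ ε ^ (-|k|) := Real.one_le_rpow_of_pos_of_le_one_of_nonpos hε hε1 (by simp)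
  rcases le_total 0 k with hk | hk
  · rw [abs_of_nonneg hk] at *
    constructor
    · rw [← Real.mul_rpow hε.le hX.le]
      exact Real.rpow_le_rpow (by positivity) h1 hk
    · calc (1 + ε * x) ^ k ≤ (1 + x) ^ k := Real.rpow_le_rpow hY.le h2 hk
        _ ≤ ε ^ (-k) * (1 + x) ^ k := le_mul_of_one_le_left hp.le s2
  · rw [abs_of_nonpos hk] at *
    constructor
    · calc ε ^ (-k) * (1 + x) ^ k ≤ (1 + x) ^ k := mul_le_of_le_one_left hp.le s1
        _ ≤ _ := Real.rpow_le_rpow_of_nonpos hY h2 hk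
    · rw [neg_neg, ← Real.mul_rpow hε.le hX.le]
      exact Real.rpow_le_rpow_of_nonpos (by positivity) h1 hk

set_option maxHeartbeats 1000000 in
/-- The weights for the zero-order estimate. -/
theorem exists_weights {ν β p γ : ℝ} (hν : 0 < ν) (hβ : 0 < β) (hβ1 : β < 1) (hp : 1 < p)
    (h1 : p - p * β - 1 < γ) (h2 : γ < 2 * p - 1) :
    ∃ σ k a b ε c C : ℝ, 0 < ε ∧ ε ≤ 1 ∧ 0 < c ∧ 0 < C ∧ a ∈ Icc (0 : ℝ) 1 ∧
      ∀ Λ t : ℝ, 0 < Λ → 0 < t →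
        (∀ q, ν * (rho Λ β t / t) ^ 2 ≤ q →
          c * th Λ β t ^ 2 * wt (Λ ^ σ) b k (ε * Λ) β t
            ≤ q * wt (Λ ^ σ) b k (ε * Λ) β t - wt'' (Λ ^ σ) b k (ε * Λ) β t ∧
          c * th Λ β t ^ 2 * wt 1 a 0 0 β t ≤ q * wt 1 a 0 0 β t - wt'' 1 a 0 0 β t) ∧
        wt (Λ ^ σ) b k (ε * Λ) β t * (th Λ β t ^ 2 * t ^ a) ^ (1 - p) ≤ C * t ^ γ ∧
        wA p γ Λ β t * th Λ β t ^ p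
          ≤ C * (th Λ β t ^ 2 * wt (Λ ^ σ) b k (ε * Λ) β t * (t ^ a) ^ (1 - p)) := by
  obtain ⟨σ, hσ0, hσp, hm1, hm2⟩ : ∃ σ : ℝ, 0 ≤ σ ∧ σ ≤ p ∧ 1 - p < γ + 2 - 2 * p + σ * β ∧
      γ + 2 - 2 * p + σ * β < 1 := by
    by_cases h : 1 - p < γ + 2 - 2 * p
    · exact ⟨0, le_rfl, by linarith, by linarith, by linarith⟩
    · push Not at h
      by_cases h' : γ + 2 - 2 * p + p * β < 1
      · exact ⟨p, by linarith, le_rfl, by linarith, h'⟩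
      · push Not at h'
        have hv : -p / 2 + 1 - (γ + 2 - 2 * p) ≤ p * β := by linarith
        refine ⟨(1 - p / 2 - (γ + 2 - 2 * p)) / β, ?_, ?_, ?_, ?_⟩
        · apply div_nonneg _ hβ.le; linarith
        · rw [div_le_iff₀ hβ]; linarith
        · rw [div_mul_cancel₀ _ hβ.ne']; linarith
        · rw [div_mul_cancel₀ _ hβ.ne']; linarith
  set m0 := γ + 2 - 2 * p + σ * β with hm0
  set b := (m0 + p - 1) / p with hb
  have hp0 : 0 < p := by linarith
  have hb0 : 0 < b := div_pos (by linarith) hp0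
  have hb1 : b < 1 := by rw [hb, div_lt_one hp0]; linarith
  have hbm : b + (1 - b) * (1 - p) = m0 := by
    rw [hb]; field_simp; ring
  set k := 2 * p - 2 - σ with hk
  set k' := k * β with hk'
  set C0 := 3 * |k'| + k' ^ 2 + 1 with hC0
  have hC0p : 0 < C0 := by positivity
  set B := b * (1 - b) with hB
  have hBp : 0 < B := mul_pos hb0 (by linarith)
  obtain ⟨ε, hε, hε1, hεB⟩ : ∃ ε : ℝ, 0 < ε ∧ ε ≤ 1 ∧ C0 ^ 2 * ε ^ 2 ≤ ν * B := by
    refine ⟨min 1 (Real.sqrt (ν * B) / C0), lt_min one_pos (by positivity), min_le_left _ _, ?_⟩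
    have h : min 1 (Real.sqrt (ν * B) / C0) ≤ Real.sqrt (ν * B) / C0 := min_le_right _ _
    have h0 : 0 ≤ min 1 (Real.sqrt (ν * B) / C0) := le_min zero_le_one (by positivity)
    have h3 : C0 * min 1 (Real.sqrt (ν * B) / C0) ≤ Real.sqrt (ν * B) := by
      rw [le_div_iff₀ hC0p] at h; linarith
    calc _ = (C0 * min 1 (Real.sqrt (ν * B) / C0)) ^ 2 := by ring
      _ ≤ Real.sqrt (ν * B) ^ 2 := by gcongr
      _ = ν * B := Real.sq_sqrt (by positivity)
  set D := ε ^ (-|k|) with hD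
  have hDp : 0 < D := Real.rpow_pos_of_pos hε _
  have hc0 : 0 < min ν B / 4 := by
    have := lt_min hν hBp
    linarith
  refine ⟨σ, k, 1 - b, b, ε, min ν B / 4, D, hε, hε1, hc0, hDp,
    ⟨by linarith, by linarith⟩, ?_⟩
  intro Λ t hΛ ht
  set ρ := rho Λ β t with hρ
  have hρp : 0 < ρ := rho_pos hΛ ht
  have hκ : 0 ≤ ε * Λ := by positivity
  have hερ : ε * Λ * t ^ β = ε * ρ := by rw [hρ, rho]; ring
  have hφ : wt (Λ ^ σ) b k (ε * Λ) β t = Λ ^ σ * t ^ b * (1 + ε * ρ) ^ k := by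
    rw [wt, hερ]; ring
  have hφp : 0 < wt (Λ ^ σ) b k (ε * Λ) β t := by rw [hφ]; positivity
  have hth : th Λ β t = (1 + ρ) / t := rfl
  obtain ⟨hbd1, hbd2⟩ := one_add_mul_rpow_bounds hε hε1 hρp.le k
  have hΛρ : Λ ^ σ * t ^ m0 = t ^ (γ + 2 - 2 * p) * ρ ^ σ := by
    rw [hρ, rho, Real.mul_rpow hΛ.le (by positivity), ← Real.rpow_mul ht.le, hm0, mul_comm σ β,
      Real.rpow_add ht]
    ring
  have hmn : min ν B / 4 * (1 + ρ) ^ 2 ≤ (ν * ρ ^ 2 + B) / 2 := by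
    have e1 : min ν B ≤ ν := min_le_left _ _
    have e2 : min ν B ≤ B := min_le_right _ _
    have : (1 + ρ) ^ 2 ≤ 2 * (1 + ρ ^ 2) := by linarith [add_pow_two 1 ρ, sub_sq 1 ρ, sq_nonneg (1 - ρ)]
    have e3 : min ν B * ρ ^ 2 ≤ ν * ρ ^ 2 := by gcongr
    have : min ν B / 4 * (1 + ρ) ^ 2 ≤ min ν B / 4 * (2 * (1 + ρ ^ 2)) := by gcongr
    linarith
  refine ⟨fun q hq => ⟨?_, ?_⟩, ?_, ?_⟩
  · set w := wfrac (ε * Λ) β t with hw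
    have w0 : 0 ≤ w := wfrac_nonneg hκ ht
    have w1 : w ≤ 1 := wfrac_le_one hκ ht
    have w2 : w ≤ ε * ρ := by rw [← hερ]; exact wfrac_le hκ ht
    have hX : (b + k * β * w) ^ 2 - (b + k * β * w) + k * β * β * (w * (1 - w))
        ≤ -B + C0 * w := by
      have i1 : (2 * b * k' - k') ≤ |k'| := by
        have : |2 * b * k' - k'| ≤ |k'| := by
          rw [show 2 * b * k' - k' = (2 * b - 1) * k' by ring, abs_mul]
          exact mul_le_of_le_one_left (abs_nonneg _) (by rw [abs_le]; constructor <;> linarith)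
        exact (le_abs_self _).trans this
      have i2 : k' * β * (1 - w) ≤ |k'| := by
        have : |k' * (β * (1 - w))| ≤ |k'| := by
          rw [abs_mul]
          refine mul_le_of_le_one_right (abs_nonneg _) ?_
          rw [abs_of_nonneg (mul_nonneg hβ.le (by linarith))]
          exact mul_le_one₀ hβ1.le (by linarith) (by linarith)
        calc _ = k' * (β * (1 - w)) := by ring
          _ ≤ _ := (le_abs_self _).trans this
      have i3 : k' ^ 2 * w ≤ k' ^ 2 := mul_le_of_le_one_right (sq_nonneg _) w1
      have : w * ((2 * b * k' - k') + k' * β * (1 - w) + k' ^ 2 * w) ≤ w * C0 := by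
        refine mul_le_mul_of_nonneg_left ?_ w0
        rw [hC0]
        have := abs_nonneg k'
        linarith
      rw [← hk']
      calc _ = -B + w * ((2 * b * k' - k') + k' * β * (1 - w) + k' ^ 2 * w) := by rw [hB]; ring
        _ ≤ _ := by linarith
    have hY : C0 * w ≤ (ν * ρ ^ 2 + B) / 2 := by
      have : C0 * w ≤ C0 * (ε * ρ) := by gcongr
      have h4 : (C0 * ε * ρ) ^ 2 ≤ (ν * ρ ^ 2) * B := by
        calc _ = (C0 ^ 2 * ε ^ 2) * ρ ^ 2 := by ring
          _ ≤ (ν * B) * ρ ^ 2 := by gcongr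
          _ = _ := by ring
      have h5 : C0 * ε * ρ ≤ (ν * ρ ^ 2 + B) / 2 := by
        refine abs_le_of_sq_le_sq' ?_ (by positivity) |>.2
        have := sq_nonneg (ν * ρ ^ 2 - B)
        calc _ ≤ _ := h4
          _ = ((ν * ρ ^ 2 + B) / 2) ^ 2 - (ν * ρ ^ 2 - B) ^ 2 / 4 := by ring
          _ ≤ _ := by linarith
      linarith
    have hq' : ν * ρ ^ 2 ≤ q * t ^ 2 := by
      have := mul_le_mul_of_nonneg_right hq (sq_nonneg t)
      calc ν * ρ ^ 2 = ν * (ρ / t) ^ 2 * t ^ 2 := by field_simp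
        _ ≤ _ := this
    rw [wt'', ← hw]
    have : q * wt (Λ ^ σ) b k (ε * Λ) β t - wt (Λ ^ σ) b k (ε * Λ) β t *
        (((b + k * β * w) ^ 2 - (b + k * β * w) + k * β * β * (w * (1 - w))) / t ^ 2)
        = (q * t ^ 2 - ((b + k * β * w) ^ 2 - (b + k * β * w) + k * β * β * (w * (1 - w)))) / t ^ 2
          * wt (Λ ^ σ) b k (ε * Λ) β t := by
      field_simp
    rw [this]
    refine mul_le_mul_of_nonneg_right ?_ hφp.le
    rw [hth, div_pow, mul_div_assoc']
    gcongr
    linarith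
  · have hq' : ν * ρ ^ 2 ≤ q * t ^ 2 := by
      have := mul_le_mul_of_nonneg_right hq (sq_nonneg t)
      calc ν * ρ ^ 2 = ν * (ρ / t) ^ 2 * t ^ 2 := by field_simp
        _ ≤ _ := this
    have hS : 0 < wt 1 (1 - b) 0 0 β t := by unfold wt; positivity
    have : q * wt 1 (1 - b) 0 0 β t - wt'' 1 (1 - b) 0 0 β t
        = (q * t ^ 2 + B) / t ^ 2 * wt 1 (1 - b) 0 0 β t := by
      rw [wt'', hB]; field_simp; ring
    rw [this]
    refine mul_le_mul_of_nonneg_right ?_ hS.le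
    rw [hth, div_pow, mul_div_assoc']
    gcongr
    have := mul_pos hν (pow_pos hρp 2)
    linarith
  · have e : wt (Λ ^ σ) b k (ε * Λ) β t * (th Λ β t ^ 2 * t ^ (1 - b)) ^ (1 - p)
        = t ^ γ * (ρ ^ σ * (1 + ε * ρ) ^ k * (1 + ρ) ^ (2 - 2 * p)) := by
      rw [hφ, Real.mul_rpow (by positivity) (by positivity), ← Real.rpow_mul ht.le, hth,
        ← Real.rpow_natCast, ← Real.rpow_mul (by positivity),
        Real.div_rpow (by positivity) ht.le]
      have e1 : t ^ γ = t ^ (γ + 2 - 2 * p) / t ^ (((2 : ℕ) : ℝ) * (1 - p)) := by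
        rw [← Real.rpow_sub ht]; congr 1; push_cast; ring
      rw [e1, show 2 - 2 * p = ((2 : ℕ) : ℝ) * (1 - p) by push_cast; ring]
      have e2 : Λ ^ σ * (t ^ b * t ^ ((1 - b) * (1 - p))) = t ^ (γ + 2 - 2 * p) * ρ ^ σ := by
        rw [← Real.rpow_add ht, hbm, hΛρ]
      calc _ = Λ ^ σ * (t ^ b * t ^ ((1 - b) * (1 - p))) * (1 + ε * ρ) ^ k *
            ((1 + ρ) ^ (((2 : ℕ) : ℝ) * (1 - p)) / t ^ (((2 : ℕ) : ℝ) * (1 - p))) := by ring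
        _ = _ := by rw [e2]; ring
    rw [e, mul_comm D]
    refine mul_le_mul_of_nonneg_left ?_ (by positivity)
    calc ρ ^ σ * (1 + ε * ρ) ^ k * (1 + ρ) ^ (2 - 2 * p)
        ≤ (1 + ρ) ^ σ * (D * (1 + ρ) ^ k) * (1 + ρ) ^ (2 - 2 * p) := by
          have : ρ ^ σ ≤ (1 + ρ) ^ σ := Real.rpow_le_rpow hρp.le (by linarith) hσ0
          gcongr
      _ = D * ((1 + ρ) ^ σ * (1 + ρ) ^ k * (1 + ρ) ^ (2 - 2 * p)) := by ring
      _ = D := by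
          rw [← Real.rpow_add (by positivity), ← Real.rpow_add (by positivity),
            show σ + k + (2 - 2 * p) = 0 by rw [hk]; ring, Real.rpow_zero, mul_one]
  · have e : th Λ β t ^ 2 * wt (Λ ^ σ) b k (ε * Λ) β t * (t ^ (1 - b)) ^ (1 - p)
        = t ^ (γ - 2 * p) * (ρ ^ σ * (1 + ρ) ^ (2 : ℝ) * (1 + ε * ρ) ^ k) := by
      rw [hφ, ← Real.rpow_mul ht.le, hth]
      have e1 : t ^ (γ - 2 * p) = t ^ (γ + 2 - 2 * p) / t ^ 2 := by
        rw [← Real.rpow_natCast, ← Real.rpow_sub ht]; congr 1; push_cast; ring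
      have e2 : Λ ^ σ * (t ^ b * t ^ ((1 - b) * (1 - p))) = t ^ (γ + 2 - 2 * p) * ρ ^ σ := by
        rw [← Real.rpow_add ht, hbm, hΛρ]
      rw [e1, Real.rpow_two]
      calc _ = Λ ^ σ * (t ^ b * t ^ ((1 - b) * (1 - p))) * ((1 + ρ) ^ 2 / t ^ 2) *
            (1 + ε * ρ) ^ k := by ring
        _ = _ := by rw [e2]; ring
    have e3 : wA p γ Λ β t * th Λ β t ^ p = t ^ (γ - 2 * p) * (ρ ^ p * (1 + ρ) ^ p) := by
      rw [wA, hth, Real.div_rpow (by positivity) ht.le,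
        show γ - 2 * p = γ - p - p by ring, Real.rpow_sub ht (γ - p) p]
      ring
    rw [e, e3, mul_left_comm D]
    refine mul_le_mul_of_nonneg_left ?_ (by positivity)
    have e4 : ρ ^ p ≤ ρ ^ σ * (1 + ρ) ^ (p - σ) := by
      calc ρ ^ p = ρ ^ σ * ρ ^ (p - σ) := by rw [← Real.rpow_add hρp]; congr 1; ring
        _ ≤ _ := by
          gcongr
          · linarith
    have e5 : (1 + ρ) ^ k ≤ D * (1 + ε * ρ) ^ k := by
      have : D * ε ^ |k| = 1 := by rw [hD, Real.rpow_neg hε.le, inv_mul_cancel₀ (by positivity)]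
      calc (1 + ρ) ^ k = D * (ε ^ |k| * (1 + ρ) ^ k) := by rw [← mul_assoc, this, one_mul]
        _ ≤ _ := by gcongr
    calc ρ ^ p * (1 + ρ) ^ p ≤ ρ ^ σ * (1 + ρ) ^ (p - σ) * (1 + ρ) ^ p := by gcongr
      _ = ρ ^ σ * ((1 + ρ) ^ (2 : ℝ) * (1 + ρ) ^ k) := by
        rw [mul_assoc, ← Real.rpow_add (by positivity), ← Real.rpow_add (by positivity)]
        congr 2; rw [hk]; ring
      _ ≤ ρ ^ σ * ((1 + ρ) ^ (2 : ℝ) * (D * (1 + ε * ρ) ^ k)) := by gcongr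
      _ = _ := by ring

end Pointwise

section ZeroOrder

/-- Young's inequality with a small parameter. -/
theorem young_eps {p η A B : ℝ} (hp : 1 < p) (hη : 0 < η) (hA : 0 ≤ A) (hB : 0 ≤ B) :
    A * B ≤ η * A ^ (p / (p - 1)) + η ^ (1 - p) * B ^ p := by
  have hp1 : 0 < p - 1 := by linarith
  have hq : 1 < p / (p - 1) := by rw [lt_div_iff₀ hp1]; linarith
  set l := η ^ ((p - 1) / p) with hl
  have hlp : 0 < l := Real.rpow_pos_of_pos hη _
  have hc : (p / (p - 1)).HolderConjugate p := (Real.HolderConjugate.conjExponent hp).symm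
  have h := Real.young_inequality_of_nonneg (a := l * A) (b := B / l) (by positivity)
    (by positivity) hc
  have e1 : l * A * (B / l) = A * B := by field_simp
  rw [e1, Real.mul_rpow hlp.le hA, Real.div_rpow hB hlp.le] at h
  have e2 : l ^ (p / (p - 1)) = η := by
    rw [hl, ← Real.rpow_mul hη.le]
    have : (p - 1) / p * (p / (p - 1)) = 1 := by field_simp
    rw [this, Real.rpow_one]
  have e3 : (l ^ p)⁻¹ = η ^ (1 - p) := by
    rw [hl, ← Real.rpow_mul hη.le, ← Real.rpow_neg hη.le]
    congr 1; field_simp; ring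
  rw [e2, div_eq_mul_inv (B ^ p), e3] at h
  refine h.trans (add_le_add ?_ ?_)
  · exact div_le_self (by positivity) hq.le
  · rw [mul_comm (B ^ p)]
    exact div_le_self (by positivity) hp.le

variable {E ι : Type*} [NormedAddCommGroup E] [NormedSpace ℝ E] [MeasurableSpace E] [BorelSpace E]
  [FiniteDimensional ℝ E] [Fintype ι] {μ : Measure E} [μ.IsAddHaarMeasure]
  {G : Geo E ι} {c : Coef ι} {K : Set E}

/-- Ellipticity and scaling conditions for the coefficients. -/
structure Coef.Ell (c : Coef ι) (ν β Λ : ℝ) : Prop where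
  meas_m : Measurable c.m
  meas_q : Measurable c.q
  meas_b : ∀ j, Measurable (c.b j)
  meas_a : ∀ i j, Measurable (c.a i j)
  m_lo : ∀ t, 0 < t → ν * t ^ (2 * β - 2) ≤ c.m t
  m_hi : ∀ t, 0 < t → c.m t ≤ ν⁻¹ * t ^ (2 * β - 2)
  q_lo : ∀ t, 0 < t → ν * (rho Λ β t / t) ^ 2 ≤ c.q t
  q_hi : ∀ t, 0 < t → c.q t ≤ ν⁻¹ * (rho Λ β t / t) ^ 2
  b_bd : ∀ t, 0 < t → ∀ j, |c.b j t| ≤ ν⁻¹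
  a_bd : ∀ t, 0 < t → ∀ i j, |c.a i j t| ≤ ν⁻¹
  ell : ∀ t, 0 < t → ∀ (ξ₀ : ℝ) (ξ : ι → ℝ),
    ν * (ξ₀ ^ 2 + ∑ j, ξ j ^ 2) ≤ ξ₀ ^ 2 + ∑ j, c.b j t * (ξ j * ξ₀)
      + ∑ i, ∑ j, c.a i j t * (ξ i * ξ j)

theorem Geo.form_ge {ν β Λ : ℝ} (hc : c.Ell ν β Λ) (v : E → ℝ) {z : E} (hz : 0 < G.ht z) :
    ν * G.gradSq v z ≤ G.form c v z :=
  hc.ell _ hz _ fun j => dirD (G.e j) v z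

theorem dirD_ht_mul {P : ℝ → ℝ} {P' : ℝ} {y : E → ℝ} {z : E} (hP : HasDerivAt P P' (G.ht z))
    (hy : DifferentiableAt ℝ y z) (v : E) :
    dirD v (fun z => P (G.ht z) * y z) z = P (G.ht z) * dirD v y z + P' * G.ht v * y z := by
  have h1 : DifferentiableAt ℝ (fun z => P (G.ht z)) z :=
    hP.differentiableAt.comp z G.ht.differentiableAt
  rw [dirD_mul h1 hy, dirD_comp G.ht.differentiableAt hP]
  simp [dirD]
  ring

theorem dirD_congr {f g : E → ℝ} {z : E} (h : f =ᶠ[nhds z] g) (v : E) : dirD v f z = dirD v g z := by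
  rw [dirD, dirD, h.fderiv_eq]

theorem dirD_add {f g : E → ℝ} {z : E} (hf : DifferentiableAt ℝ f z) (hg : DifferentiableAt ℝ g z)
    (v : E) : dirD v (fun z => f z + g z) z = dirD v f z + dirD v g z := by
  simp [dirD, fderiv_fun_add hf hg]

variable (hK : IsCompact K) (hpos : ∀ z ∈ K, 0 < G.ht z)

theorem Geo.op_ht_mul {s s' s'' : ℝ → ℝ} (h1 : ∀ t, 0 < t → HasDerivAt s (s' t) t)
    (h2 : ∀ t, 0 < t → HasDerivAt s' (s'' t) t) {y : E → ℝ} (hy : IsTest (⊤ : ℕ∞) K y) {z : E}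
    (hz : 0 < G.ht z) :
    G.op c (fun z => s (G.ht z) * y z) z = s (G.ht z) * G.op c y z - 2 * s' (G.ht z) * dirD G.n y z
        - s'' (G.ht z) * y z - ∑ j, c.b j (G.ht z) * s' (G.ht z) * dirD (G.e j) y z := by
  have hle : (1 : WithTop ℕ∞) ≤ ((⊤ : ℕ∞) : WithTop ℕ∞) := WithTop.coe_le_coe.2 le_top
  have dy := hy.differentiableAt hle
  have dv := fun v => (hy.dirD v).differentiableAt hle
  have first : ∀ v w : E, 0 < G.ht w → dirD v (fun z => s (G.ht z) * y z) w
      = s (G.ht w) * dirD v y w + s' (G.ht w) * (G.ht v * y w) := fun v w hw => by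
    rw [dirD_ht_mul (h1 _ hw) (dy w)]; ring
  have hev : ∀ᶠ w in nhds z, 0 < G.ht w := G.ht.continuous.continuousAt.eventually (lt_mem_nhds hz)
  have second : ∀ v w : E, dirD w (dirD v (fun z => s (G.ht z) * y z)) z
      = s (G.ht z) * dirD w (dirD v y) z + s' (G.ht z) * (G.ht w * dirD v y z)
        + (s' (G.ht z) * (G.ht v * dirD w y z) + s'' (G.ht z) * (G.ht w * (G.ht v * y z))) := by
    intro v w
    rw [dirD_congr (hev.mono fun w hw => first v w hw)]
    have d1 : DifferentiableAt ℝ (fun z => G.ht v * y z) z := (dy z).const_mul _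
    have d2 : DifferentiableAt ℝ (fun z => s (G.ht z)) z :=
      (h1 _ hz).differentiableAt.comp z G.ht.differentiableAt
    have d3 : DifferentiableAt ℝ (fun z => s' (G.ht z)) z :=
      (h2 _ hz).differentiableAt.comp z G.ht.differentiableAt
    have d4 : DifferentiableAt ℝ (fun w => s (G.ht w) * dirD v y w) z := d2.mul (dv v z)
    have d5 : DifferentiableAt ℝ (fun w => s' (G.ht w) * (G.ht v * y w)) z := d3.mul d1
    rw [dirD_add d4 d5, dirD_ht_mul (h1 _ hz) (dv v z),
      dirD_ht_mul (h2 _ hz) d1, dirD_mul (differentiableAt_const _) (dy z)]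
    simp [dirD]
    ring
  simp only [Geo.op, first _ _ hz, second, G.ht_n, G.ht_e, G.ht_τ]
  have e1 : ∑ j, c.b j (G.ht z) * (s (G.ht z) * dirD (G.e j) (dirD G.n y) z
      + s' (G.ht z) * (0 * dirD G.n y z)
      + (s' (G.ht z) * (1 * dirD (G.e j) y z) + s'' (G.ht z) * (0 * (1 * y z))))
      = s (G.ht z) * (∑ j, c.b j (G.ht z) * dirD (G.e j) (dirD G.n y) z)
        + ∑ j, c.b j (G.ht z) * s' (G.ht z) * dirD (G.e j) y z := by
    rw [Finset.mul_sum, ← Finset.sum_add_distrib]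
    exact Finset.sum_congr rfl fun j _ => by ring
  have e2 : ∑ i, ∑ j, c.a i j (G.ht z) * (s (G.ht z) * dirD (G.e i) (dirD (G.e j) y) z
      + s' (G.ht z) * (0 * dirD (G.e j) y z)
      + (s' (G.ht z) * (0 * dirD (G.e i) y z) + s'' (G.ht z) * (0 * (0 * y z))))
      = s (G.ht z) * ∑ i, ∑ j, c.a i j (G.ht z) * dirD (G.e i) (dirD (G.e j) y) z := by
    simp only [Finset.mul_sum]
    exact Finset.sum_congr rfl fun i _ => Finset.sum_congr rfl fun j _ => by ring
  rw [e1, e2]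
  ring

include hpos in
theorem IsTest.rpow_mul {u : E → ℝ} (hu : IsTest (⊤ : ℕ∞) K u) (r : ℝ) :
    IsTest (⊤ : ℕ∞) K (fun z => G.ht z ^ r * u z) := by
  refine ⟨contDiff_iff_contDiffAt.2 fun z => ?_, (tsupport_mul_subset_right).trans hu.supp⟩
  by_cases hz : z ∈ tsupport u
  · exact (G.ht.contDiff.contDiffAt.rpow_const_of_ne (hpos z (hu.supp hz)).ne').mul
      hu.contDiff.contDiffAt
  · have h0 : u =ᶠ[nhds z] 0 := notMem_tsupport_iff_eventuallyEq.1 hz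
    refine (contDiffAt_const (c := (0 : ℝ))).congr_of_eventuallyEq ?_
    filter_upwards [h0] with w hw
    simp [hw]

include hK hpos

theorem Coef.Ell.loc {ν β Λ : ℝ} (hc : c.Ell ν β Λ) (hν : 0 < ν) : c.Loc G K where
  m := by
    refine bddMeas_ht_of_le (g := fun t => ν⁻¹ * t ^ (2 * β - 2)) hK hpos hc.meas_m
      ((BddMeas.const _).mul (bddMeas_ht_rpow hK hpos _)) fun t ht => ?_
    rw [abs_of_nonneg]
    · exact hc.m_hi t ht
    · exact le_trans (by positivity) (hc.m_lo t ht)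
  q := by
    have hb : BddMeas K (fun z => ν⁻¹ * (rho Λ β (G.ht z) / G.ht z) ^ 2) := by
      refine bddMeas_ht (f := fun t => ν⁻¹ * (rho Λ β t / t) ^ 2) hK hpos ?_ ?_
      · unfold rho; fun_prop
      · unfold rho
        refine continuousOn_const.mul (ContinuousOn.pow (ContinuousOn.div
          (continuousOn_const.mul (ContinuousOn.rpow_const continuousOn_id
            fun t ht => Or.inl (ne_of_gt ht))) continuousOn_id fun t ht => ne_of_gt ht) 2)
    refine bddMeas_ht_of_le (g := fun t => ν⁻¹ * (rho Λ β t / t) ^ 2) hK hpos hc.meas_q hb fun t ht => ?_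
    rw [abs_of_nonneg]
    · exact hc.q_hi t ht
    · exact le_trans (by positivity) (hc.q_lo t ht)
  b j := bddMeas_ht_of_le (g := fun _ => ν⁻¹) hK hpos (hc.meas_b j) (BddMeas.const _)
    fun t ht => hc.b_bd t ht j
  a i j := bddMeas_ht_of_le (g := fun _ => ν⁻¹) hK hpos (hc.meas_a i j) (BddMeas.const _)
    fun t ht => hc.a_bd t ht i j

theorem bddMeas_th {Λ β : ℝ} (hΛ : 0 < Λ) (r : ℝ) :
    BddMeas K (fun z => th Λ β (G.ht z) ^ r) := by
  refine bddMeas_ht (f := fun t => th Λ β t ^ r) hK hpos (by unfold th rho; fun_prop) ?_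
  have : ContinuousOn (th Λ β) (Ioi 0) := by
    unfold th rho
    exact ContinuousOn.div (continuousOn_const.add (continuousOn_const.mul
      (ContinuousOn.rpow_const continuousOn_id fun t ht => Or.inl (ne_of_gt ht))))
      continuousOn_id fun t ht => ne_of_gt ht
  exact this.rpow_const fun t ht => Or.inl (th_pos hΛ ht).ne'

theorem bddMeas_wA {Λ β : ℝ} (hΛ : 0 < Λ) (p γ : ℝ) :
    BddMeas K (fun z => wA p γ Λ β (G.ht z)) := by
  refine bddMeas_ht (f := wA p γ Λ β) hK hpos (by unfold wA rho; fun_prop) ?_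
  unfold wA rho
  refine (ContinuousOn.rpow_const continuousOn_id fun t ht => Or.inl (ne_of_gt ht)).mul
    (ContinuousOn.rpow_const (continuousOn_const.mul
      (ContinuousOn.rpow_const continuousOn_id fun t ht => Or.inl (ne_of_gt ht)))
      fun t ht => Or.inl ?_)
  have : (0 : ℝ) < t := ht
  positivity

end ZeroOrder

section ZeroOrder

theorem zero_order_pointwise {p c ν C e q φ φ2 S S2 θ A tγ Y P P' Ψ gr fm f : ℝ}
    (hp : 1 < p) (hc : 0 < c) (hν : 0 < ν) (hC : 0 < C) (hφ : 0 < φ) (hS : 0 < S) (hθ : 0 < θ)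
    (h1 : c * θ ^ 2 * φ ≤ q * φ - φ2) (h2 : c * θ ^ 2 * S ≤ q * S - S2)
    (h3 : φ * (θ ^ 2 * S) ^ (1 - p) ≤ C * tγ) (h4 : A * θ ^ p ≤ C * (θ ^ 2 * φ * S ^ (1 - p)))
    (hY : |P| ^ (p / (p - 1)) ≤ Y * P) (hP' : 0 ≤ P') (hΨ : |p * Ψ - Y * P| ≤ e)
    (hgr : 0 ≤ gr) (hfm : ν * gr ≤ fm) :
    A * θ ^ p * S ^ p * (Y * P) + A * θ ^ (p - 2) * S ^ p * (P' * gr)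
      ≤ C * (2 / c + 1 / ν) * ((q * S * φ * (Y * P) + S * φ * P' * fm
        + (S2 * φ - S * φ2) * Ψ - S2 * φ * (Y * P)) - φ * P * f
        + C * (c / 2) ^ (1 - p) * (tγ * |f| ^ p) + e * |S2 * φ - S * φ2|) := by
  have hp0 : 0 < p := by linarith
  set N := Y * P with hN
  have hN0 : 0 ≤ N := le_trans (by positivity) hY
  have he : 0 ≤ e := (abs_nonneg _).trans hΨ
  set D := S2 * φ - S * φ2 with hD
  have k1 : D * Ψ ≥ D * N / p - e * |D| := by
    have : |D * (p * Ψ - N)| ≤ |D| * e := by rw [abs_mul]; gcongr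
    have h' := (abs_le.1 this).1
    have h'' : D * Ψ = (D * (p * Ψ - N)) / p + D * N / p := by field_simp; ring
    have h3 : -(|D| * e) ≤ (D * (p * Ψ - N)) / p := by
      rw [le_div_iff₀ hp0]
      have : 0 ≤ |D| * e := by positivity
      nlinarith
    linarith
  have k2 : q * S * φ * N + D * N / p - S2 * φ * N ≥ c * θ ^ 2 * φ * S * N := by
    have e1 : q * S * φ * N + D * N / p - S2 * φ * N = N * (1 / p * S * (q * φ - φ2)
        + (1 - 1 / p) * φ * (q * S - S2)) := by rw [hD]; field_simp; ring
    have e2 : c * θ ^ 2 * φ * S * N = N * (1 / p * S * (c * θ ^ 2 * φ)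
        + (1 - 1 / p) * φ * (c * θ ^ 2 * S)) := by ring
    rw [e1, e2]
    have hp' : 0 ≤ 1 - 1 / p := by
      rw [sub_nonneg, div_le_one hp0]; exact hp.le
    gcongr
  have k3 : φ * P * f ≤ c / 2 * θ ^ 2 * φ * S * N
      + C * (c / 2) ^ (1 - p) * (tγ * |f| ^ p) := by
    have y := young_eps (η := c / 2) (A := |P|) (B := |f| / (θ ^ 2 * S)) hp (by positivity)
      (abs_nonneg _) (by positivity)
    have hA : φ * P * f ≤ φ * θ ^ 2 * S * (|P| * (|f| / (θ ^ 2 * S))) := by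
      have : φ * θ ^ 2 * S * (|P| * (|f| / (θ ^ 2 * S))) = φ * |P * f| := by
        rw [abs_mul]; field_simp
      rw [this, mul_assoc]
      gcongr
      exact le_abs_self _
    refine hA.trans ((mul_le_mul_of_nonneg_left y (by positivity)).trans ?_)
    rw [mul_add]
    refine add_le_add ?_ ?_
    · calc φ * θ ^ 2 * S * (c / 2 * |P| ^ (p / (p - 1))) ≤ φ * θ ^ 2 * S * (c / 2 * N) := by gcongr
        _ = _ := by ring
    · have e3 : φ * θ ^ 2 * S * ((c / 2) ^ (1 - p) * (|f| / (θ ^ 2 * S)) ^ p)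
          = (c / 2) ^ (1 - p) * |f| ^ p * (φ * (θ ^ 2 * S) ^ (1 - p)) := by
        have hX : 0 < θ ^ 2 * S := by positivity
        rw [Real.div_rpow (abs_nonneg _) hX.le, Real.rpow_sub hX, Real.rpow_one]
        ring
      rw [e3]
      calc _ ≤ (c / 2) ^ (1 - p) * |f| ^ p * (C * tγ) := by gcongr
        _ = _ := by ring
  have k4 : S * φ * P' * fm ≥ S * φ * P' * (ν * gr) := by
    have : 0 ≤ S * φ * P' := by positivity
    exact mul_le_mul_of_nonneg_left hfm this
  have k5 : A * θ ^ p * S ^ p ≤ C * (θ ^ 2 * φ * S) := by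
    calc A * θ ^ p * S ^ p ≤ C * (θ ^ 2 * φ * S ^ (1 - p)) * S ^ p := by gcongr
      _ = C * (θ ^ 2 * φ * (S ^ (1 - p) * S ^ p)) := by ring
      _ = _ := by rw [← Real.rpow_add hS]; simp
  have k6 : A * θ ^ (p - 2) * S ^ p ≤ C * (φ * S) := by
    have : A * θ ^ (p - 2) * S ^ p = A * θ ^ p * S ^ p / θ ^ 2 := by
      rw [Real.rpow_sub hθ, Real.rpow_two]; ring
    rw [this, div_le_iff₀ (by positivity)]
    linarith
  set Z := c / 2 * θ ^ 2 * φ * S * N + S * φ * P' * (ν * gr) with hZ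
  have k7 : A * θ ^ p * S ^ p * N + A * θ ^ (p - 2) * S ^ p * (P' * gr)
      ≤ C * (2 / c + 1 / ν) * Z := by
    have hPg : 0 ≤ P' * gr := by positivity
    have a1 := mul_le_mul_of_nonneg_right k5 hN0
    have a2 := mul_le_mul_of_nonneg_right k6 hPg
    have e4 : C * (2 / c + 1 / ν) * Z = C * (θ ^ 2 * φ * S) * N + C * (φ * S) * (P' * gr)
        + C * (1 / ν * (c / 2) * (θ ^ 2 * φ * S * N) + 2 / c * ν * (S * φ * (P' * gr))) := by
      rw [hZ]; field_simp; ring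
    rw [e4]
    have : 0 ≤ C * (1 / ν * (c / 2) * (θ ^ 2 * φ * S * N) + 2 / c * ν * (S * φ * (P' * gr))) := by
      positivity
    linarith
  refine k7.trans (mul_le_mul_of_nonneg_left ?_ (by positivity))
  have : c / 2 * θ ^ 2 * φ * S * N = c * θ ^ 2 * φ * S * N / 2 := by ring
  linarith

variable {E ι : Type*} [NormedAddCommGroup E] [NormedSpace ℝ E] [MeasurableSpace E] [BorelSpace E]
  [FiniteDimensional ℝ E] [Fintype ι] {μ : Measure E} [μ.IsAddHaarMeasure]
  {G : Geo E ι} {K : Set E}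

theorem zero_order_estimate {ν β p γ : ℝ} (hν : 0 < ν) (hβ : 0 < β) (hβ1 : β < 1) (hp : 1 < p)
    (h1 : p - p * β - 1 < γ) (h2 : γ < 2 * p - 1) : ∃ a C : ℝ, a ∈ Icc (0 : ℝ) 1 ∧ 0 < C ∧
    ∀ (E ι : Type) [NormedAddCommGroup E] [NormedSpace ℝ E] [MeasurableSpace E] [BorelSpace E]
      [FiniteDimensional ℝ E] [Fintype ι] (μ : Measure E) [μ.IsAddHaarMeasure] (G : Geo E ι)
      (K : Set E), IsCompact K → (∀ z ∈ K, 0 < G.ht z) → ∀ Λ, 0 < Λ → ∀ c : Coef ι,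
      c.Ell ν β Λ → ∀ u : E → ℝ, IsTest (⊤ : ℕ∞) K u → ∃ B, 0 ≤ B ∧
      ∀ ψ ψ' Ψ : ℝ → ℝ, PrimPair ψ ψ' Ψ → ∀ e, (∀ y, 0 ≤ ψ' y) → (∀ y, |p * Ψ y - y * ψ y| ≤ e) →
      (∀ y, |ψ y| ^ (p / (p - 1)) ≤ y * ψ y) →
      ∫ z, (wA p γ Λ β (G.ht z) * th Λ β (G.ht z) ^ p * (G.ht z ^ a) ^ p
          * ((G.ht z ^ (-a) * u z) * ψ (G.ht z ^ (-a) * u z))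
        + wA p γ Λ β (G.ht z) * th Λ β (G.ht z) ^ (p - 2) * (G.ht z ^ a) ^ p
          * (ψ' (G.ht z ^ (-a) * u z) * G.gradSq (fun z => G.ht z ^ (-a) * u z) z)) ∂μ
      ≤ C * ∫ z, G.ht z ^ γ * |G.op c u z| ^ p ∂μ + e * B := by
  obtain ⟨σ, k, a, b, ε, c0, C, hε, hε1, hc0, hC, ha, hw⟩ := exists_weights hν hβ hβ1 hp h1 h2
  refine ⟨a, C * (2 / c0 + 1 / ν) * (C * (c0 / 2) ^ (1 - p)), ha, by positivity, ?_⟩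
  intro E ι _ _ _ _ _ _ μ _ G K hK hpos Λ hΛ c hc u hu
  set φ := wt (Λ ^ σ) b k (ε * Λ) β with hφ
  set φ2 := wt'' (Λ ^ σ) b k (ε * Λ) β with hφ2
  set S := wt 1 a 0 0 β with hS
  set S2 := wt'' 1 a 0 0 β with hS2
  have hSa : ∀ t, S t = t ^ a := fun t => by simp [hS, wt]
  have W1 := weight_wt (G := G) hK hpos (κ := ε * Λ) (by positivity) (Λ ^ σ) b k β
  have W2 := weight_wt (G := G) hK hpos (κ := 0) le_rfl 1 a 0 β
  rw [← hφ, ← hφ2] at W1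
  rw [← hS, ← hS2] at W2
  have hbD : BddMeas K (fun z => |S2 (G.ht z) * φ (G.ht z) - S (G.ht z) * φ2 (G.ht z)|) :=
    ((W2.bm''.mul W1.bm).sub (W2.bm.mul W1.bm'')).abs
  set y : E → ℝ := fun z => G.ht z ^ (-a) * u z with hy
  have hyt : IsTest (⊤ : ℕ∞) K y := hu.rpow_mul hpos (-a)
  have huS : u = fun z => S (G.ht z) * y z := by
    ext z
    by_cases hz : z ∈ K
    · have := hpos z hz
      simp only [hSa, hy]
      rw [← mul_assoc, ← Real.rpow_add this]
      simp
    · simp [hy, hu.zero_off hz]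
  have hloc : c.Loc G K := hc.loc hK hpos hν
  have hDi : Integrable (fun z => K.indicator
      (fun z => |S2 (G.ht z) * φ (G.ht z) - S (G.ht z) * φ2 (G.ht z)|) z) μ := by
    obtain ⟨D, hD⟩ := hbD.bdd
    rw [integrable_indicator_iff hK.measurableSet]
    exact IntegrableOn.of_bound hK.measure_lt_top hbD.meas.aestronglyMeasurable D
      (ae_restrict_of_forall_mem hK.measurableSet fun z hz => hD z hz)
  refine ⟨C * (2 / c0 + 1 / ν) * ∫ z, K.indicator
      (fun z => |S2 (G.ht z) * φ (G.ht z) - S (G.ht z) * φ2 (G.ht z)|) z ∂μ,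
    mul_nonneg (by positivity) (integral_nonneg fun z => indicator_nonneg (fun _ _ => abs_nonneg _) _),
    ?_⟩
  intro ψ ψ' Ψ hψ e hψ' hΨ hY
  have hop : ∀ z, 0 < G.ht z → G.op c u z = S (G.ht z) * G.op c y z
        - 2 * wt' 1 a 0 0 β (G.ht z) * dirD G.n y z - S2 (G.ht z) * y z
        - ∑ j, c.b j (G.ht z) * wt' 1 a 0 0 β (G.ht z) * dirD (G.e j) y z := fun z hz => by
    rw [huS]
    exact Geo.op_ht_mul W2.d1 W2.d2 hyt hz
  have id := energy_identity (μ := μ) hK hpos hloc hψ W2 W1 hyt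
  set Rh : E → ℝ := fun z => c.q (G.ht z) * S (G.ht z) * φ (G.ht z) * (y z * ψ (y z))
        + S (G.ht z) * φ (G.ht z) * ψ' (y z) * G.form c y z
        + (S2 (G.ht z) * φ (G.ht z) - S (G.ht z) * φ2 (G.ht z)) * Ψ (y z)
        - S2 (G.ht z) * φ (G.ht z) * (y z * ψ (y z)) with hRh
  have hL : ∀ z, φ (G.ht z) * ψ (y z) * (S (G.ht z) * G.op c y z
        - 2 * wt' 1 a 0 0 β (G.ht z) * dirD G.n y z
        - S2 (G.ht z) * y z - ∑ j, c.b j (G.ht z) * wt' 1 a 0 0 β (G.ht z) * dirD (G.e j) y z)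
      = φ (G.ht z) * ψ (y z) * G.op c u z := by
    intro z
    by_cases hz : z ∈ K
    · rw [hop z (hpos z hz)]
    · simp [hyt.zero_off hz, hψ.zero]
  simp only [hL] at id
  have by1 := hyt.bddMeas hK
  have bψ : BddMeas K (fun z => ψ (y z)) := by1.cont_comp hψ.continuous
  have bψ' : BddMeas K (fun z => ψ' (y z)) := by1.cont_comp hψ.cont
  have bΨ : BddMeas K (fun z => Ψ (y z)) := by1.cont_comp hψ.contDiff_prim.continuous
  have bop := Geo.bddMeas_op hK hloc hu
  have bform := Geo.bddMeas_form hK hloc hyt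
  have bgr := Geo.bddMeas_gradSq (G := G) hK hyt
  have bφ := W1.bm
  have bS := W2.bm
  have bφ2 := W1.bm''
  have bS2 := W2.bm''
  have bq := hloc.q
  have iR : Integrable Rh μ := by
    refine BddMeas.integrable (K := K) ?_ hK.measurableSet hK.measure_lt_top.ne ?_
    · rw [hRh]
      solve_by_elim (maxDepth := 40) [BddMeas.mul, BddMeas.add, BddMeas.sub]
    · intro z hz
      simp [hRh, hyt.zero_off hz, hψ.zero, hψ.prim_zero, Geo.form_zero_off hyt hz]
  have iL : Integrable (fun z => φ (G.ht z) * ψ (y z) * G.op c u z) μ := by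
    refine BddMeas.integrable (K := K) ?_ hK.measurableSet hK.measure_lt_top.ne ?_
    · solve_by_elim (maxDepth := 40) [BddMeas.mul, BddMeas.add, BddMeas.sub]
    · intro z hz
      simp [hyt.zero_off hz, hψ.zero]
  have iM : Integrable (fun z => G.ht z ^ γ * |G.op c u z| ^ p) μ := by
    refine BddMeas.integrable (K := K) ((bddMeas_ht_rpow hK hpos γ).mul
      (bop.abs_rpow (by linarith))) hK.measurableSet hK.measure_lt_top.ne ?_
    intro z hz
    rw [Geo.op_zero_off hu hz, abs_zero, Real.zero_rpow (by linarith), mul_zero]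
  have bA := bddMeas_wA (G := G) (β := β) hK hpos hΛ p γ
  have bθ := fun r => bddMeas_th (G := G) (β := β) hK hpos hΛ r
  have bSp : BddMeas K (fun z => (G.ht z ^ a) ^ p) :=
    (bddMeas_ht (f := fun t => (t ^ a) ^ p) hK hpos (by fun_prop)
      ((ContinuousOn.rpow_const continuousOn_id fun t ht => Or.inl (ne_of_gt ht)).rpow_const
        fun t ht => Or.inl (Real.rpow_pos_of_pos ht _).ne'))
  have bθp := bθ p
  have bθp2 := bθ (p - 2)
  have iX : Integrable (fun z => wA p γ Λ β (G.ht z) * th Λ β (G.ht z) ^ p * (G.ht z ^ a) ^ p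
          * (y z * ψ (y z)) + wA p γ Λ β (G.ht z) * th Λ β (G.ht z) ^ (p - 2) * (G.ht z ^ a) ^ p
          * (ψ' (y z) * G.gradSq y z)) μ := by
    refine BddMeas.integrable (K := K) ?_ hK.measurableSet hK.measure_lt_top.ne ?_
    · solve_by_elim (maxDepth := 40) [BddMeas.mul, BddMeas.add, BddMeas.sub]
    · intro z hz
      simp [hyt.zero_off hz, hψ.zero, Geo.gradSq_zero_off hyt hz]
  have main : ∀ z, wA p γ Λ β (G.ht z) * th Λ β (G.ht z) ^ p * (G.ht z ^ a) ^ p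
          * (y z * ψ (y z)) + wA p γ Λ β (G.ht z) * th Λ β (G.ht z) ^ (p - 2) * (G.ht z ^ a) ^ p
          * (ψ' (y z) * G.gradSq y z) ≤ C * (2 / c0 + 1 / ν) * (Rh z
          - φ (G.ht z) * ψ (y z) * G.op c u z
          + C * (c0 / 2) ^ (1 - p) * (G.ht z ^ γ * |G.op c u z| ^ p)
          + e * K.indicator
            (fun z => |S2 (G.ht z) * φ (G.ht z) - S (G.ht z) * φ2 (G.ht z)|) z) := by
    intro z
    by_cases hz : z ∈ K
    · have ht := hpos z hz
      obtain ⟨w1, w2, w3⟩ := hw Λ (G.ht z) hΛ ht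
      obtain ⟨w4, w5⟩ := w1 (c.q (G.ht z)) (hc.q_lo _ ht)
      rw [indicator_of_mem hz]
      refine zero_order_pointwise (S := G.ht z ^ a) (S2 := S2 (G.ht z)) (f := G.op c u z) hp hc0 hν hC ?_ (by positivity)
        (th_pos hΛ ht) w4 ?_ w2 w3 (hY _) (hψ' _) (hΨ _) (Geo.gradSq_nonneg _ _ _)
        (Geo.form_ge hc y ht) |>.trans_eq ?_
      · have := wt_base_pos (κ := ε * Λ) (β := β) (by positivity) ht
        simp only [wt]
        positivity
      · simpa only [← hSa] using w5
      · simp only [hRh, hSa, hφ, hφ2]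
    · simp [hyt.zero_off hz, hψ.zero, hψ.prim_zero, Geo.gradSq_zero_off hyt hz,
        Geo.op_zero_off hu hz, hz, hRh, Geo.form_zero_off hyt hz,
        Real.zero_rpow (show p ≠ 0 by linarith)]
  have iRL : Integrable (fun z => Rh z - φ (G.ht z) * ψ (y z) * G.op c u z) μ := iR.sub iL
  have iMc : Integrable (fun z => C * (c0 / 2) ^ (1 - p) * (G.ht z ^ γ * |G.op c u z| ^ p)) μ :=
    iM.const_mul _
  have iDc := hDi.const_mul e
  have i1 : Integrable (fun z => Rh z - φ (G.ht z) * ψ (y z) * G.op c u z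
    + C * (c0 / 2) ^ (1 - p) * (G.ht z ^ γ * |G.op c u z| ^ p)) μ := iRL.add iMc
  have i2 := i1.add iDc
  refine (integral_mono iX (i2.const_mul (C * (2 / c0 + 1 / ν))) main).trans_eq ?_
  simp only [Pi.add_apply]
  rw [integral_const_mul, integral_add i1 iDc, integral_add iRL iMc, integral_sub iR iL, id,
    integral_const_mul, integral_const_mul]
  ring

end ZeroOrder

section GradSmall

theorem add_rpow_le_two_rpow {p a b : ℝ} (hp : 0 ≤ p) (ha : 0 ≤ a) (hb : 0 ≤ b) :
    (a + b) ^ p ≤ 2 ^ p * (a ^ p + b ^ p) := by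
  have h : a + b ≤ 2 * max a b := by
    rcases le_total a b with h | h <;> simp [h] <;> linarith
  refine (Real.rpow_le_rpow (by positivity) h hp).trans ?_
  rw [Real.mul_rpow (by norm_num) (le_max_of_le_left ha)]
  gcongr
  have h1 := Real.rpow_nonneg ha p
  have h2 := Real.rpow_nonneg hb p
  rcases le_total a b with h | h <;> simp [h] <;> linarith

theorem rpow_le_mixed {p x D : ℝ} (hp : p ≤ 2) (hp0 : 0 ≤ p) (hx : 0 < x) :
    |D| ^ p ≤ x ^ (p - 2) * D ^ 2 + x ^ p := by
  rcases le_total |D| x with h | h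
  · have := Real.rpow_le_rpow (abs_nonneg D) h hp0
    have : 0 ≤ x ^ (p - 2) * D ^ 2 := by positivity
    linarith
  · have hD : 0 < |D| := hx.trans_le h
    have h1 : |D| ^ p = |D| ^ (p - 2) * D ^ 2 := by
      rw [← sq_abs, ← Real.rpow_two, ← Real.rpow_add hD]; congr 1; ring
    have h2 : |D| ^ (p - 2) ≤ x ^ (p - 2) := Real.rpow_le_rpow_of_nonpos hx h (by linarith)
    have : 0 ≤ x ^ p := by positivity
    rw [h1]
    nlinarith [sq_nonneg D]

theorem grad_pointwise {p ε y D h t S θ A P' gr N : ℝ} (hp : 1 < p) (hp2 : p ≤ 2) (hε : 0 < ε)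
    (hS : 0 < S) (hθ : 0 < θ) (hA : 0 ≤ A) (hh : |h| ≤ θ)
    (hP' : (p - 1) * (y ^ 2 + ε ^ 2) ^ ((p - 2) / 2) ≤ P') (hgr : D ^ 2 ≤ gr)
    (hN : (y ^ 2 + ε ^ 2) ^ (p / 2) ≤ N + ε ^ p) :
    A * |S * D + h * S * y| ^ p ≤ 2 ^ p * (2 + 1 / (p - 1)) *
      (A * θ ^ p * S ^ p * N + A * θ ^ (p - 2) * S ^ p * (P' * gr) + ε ^ p * (A * θ ^ p * S ^ p))
      := by
  have hp0 : 0 ≤ p := by linarith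
  have hp1 : 0 < p - 1 := by linarith
  set R := y ^ 2 + ε ^ 2 with hR
  have hR0 : 0 < R := by positivity
  obtain ⟨x, hx⟩ : ∃ x, x = θ * R ^ ((1 : ℝ) / 2) := ⟨_, rfl⟩
  have hx0 : 0 < x := by rw [hx]; positivity
  have hxp : ∀ r : ℝ, x ^ r = θ ^ r * R ^ (r / 2) := fun r => by
    rw [hx, Real.mul_rpow hθ.le (Real.rpow_nonneg hR0.le _), ← Real.rpow_mul hR0.le,
      show (1 : ℝ) / 2 * r = r / 2 by ring]
  have m := rpow_le_mixed (D := D) hp2 hp0 hx0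
  rw [hxp (p - 2), hxp p] at m
  have hy : |y| ≤ R ^ ((1 : ℝ) / 2) := by
    rw [← Real.sqrt_eq_rpow]
    exact Real.abs_le_sqrt (by rw [hR]; nlinarith)
  have hy' : |h * S * y| ^ p ≤ S ^ p * (θ ^ p * R ^ (p / 2)) := by
    have : |h * S * y| ≤ S * x := by
      rw [abs_mul, abs_mul, abs_of_pos hS, hx]
      calc |h| * S * |y| ≤ θ * S * R ^ ((1 : ℝ) / 2) := by gcongr
        _ = _ := by ring
    refine (Real.rpow_le_rpow (abs_nonneg _) this hp0).trans_eq ?_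
    rw [Real.mul_rpow hS.le hx0.le, hxp]
  have hD' : |S * D| ^ p = S ^ p * |D| ^ p := by
    rw [abs_mul, abs_of_pos hS, Real.mul_rpow hS.le (abs_nonneg _)]
  have tri : |S * D + h * S * y| ^ p ≤ 2 ^ p * (S ^ p * (θ ^ (p - 2) * R ^ ((p - 2) / 2) * D ^ 2)
      + 2 * (S ^ p * (θ ^ p * R ^ (p / 2)))) := by
    refine (Real.rpow_le_rpow (abs_nonneg _) (abs_add_le _ _) hp0).trans
      ((add_rpow_le_two_rpow hp0 (abs_nonneg _) (abs_nonneg _)).trans ?_)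
    refine mul_le_mul_of_nonneg_left ?_ (by positivity)
    rw [hD']
    have := mul_le_mul_of_nonneg_left m (Real.rpow_nonneg hS.le p)
    linarith
  have e1 : R ^ ((p - 2) / 2) * D ^ 2 ≤ 1 / (p - 1) * (P' * gr) := by
    rw [one_div, ← div_eq_inv_mul, le_div_iff₀ hp1]
    have h0 : 0 ≤ R ^ ((p - 2) / 2) := by positivity
    calc R ^ ((p - 2) / 2) * D ^ 2 * (p - 1) = (p - 1) * R ^ ((p - 2) / 2) * D ^ 2 := by ring
      _ ≤ P' * gr := mul_le_mul hP' hgr (sq_nonneg _) (le_trans (by positivity) hP')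
  have hN0 : 0 ≤ N + ε ^ p := le_trans (by positivity) hN
  have hQ0 : 0 ≤ P' * gr := by
    have : 0 ≤ 1 / (p - 1) * (P' * gr) := le_trans (by positivity) e1
    have h1 : 0 < 1 / (p - 1) := by positivity
    exact nonneg_of_mul_nonneg_right this h1
  calc A * |S * D + h * S * y| ^ p ≤ A * (2 ^ p * (S ^ p * (θ ^ (p - 2) * R ^ ((p - 2) / 2) * D ^ 2)
      + 2 * (S ^ p * (θ ^ p * R ^ (p / 2))))) := by gcongr
    _ = 2 ^ p * (A * S ^ p * θ ^ (p - 2) * (R ^ ((p - 2) / 2) * D ^ 2)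
      + 2 * (A * S ^ p * θ ^ p * R ^ (p / 2))) := by ring
    _ ≤ 2 ^ p * (A * S ^ p * θ ^ (p - 2) * (1 / (p - 1) * (P' * gr))
      + 2 * (A * S ^ p * θ ^ p * (N + ε ^ p))) := by gcongr
    _ ≤ 2 ^ p * (A * S ^ p * θ ^ (p - 2) * (1 / (p - 1) * (P' * gr))
      + 2 * (A * S ^ p * θ ^ p * (N + ε ^ p))) + 2 ^ p * (1 / (p - 1) *
        (A * θ ^ p * S ^ p * (N + ε ^ p)) + 2 * (A * θ ^ (p - 2) * S ^ p * (P' * gr))) := by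
        have : 0 ≤ 2 ^ p * (1 / (p - 1) *
          (A * θ ^ p * S ^ p * (N + ε ^ p)) + 2 * (A * θ ^ (p - 2) * S ^ p * (P' * gr))) := by
          positivity
        linarith
    _ = _ := by ring

theorem grad_le_two {ν β p γ : ℝ} (hν : 0 < ν) (hβ : 0 < β) (hβ1 : β < 1) (hp : 1 < p)
    (hp2 : p ≤ 2) (h1 : p - p * β - 1 < γ) (h2 : γ < 2 * p - 1) : ∃ C : ℝ, 0 < C ∧
    ∀ (E ι : Type) [NormedAddCommGroup E] [NormedSpace ℝ E] [MeasurableSpace E] [BorelSpace E]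
      [FiniteDimensional ℝ E] [Fintype ι] (μ : Measure E) [μ.IsAddHaarMeasure] (G : Geo E ι)
      (K : Set E), IsCompact K → (∀ z ∈ K, 0 < G.ht z) → ∀ Λ, 0 < Λ → ∀ c : Coef ι,
      c.Ell ν β Λ → ∀ u : E → ℝ, IsTest (⊤ : ℕ∞) K u → ∀ v : E, |G.ht v| ≤ 1 →
      (∀ (y : E → ℝ) z, dirD v y z ^ 2 ≤ G.gradSq y z) →
      ∫ z, wA p γ Λ β (G.ht z) * |dirD v u z| ^ p ∂μ ≤ C * ∫ z, G.ht z ^ γ * |G.op c u z| ^ p ∂μ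
    := by
  obtain ⟨a, C, ha, hC, H⟩ := zero_order_estimate hν hβ hβ1 hp h1 h2
  have hp1 : 0 < p - 1 := by linarith
  have hp0 : 0 < p := by linarith
  refine ⟨2 ^ p * (2 + 1 / (p - 1)) * C, by positivity, ?_⟩
  intro E ι _ _ _ _ _ _ μ _ G K hK hpos Λ hΛ c hc u hu v hv1 hv2
  obtain ⟨B, hB, HB⟩ := H E ι μ G K hK hpos Λ hΛ c hc u hu
  set y : E → ℝ := fun z => G.ht z ^ (-a) * u z with hy
  have hyt : IsTest (⊤ : ℕ∞) K y := hu.rpow_mul hpos (-a)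
  have hle : (1 : WithTop ℕ∞) ≤ ((⊤ : ℕ∞) : WithTop ℕ∞) := WithTop.coe_le_coe.2 le_top
  have hDu : ∀ z, 0 < G.ht z → dirD v u z = G.ht z ^ a * dirD v y z
      + a * G.ht v / G.ht z * G.ht z ^ a * y z := by
    intro z hz
    have huS : u = fun z => G.ht z ^ a * y z := by
      ext z
      by_cases hz : z ∈ K
      · have := hpos z hz
        simp only [hy]
        rw [← mul_assoc, ← Real.rpow_add this]
        simp
      · simp [hy, hu.zero_off hz]
    conv_lhs => rw [huS]
    rw [dirD_ht_mul (P := fun t => t ^ a) (Real.hasDerivAt_rpow_const (Or.inl hz.ne'))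
      (hyt.differentiableAt hle z) v, Real.rpow_sub_one hz.ne']
    ring
  have bA := bddMeas_wA (G := G) (β := β) hK hpos hΛ p γ
  have bθp := bddMeas_th (G := G) (β := β) hK hpos hΛ p
  have bθp2 := bddMeas_th (G := G) (β := β) hK hpos hΛ (p - 2)
  have bSp : BddMeas K (fun z => (G.ht z ^ a) ^ p) :=
    (bddMeas_ht (f := fun t => (t ^ a) ^ p) hK hpos (by fun_prop)
      ((ContinuousOn.rpow_const continuousOn_id fun t ht => Or.inl (ne_of_gt ht)).rpow_const
        fun t ht => Or.inl (Real.rpow_pos_of_pos ht _).ne'))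
  have bh : BddMeas K (fun z => wA p γ Λ β (G.ht z) * th Λ β (G.ht z) ^ p * (G.ht z ^ a) ^ p) :=
    (bA.mul bθp).mul bSp
  have ih : Integrable (fun z => K.indicator (fun z => wA p γ Λ β (G.ht z) * th Λ β (G.ht z) ^ p
      * (G.ht z ^ a) ^ p) z) μ := by
    obtain ⟨D, hD⟩ := bh.bdd
    rw [integrable_indicator_iff hK.measurableSet]
    exact IntegrableOn.of_bound hK.measure_lt_top bh.meas.aestronglyMeasurable D
      (ae_restrict_of_forall_mem hK.measurableSet fun z hz => hD z hz)
  set J := ∫ z, K.indicator (fun z => wA p γ Λ β (G.ht z) * th Λ β (G.ht z) ^ p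
      * (G.ht z ^ a) ^ p) z ∂μ with hJ
  have bdv := hu.bddMeas_dirD hle hK v
  have iL : Integrable (fun z => wA p γ Λ β (G.ht z) * |dirD v u z| ^ p) μ := by
    refine BddMeas.integrable (K := K) (bA.mul (bdv.abs_rpow hp0.le)) hK.measurableSet
      hK.measure_lt_top.ne fun z hz => ?_
    rw [(hu.dirD v).zero_off hz, abs_zero, Real.zero_rpow hp0.ne', mul_zero]
  have key : ∀ ε, 0 < ε → ∫ z, wA p γ Λ β (G.ht z) * |dirD v u z| ^ p ∂μ
      ≤ 2 ^ p * (2 + 1 / (p - 1)) * C * ∫ z, G.ht z ^ γ * |G.op c u z| ^ p ∂μ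
        + ε ^ p * (2 ^ p * (2 + 1 / (p - 1)) * (B + J)) := by
    intro ε hε
    have hψ := primPair_reg hp hε
    have hb := HB (regPow p ε) (regPow' p ε) (regPrim p ε) hψ (ε ^ p)
      (fun y => regPow'_nonneg hp hε hp2 y) (fun y => regPrim_sub hp hε hp2 y)
      (fun y => regPow_young hp hε hp2 y)
    have by1 := hyt.bddMeas hK
    have bψ : BddMeas K (fun z => regPow p ε (y z)) := by1.cont_comp hψ.continuous
    have bψ' : BddMeas K (fun z => regPow' p ε (y z)) := by1.cont_comp hψ.cont
    have bgr := Geo.bddMeas_gradSq (G := G) hK hyt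
    have iX : Integrable (fun z => wA p γ Λ β (G.ht z) * th Λ β (G.ht z) ^ p * (G.ht z ^ a) ^ p
          * (y z * regPow p ε (y z)) + wA p γ Λ β (G.ht z) * th Λ β (G.ht z) ^ (p - 2)
          * (G.ht z ^ a) ^ p * (regPow' p ε (y z) * G.gradSq y z)) μ := by
      refine BddMeas.integrable (K := K) ?_ hK.measurableSet hK.measure_lt_top.ne ?_
      · solve_by_elim (maxDepth := 40) [BddMeas.mul, BddMeas.add, BddMeas.sub]
      · intro z hz
        simp [hyt.zero_off hz, hψ.zero, Geo.gradSq_zero_off hyt hz]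
    have main : ∀ z, wA p γ Λ β (G.ht z) * |dirD v u z| ^ p ≤ 2 ^ p * (2 + 1 / (p - 1)) *
        ((wA p γ Λ β (G.ht z) * th Λ β (G.ht z) ^ p * (G.ht z ^ a) ^ p
          * (y z * regPow p ε (y z)) + wA p γ Λ β (G.ht z) * th Λ β (G.ht z) ^ (p - 2)
          * (G.ht z ^ a) ^ p * (regPow' p ε (y z) * G.gradSq y z))
          + ε ^ p * K.indicator (fun z => wA p γ Λ β (G.ht z) * th Λ β (G.ht z) ^ p
            * (G.ht z ^ a) ^ p) z) := by
      intro z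
      by_cases hz : z ∈ K
      · have ht := hpos z hz
        rw [hDu z ht, indicator_of_mem hz]
        refine grad_pointwise (t := 0) hp hp2 hε (by positivity) (th_pos hΛ ht)
          (wA_pos hΛ ht p γ).le ?_ (regPow'_ge hp hε hp2 _) (hv2 _ _)
          (reg_le hp hε hp2 _)
        have hr := rho_pos (β := β) hΛ ht
        rw [abs_div, abs_mul, abs_of_pos ht, abs_of_nonneg ha.1, th]
        gcongr
        have := mul_le_mul ha.2 hv1 (abs_nonneg _) (by norm_num)
        linarith
      · rw [(hu.dirD v).zero_off hz]
        simp [hyt.zero_off hz, hψ.zero, Geo.gradSq_zero_off hyt hz, hz,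
          Real.zero_rpow hp0.ne']
    refine (integral_mono iL ((iX.add (ih.const_mul (ε ^ p))).const_mul _) main).trans ?_
    rw [integral_const_mul]
    simp only [Pi.add_apply]
    rw [integral_add iX (ih.const_mul _), integral_const_mul, ← hJ]
    have hc : (0 : ℝ) ≤ 2 ^ p * (2 + 1 / (p - 1)) := by positivity
    have := mul_le_mul_of_nonneg_left (add_le_add_left hb (ε ^ p * J)) hc
    refine this.trans_eq ?_
    ring
  set D := 2 ^ p * (2 + 1 / (p - 1)) * (B + J) with hD
  have hlim : Filter.Tendsto (fun ε : ℝ => 2 ^ p * (2 + 1 / (p - 1)) * C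
      * ∫ z, G.ht z ^ γ * |G.op c u z| ^ p ∂μ + ε ^ p * D) (nhdsWithin 0 (Ioi 0))
      (nhds (2 ^ p * (2 + 1 / (p - 1)) * C * ∫ z, G.ht z ^ γ * |G.op c u z| ^ p ∂μ)) := by
    have : Filter.Tendsto (fun ε : ℝ => ε ^ p) (nhdsWithin 0 (Ioi 0)) (nhds 0) := by
      have h := (Real.continuous_rpow_const hp0.le).tendsto (0 : ℝ)
      rw [Real.zero_rpow hp0.ne'] at h
      exact h.mono_left nhdsWithin_le_nhds
    simpa using (tendsto_const_nhds.add (this.mul_const D))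
  exact ge_of_tendsto hlim (Filter.eventually_of_mem self_mem_nhdsWithin fun ε hε => key ε hε)

theorem zero_order_gt_two {ν β p γ : ℝ} (hν : 0 < ν) (hβ : 0 < β) (hβ1 : β < 1) (hp : 2 < p)
    (h1 : p - p * β - 1 < γ) (h2 : γ < 2 * p - 1) : ∃ C : ℝ, 0 < C ∧
    ∀ (E ι : Type) [NormedAddCommGroup E] [NormedSpace ℝ E] [MeasurableSpace E] [BorelSpace E]
      [FiniteDimensional ℝ E] [Fintype ι] (μ : Measure E) [μ.IsAddHaarMeasure] (G : Geo E ι)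
      (K : Set E), IsCompact K → (∀ z ∈ K, 0 < G.ht z) → ∀ Λ, 0 < Λ → ∀ c : Coef ι,
      c.Ell ν β Λ → ∀ u : E → ℝ, IsTest (⊤ : ℕ∞) K u →
      ∫ z, wA p γ Λ β (G.ht z) * th Λ β (G.ht z) ^ p * |u z| ^ p ∂μ
        ≤ C * ∫ z, G.ht z ^ γ * |G.op c u z| ^ p ∂μ := by
  have hp1 : 1 < p := by linarith
  have hp0 : 0 < p := by linarith
  obtain ⟨a, C, ha, hC, H⟩ := zero_order_estimate hν hβ hβ1 hp1 h1 h2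
  refine ⟨C, hC, ?_⟩
  intro E ι _ _ _ _ _ _ μ _ G K hK hpos Λ hΛ c hc u hu
  obtain ⟨B, hB, HB⟩ := H E ι μ G K hK hpos Λ hΛ c hc u hu
  have hψ := primPair_spow hp
  have hb := HB _ _ _ hψ 0 (fun y => mul_nonneg (by linarith) (by positivity)) (fun y => by
    rw [mul_spow hp1]; field_simp; simp) (fun y => by
      rw [mul_spow hp1, abs_spow hp1, ← Real.rpow_mul (abs_nonneg _)]
      apply le_of_eq; congr 1; field_simp [show p - 1 ≠ 0 by linarith])
  rw [zero_mul, add_zero] at hb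
  refine le_trans ?_ hb
  set y : E → ℝ := fun z => G.ht z ^ (-a) * u z with hy
  have hyt : IsTest (⊤ : ℕ∞) K y := hu.rpow_mul hpos (-a)
  have bA := bddMeas_wA (G := G) (β := β) hK hpos hΛ p γ
  have bθp := bddMeas_th (G := G) (β := β) hK hpos hΛ p
  have bθp2 := bddMeas_th (G := G) (β := β) hK hpos hΛ (p - 2)
  have bSp : BddMeas K (fun z => (G.ht z ^ a) ^ p) :=
    (bddMeas_ht (f := fun t => (t ^ a) ^ p) hK hpos (by fun_prop)
      ((ContinuousOn.rpow_const continuousOn_id fun t ht => Or.inl (ne_of_gt ht)).rpow_const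
        fun t ht => Or.inl (Real.rpow_pos_of_pos ht _).ne'))
  have by1 := hyt.bddMeas hK
  have bψ : BddMeas K (fun z => spow p (y z)) := by1.cont_comp hψ.continuous
  have bψ' : BddMeas K (fun z => (p - 1) * |y z| ^ (p - 2)) :=
    by1.cont_comp (h := fun y => (p - 1) * |y| ^ (p - 2)) hψ.cont
  have bgr := Geo.bddMeas_gradSq (G := G) hK hyt
  refine integral_mono ?_ ?_ fun z => ?_
  · refine BddMeas.integrable (K := K) ((bA.mul bθp).mul ((hu.bddMeas hK).abs_rpow hp0.le))
      hK.measurableSet hK.measure_lt_top.ne fun z hz => ?_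
    rw [hu.zero_off hz, abs_zero, Real.zero_rpow hp0.ne', mul_zero]
  · refine BddMeas.integrable (K := K) ?_ hK.measurableSet hK.measure_lt_top.ne ?_
    · solve_by_elim (maxDepth := 40) [BddMeas.mul, BddMeas.add, BddMeas.sub]
    · intro z hz
      have h0 := hyt.zero_off hz
      simp only [hy] at h0
      simp [h0, hψ.zero, Geo.gradSq_zero_off hyt hz]
  · by_cases hz : z ∈ K
    · have ht := hpos z hz
      have e : |u z| ^ p = (G.ht z ^ a) ^ p * |y z| ^ p := by
        rw [← Real.mul_rpow (by positivity) (abs_nonneg _)]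
        congr 1
        simp only [hy]
        rw [abs_mul, abs_of_pos (Real.rpow_pos_of_pos ht _), ← mul_assoc, ← Real.rpow_add ht]
        simp
      have h3 : 0 ≤ wA p γ Λ β (G.ht z) * th Λ β (G.ht z) ^ (p - 2) * (G.ht z ^ a) ^ p
          * ((p - 1) * |y z| ^ (p - 2) * G.gradSq y z) := by
        have := Geo.gradSq_nonneg G y z
        have h4 := wA_pos (β := β) hΛ ht p γ
        have h5 := th_pos (β := β) hΛ ht
        have : 0 < p - 1 := by linarith
        positivity
      simp only [mul_spow hp1]
      rw [e]
      linarith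
    · have h0 := hyt.zero_off hz
      simp only [hy] at h0
      simp [hψ.zero, Geo.gradSq_zero_off hyt hz, hu.zero_off hz, Real.zero_rpow hp0.ne']

end GradSmall

section TangentialLarge

theorem rpow_mul_sq_le {p a b : ℝ} (hp : 2 < p) (ha : 0 ≤ a) (hb : 0 ≤ b) :
    a ^ (p - 2) * b ^ 2 ≤ a ^ p + b ^ p := by
  have e : ∀ x : ℝ, 0 ≤ x → x ^ p = x ^ (p - 2) * x ^ 2 := fun x hx => by
    rw [← Real.rpow_two, ← Real.rpow_add' hx (by linarith)]; congr 1; ring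
  have h1 := Real.rpow_nonneg ha p
  have h2 := Real.rpow_nonneg hb p
  have h3 := Real.rpow_nonneg ha (p - 2)
  rcases le_total a b with h | h
  · have := Real.rpow_le_rpow ha h (show (0 : ℝ) ≤ p - 2 by linarith)
    rw [e b hb] at h2 ⊢
    nlinarith [sq_nonneg b]
  · have : b ^ 2 ≤ a ^ 2 := by gcongr
    rw [e a ha] at h1 ⊢
    nlinarith

theorem rpow_mul_sq_le_eps {p η : ℝ} (hp : 2 < p) (hη : 0 < η) : ∃ C, 0 < C ∧ ∀ a b : ℝ,
    0 ≤ a → 0 ≤ b → a ^ (p - 2) * b ^ 2 ≤ η * a ^ p + C * b ^ p := by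
  have hp0 : 0 < p := by linarith
  set l := η ^ (1 / p) with hl
  have hl0 : 0 < l := Real.rpow_pos_of_pos hη _
  have hlp : l ^ p = η := by rw [hl, ← Real.rpow_mul hη.le]; field_simp; simp
  set k := l ^ (-((p - 2) / 2)) with hk
  have hk0 : 0 < k := Real.rpow_pos_of_pos hl0 _
  refine ⟨k ^ p, Real.rpow_pos_of_pos hk0 _, fun a b ha hb => ?_⟩
  have h := rpow_mul_sq_le hp (a := l * a) (b := k * b) (by positivity) (by positivity)
  rw [Real.mul_rpow hl0.le ha, Real.mul_rpow hl0.le ha, Real.mul_rpow hk0.le hb, hlp, mul_pow] at h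
  have e : l ^ (p - 2) * k ^ 2 = 1 := by
    rw [hk, ← Real.rpow_two, ← Real.rpow_mul hl0.le, ← Real.rpow_add hl0]
    ring_nf
    simp
  calc a ^ (p - 2) * b ^ 2 = (l ^ (p - 2) * k ^ 2) * (a ^ (p - 2) * b ^ 2) := by rw [e, one_mul]
    _ = l ^ (p - 2) * a ^ (p - 2) * (k ^ 2 * b ^ 2) := by ring
    _ ≤ _ := h

theorem abs_wt''_le {A r k κ β t : ℝ} (hA : 0 ≤ A) (hκ : 0 ≤ κ) (ht : 0 < t) (hβ : 0 < β)
    (hβ1 : β < 1) :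
    |wt'' A r k κ β t| ≤ ((|r| + |k|) ^ 2 + (|r| + |k|) + |k|) * (wt A r k κ β t / t ^ 2) := by
  have hw0 := wfrac_nonneg (β := β) hκ ht
  have hw1 := wfrac_le_one (β := β) hκ ht
  have hb := wt_base_pos (β := β) hκ ht
  set w := wfrac κ β t
  have hwt : 0 ≤ wt A r k κ β t := by unfold wt; positivity
  have hb0 : |k * β * w| ≤ |k| := by
    rw [abs_mul, abs_mul, abs_of_pos hβ, abs_of_nonneg hw0]
    have : β * w ≤ 1 := by nlinarith
    nlinarith [abs_nonneg k]
  have h1 : |r + k * β * w| ≤ |r| + |k| := (abs_add_le _ _).trans (by linarith)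
  have h2 : |k * β * β * (w * (1 - w))| ≤ |k| := by
    have e : k * β * β * (w * (1 - w)) = (k * β * w) * (β * (1 - w)) := by ring
    rw [e, abs_mul]
    have : |β * (1 - w)| ≤ 1 := by
      rw [abs_of_nonneg (mul_nonneg hβ.le (by linarith))]; nlinarith
    nlinarith [abs_nonneg (k * β * w), abs_nonneg (β * (1 - w))]
  have h3 : |(r + k * β * w) ^ 2 - (r + k * β * w) + k * β * β * (w * (1 - w))|
      ≤ (|r| + |k|) ^ 2 + (|r| + |k|) + |k| := by
    refine (abs_add_le _ _).trans (add_le_add ((abs_sub _ _).trans (add_le_add ?_ h1)) h2)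
    rw [abs_pow]; gcongr
  rw [wt'', abs_mul, abs_of_nonneg hwt, abs_div, abs_of_pos (show 0 < t ^ 2 by positivity)]
  calc wt A r k κ β t * (_ / t ^ 2) ≤ wt A r k κ β t
      * (((|r| + |k|) ^ 2 + (|r| + |k|) + |k|) / t ^ 2) := by gcongr
    _ = _ := by ring

theorem wA_div_th_sq {p γ Λ β t : ℝ} (hΛ : 0 < Λ) (ht : 0 < t) :
    wA p γ Λ β t / th Λ β t ^ 2 = wt (Λ ^ p) (γ - p + p * β + 2) (-2) Λ β t := by
  have hb := wt_base_pos (β := β) hΛ.le ht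
  rw [wA, th, wt, rho, Real.mul_rpow hΛ.le (by positivity), Real.rpow_add ht, Real.rpow_add ht,
    Real.rpow_neg hb.le, ← Real.rpow_mul ht.le, mul_comm β p, Real.rpow_two, Real.rpow_two]
  field_simp

theorem wA_mul_th_rpow_neg {p γ Λ β t : ℝ} (hp : 0 ≤ p) (hΛ : 0 < Λ) (ht : 0 < t) :
    wA p γ Λ β t * (th Λ β t ^ p)⁻¹ ≤ t ^ γ := by
  have hr := rho_pos (β := β) hΛ ht
  rw [wA, th, Real.div_rpow (by linarith) ht.le, inv_div]
  have h1 : rho Λ β t ^ p ≤ (1 + rho Λ β t) ^ p := by gcongr; linarith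
  have h2 : 0 < (1 + rho Λ β t) ^ p := by positivity
  have h3 : 0 < t ^ p := by positivity
  calc t ^ (γ - p) * rho Λ β t ^ p * (t ^ p / (1 + rho Λ β t) ^ p)
      = (t ^ (γ - p) * t ^ p) * (rho Λ β t ^ p / (1 + rho Λ β t) ^ p) := by ring
    _ ≤ (t ^ (γ - p) * t ^ p) * 1 := by gcongr; rwa [div_le_one h2]
    _ = t ^ γ := by rw [mul_one, ← Real.rpow_add ht]; congr 1; ring

variable {E ι : Type*} [NormedAddCommGroup E] [NormedSpace ℝ E] [MeasurableSpace E] [BorelSpace E]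
  [FiniteDimensional ℝ E] [Fintype ι] {μ : Measure E} [μ.IsAddHaarMeasure] {G : Geo E ι}
  {c : Coef ι} {K : Set E}

/-- Tangential derivatives may be moved from the operator to the test function. -/
theorem zeroInt_op_tan (hK : IsCompact K) (hc : c.Loc G K) {ψ ψ' Ψ : ℝ → ℝ}
    (hψ : PrimPair ψ ψ' Ψ) {Q : ℝ → ℝ} (hQ : BddMeas K fun z => Q (G.ht z)) {u : E → ℝ}
    (hu : IsTest (⊤ : ℕ∞) K u) (j : ι) :
    ZeroInt μ (fun z => Q (G.ht z) * (ψ (dirD (G.e j) u z) * G.op c (dirD (G.e j) u) z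
      + ψ' (dirD (G.e j) u z) * dirD (G.e j) (dirD (G.e j) u) z * G.op c u z)) := by
  have hle : (1 : WithTop ℕ∞) ≤ ((⊤ : ℕ∞) : WithTop ℕ∞) := WithTop.coe_le_coe.2 le_top
  have hv := hu.dirD (G.e j)
  have tψ : IsTest 1 K (fun z => ψ (dirD (G.e j) u z)) :=
    (hv.of_le hle).comp hψ.contDiff hψ.zero
  have base : ∀ (k : ℝ → ℝ) (w : E → ℝ), BddMeas K (fun z => k (G.ht z)) → IsTest (⊤ : ℕ∞) K w →
      ZeroInt μ (fun z => Q (G.ht z) * k (G.ht z) * (ψ (dirD (G.e j) u z) * dirD (G.e j) w z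
        + ψ' (dirD (G.e j) u z) * dirD (G.e j) (dirD (G.e j) u) z * w z)) := by
    intro k w hk hw
    have := zeroInt_tan (μ := μ) hK (hQ.mul hk) (tψ.mul (hw.of_le hle)) (v := G.e j) fun z t => by
      rw [Geo.ht_add_of_zero (G.ht_e j)]
    simpa only [dirD_psi_mul hψ (hv.differentiableAt hle _) (hw.differentiableAt hle _)] using this
  have Z1 := base c.m _ hc.m (hu.dirD G.τ)
  have Z2 := base c.q _ hc.q hu
  have Z3 := base (fun _ => 1) _ (BddMeas.const _) ((hu.dirD G.n).dirD G.n)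
  have Z4 := ZeroInt.sum (s := Finset.univ) fun i =>
    base (c.b i) _ (hc.b i) ((hu.dirD G.n).dirD (G.e i))
  have Z5 := ZeroInt.sum (s := Finset.univ) fun i => ZeroInt.sum (s := Finset.univ) fun k =>
    base (c.a i k) _ (hc.a i k) ((hu.dirD (G.e k)).dirD (G.e i))
  have Z := (((Z1.add Z2).sub Z3).sub Z4).sub Z5
  convert Z using 2 with z
  have c1 : ∀ w, dirD w (dirD (G.e j) u) = dirD (G.e j) (dirD w u) := fun w => by
    ext z; exact dirD_comm hu.contDiff _ _ _
  have c2 : ∀ w w', dirD w (dirD w' (dirD (G.e j) u)) = dirD (G.e j) (dirD w (dirD w' u)) :=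
    fun w w' => by
      rw [c1]; ext z; exact dirD_comm (hu.dirD w').contDiff _ _ _
  simp only [Geo.op, c2, c1 G.τ, mul_add, Finset.sum_add_distrib, mul_sub,
    Finset.mul_sum, mul_one]
  have r1 : ∀ a b d e : ℝ, a * (b * (d * e)) = a * d * (b * e) := fun a b d e => by ring
  simp only [r1]
  ring

theorem tangential_pointwise {ν p Q wa θ v D f q form gr C₀ tγ : ℝ} (hν : 0 < ν) (hp : 2 < p)
    (hwa : 0 < wa) (hθ : 0 < θ) (hQ : Q = wa / θ ^ 2) (hq : 0 ≤ q) (hform : ν * gr ≤ form)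
    (hgr : D ^ 2 ≤ gr) {Q'' : ℝ} (hQ'' : |Q''| ≤ C₀ * wa) (htγ : wa * (θ ^ p)⁻¹ ≤ tγ) :
    ν * (p - 1) / 2 * (Q * |v| ^ (p - 2) * gr)
      - (C₀ / p + (p - 1) / (2 * ν)) * (wa * |v| ^ p) - (p - 1) / (2 * ν) * (tγ * |f| ^ p)
      ≤ q * Q * (v * spow p v) + Q * ((p - 1) * |v| ^ (p - 2)) * form - Q'' * (|v| ^ p / p)
        + Q * ((p - 1) * |v| ^ (p - 2)) * D * f := by
  have hp1 : 0 < p - 1 := by linarith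
  have hp0 : 0 < p := by linarith
  have hQ0 : 0 < Q := by rw [hQ]; positivity
  have hV : 0 ≤ |v| ^ (p - 2) := by positivity
  have hVp : 0 ≤ |v| ^ p := by positivity
  rw [mul_spow (by linarith)]
  have s1 : 0 ≤ q * Q * |v| ^ p := by positivity
  have s2 : Q'' * (|v| ^ p / p) ≤ C₀ / p * (wa * |v| ^ p) := by
    calc Q'' * (|v| ^ p / p) ≤ (C₀ * wa) * (|v| ^ p / p) := by
          gcongr; exact (le_abs_self _).trans hQ''
      _ = _ := by ring
  have s3 : ν / 2 * D ^ 2 - -(1 / (2 * ν) * f ^ 2) ≥ -(D * f) := by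
    have : 0 ≤ (ν * D + f) ^ 2 / (2 * ν) := by positivity
    have e : (ν * D + f) ^ 2 / (2 * ν) = ν / 2 * D ^ 2 + 1 / (2 * ν) * f ^ 2 + D * f := by
      field_simp; ring
    linarith
  have s4 : Q * |v| ^ (p - 2) * f ^ 2 ≤ wa * |v| ^ p + tγ * |f| ^ p := by
    have := rpow_mul_sq_le hp (abs_nonneg v) (show 0 ≤ |f| / θ by positivity)
    rw [Real.div_rpow (abs_nonneg _) hθ.le, div_pow, sq_abs] at this
    calc Q * |v| ^ (p - 2) * f ^ 2 = wa * (|v| ^ (p - 2) * (f ^ 2 / θ ^ 2)) := by rw [hQ]; ring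
      _ ≤ wa * (|v| ^ p + |f| ^ p / θ ^ p) := by gcongr
      _ = wa * |v| ^ p + wa * (θ ^ p)⁻¹ * |f| ^ p := by ring
      _ ≤ _ := by gcongr
  have W : 0 ≤ Q * ((p - 1) * |v| ^ (p - 2)) := by positivity
  have k1 : Q * ((p - 1) * |v| ^ (p - 2)) * (ν / 2 * gr - 1 / (2 * ν) * f ^ 2)
      ≤ Q * ((p - 1) * |v| ^ (p - 2)) * (form + D * f) := by
    refine mul_le_mul_of_nonneg_left ?_ W
    have : ν / 2 * D ^ 2 ≤ ν / 2 * gr := by gcongr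
    linarith
  have k2 : (p - 1) / (2 * ν) * (Q * |v| ^ (p - 2) * f ^ 2)
      ≤ (p - 1) / (2 * ν) * (wa * |v| ^ p + tγ * |f| ^ p) := by gcongr
  have k3 : Q * ((p - 1) * |v| ^ (p - 2)) * (ν / 2 * gr - 1 / (2 * ν) * f ^ 2)
      = ν * (p - 1) / 2 * (Q * |v| ^ (p - 2) * gr)
        - (p - 1) / (2 * ν) * (Q * |v| ^ (p - 2) * f ^ 2) := by field_simp
  linarith

theorem tangential_pointwise' {p Q wa θ v D u gr η Cη : ℝ} (hp : 2 < p) (hη : 0 < η)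
    (hwa : 0 < wa) (hθ : 0 < θ) (hQ : Q = wa / θ ^ 2) (hgr : D ^ 2 ≤ gr)
    (hCη : ∀ a b : ℝ, 0 ≤ a → 0 ≤ b → a ^ (p - 2) * b ^ 2 ≤ η * a ^ p + Cη * b ^ p)
    {κ : ℝ} (hκ : 0 < κ) :
    wa * |v| ^ p - (p - 1) * κ * (Q * |v| ^ (p - 2) * gr)
      - (p - 1) / (4 * κ) * η * (wa * |v| ^ p) - (p - 1) / (4 * κ) * Cη * (wa * θ ^ p * |u| ^ p)
      ≤ wa * |v| ^ p + wa * ((p - 1) * |v| ^ (p - 2)) * D * u := by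
  have hp1 : 0 < p - 1 := by linarith
  have hQ0 : 0 < Q := by rw [hQ]; positivity
  have hV : 0 ≤ |v| ^ (p - 2) := by positivity
  have s3 : -(wa * D * u) ≤ κ * Q * D ^ 2 + 1 / (4 * κ) * (wa * (θ * |u|) ^ 2) := by
    have : 0 ≤ wa * (2 * κ * (D / θ) + θ * u) ^ 2 / (4 * κ) := by positivity
    have e : wa * (2 * κ * (D / θ) + θ * u) ^ 2 / (4 * κ)
        = κ * Q * D ^ 2 + 1 / (4 * κ) * (wa * (θ * |u|) ^ 2) + wa * D * u := by
      rw [hQ, mul_pow, sq_abs]; field_simp; ring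
    linarith
  have s4 := hCη |v| (θ * |u|) (abs_nonneg _) (by positivity)
  rw [Real.mul_rpow hθ.le (abs_nonneg _)] at s4
  have k1 := mul_le_mul_of_nonneg_left s3 (show 0 ≤ (p - 1) * |v| ^ (p - 2) by positivity)
  have k2 := mul_le_mul_of_nonneg_left s4 (show 0 ≤ (p - 1) / (4 * κ) * wa by positivity)
  have k3 : (p - 1) * κ * (Q * |v| ^ (p - 2) * D ^ 2) ≤ (p - 1) * κ * (Q * |v| ^ (p - 2) * gr) := by
    gcongr
  have e1 : (p - 1) * |v| ^ (p - 2) * (κ * Q * D ^ 2 + 1 / (4 * κ) * (wa * (θ * |u|) ^ 2))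
     = (p - 1) * κ * (Q * |v| ^ (p - 2) * D ^ 2)
      + (p - 1) / (4 * κ) * wa * (|v| ^ (p - 2) * (θ * |u|) ^ 2) := by field_simp
  have e2 : (p - 1) * |v| ^ (p - 2) * -(wa * D * u) = -(wa * ((p - 1) * |v| ^ (p - 2)) * D * u) := by
    ring
  have e3 : (p - 1) / (4 * κ) * wa * (η * |v| ^ p + Cη * (θ ^ p * |u| ^ p))
    = (p - 1) / (4 * κ) * η * (wa * |v| ^ p) + (p - 1) / (4 * κ) * Cη * (wa * θ ^ p * |u| ^ p) := by
    ring
  linarith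

end TangentialLarge

section TangentialEstimate

theorem Weight.one {E ι : Type*} [NormedAddCommGroup E] [NormedSpace ℝ E] [MeasurableSpace E]
    [BorelSpace E] (G : Geo E ι) (K : Set E) :
    Weight G K (fun _ => 1) (fun _ => 0) (fun _ => 0) :=
  ⟨BddMeas.const _, BddMeas.const _, BddMeas.const _, fun t _ => hasDerivAt_const t 1,
    fun t _ => hasDerivAt_const t 0⟩

theorem integral_sub_sub_le {X : Type*} [MeasurableSpace X] {μ : Measure X} {f g h k : X → ℝ}
    {a b c : ℝ} (hf : Integrable f μ) (hg : Integrable g μ) (hh : Integrable h μ)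
    (hk : Integrable k μ) (hle : ∀ z, a * f z - b * g z - c * h z ≤ k z) :
    a * ∫ z, f z ∂μ - b * ∫ z, g z ∂μ - c * ∫ z, h z ∂μ ≤ ∫ z, k z ∂μ := by
  have i1 := hf.const_mul a
  have i2 := hg.const_mul b
  have i3 := hh.const_mul c
  have i12 : Integrable (fun z => a * f z - b * g z) μ := i1.sub i2
  rw [← integral_const_mul, ← integral_const_mul, ← integral_const_mul, ← integral_sub i1 i2,
    ← integral_sub i12 i3]
  exact integral_mono (i12.sub i3) hk hle

set_option maxHeartbeats 1000000 in
theorem tangential_gt_two {ν β p γ : ℝ} (hν : 0 < ν) (hβ : 0 < β) (hβ1 : β < 1) (hp : 2 < p)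
    (h1 : p - p * β - 1 < γ) (h2 : γ < 2 * p - 1) : ∃ C : ℝ, 0 < C ∧
    ∀ (E ι : Type) [NormedAddCommGroup E] [NormedSpace ℝ E] [MeasurableSpace E] [BorelSpace E]
      [FiniteDimensional ℝ E] [Fintype ι] (μ : Measure E) [μ.IsAddHaarMeasure] (G : Geo E ι)
      (K : Set E), IsCompact K → (∀ z ∈ K, 0 < G.ht z) → ∀ Λ, 0 < Λ → ∀ c : Coef ι,
      c.Ell ν β Λ → ∀ u : E → ℝ, IsTest (⊤ : ℕ∞) K u → ∀ j : ι,
      ∫ z, wA p γ Λ β (G.ht z) * |dirD (G.e j) u z| ^ p ∂μ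
          ≤ C * ∫ z, G.ht z ^ γ * |G.op c u z| ^ p ∂μ ∧
      ∫ z, wA p γ Λ β (G.ht z) / th Λ β (G.ht z) ^ 2 * |dirD (G.e j) u z| ^ (p - 2)
          * G.gradSq (dirD (G.e j) u) z ∂μ
        ≤ C * ∫ z, G.ht z ^ γ * |G.op c u z| ^ p ∂μ := by
  obtain ⟨C₁, hC₁, H⟩ := zero_order_gt_two hν hβ hβ1 hp h1 h2
  have hp1 : 0 < p - 1 := by linarith
  have hp0 : 0 < p := by linarith
  set r₀ := γ - p + p * β + 2 with hr₀
  set C₀ := (|r₀| + |(-2 : ℝ)|) ^ 2 + (|r₀| + |(-2 : ℝ)|) + |(-2 : ℝ)| with hC₀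
  have hC₀0 : 0 ≤ C₀ := by positivity
  -- the first inequality reads `α₁ X ≤ α₂ Y + α₃ F`
  set α₁ := ν * (p - 1) / 2 with hα₁
  set α₂ := C₀ / p + (p - 1) / (2 * ν) with hα₂
  set α₃ := (p - 1) / (2 * ν) with hα₃
  have a1 : 0 < α₁ := by positivity
  have a2 : 0 < α₂ := by positivity
  have a3 : 0 < α₃ := by positivity
  set k := α₁ / (4 * α₂ * (p - 1)) with hk
  have hk0 : 0 < k := by positivity
  set η := k / (p - 1) with hη
  have hη0 : 0 < η := by positivity
  obtain ⟨Cη, hCη0, hCη⟩ := rpow_mul_sq_le_eps hp hη0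
  set D₁ := 2 * (α₃ / (4 * α₂) + (p - 1) / (4 * k) * Cη * C₁) with hD₁
  have hD₁0 : 0 < D₁ := by positivity
  set D₂ := (α₂ * D₁ + α₃) / α₁ with hD₂
  have hD₂0 : 0 < D₂ := by positivity
  refine ⟨D₁ + D₂, by positivity, ?_⟩
  intro E ι _ _ _ _ _ _ μ _ G K hK hpos Λ hΛ c hc u hu j
  have hle : (1 : WithTop ℕ∞) ≤ ((⊤ : ℕ∞) : WithTop ℕ∞) := WithTop.coe_le_coe.2 le_top
  have hM := H E ι μ G K hK hpos Λ hΛ c hc u hu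
  have hl := hc.loc (G := G) hK hpos hν
  have hv := hu.dirD (G.e j)
  have hψ := primPair_spow hp
  have hw := weight_wt (G := G) (β := β) hK hpos hΛ.le (Λ ^ p) r₀ (-2)
  have hQe : ∀ z ∈ K, wt (Λ ^ p) r₀ (-2) Λ β (G.ht z)
      = wA p γ Λ β (G.ht z) / th Λ β (G.ht z) ^ 2 := fun z hz =>
    (wA_div_th_sq hΛ (hpos z hz)).symm
  set v := dirD (G.e j) u with hvdef
  -- boundedness
  have bu := hu.bddMeas hK
  have bv := hv.bddMeas hK
  have bvj := (hv.dirD (G.e j)).bddMeas hK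
  have bgr := Geo.bddMeas_gradSq (G := G) hK hv
  have bop := Geo.bddMeas_op (G := G) hK hl hu
  have bfo := Geo.bddMeas_form (G := G) hK hl hv
  have bA := bddMeas_wA (G := G) (β := β) hK hpos hΛ p γ
  have bθp := bddMeas_th (G := G) (β := β) hK hpos hΛ p
  have bγ := bddMeas_ht_rpow (G := G) hK hpos γ
  have bQ := hw.bm
  have bQ'' := hw.bm''
  have bq := hl.q
  have bvp := bv.abs_rpow hp0.le
  have bvp2 := bv.abs_rpow (show 0 ≤ p - 2 by linarith)
  have bup := bu.abs_rpow hp0.le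
  have bopp := bop.abs_rpow hp0.le
  have bψ : BddMeas K (fun z => spow p (v z)) := bv.cont_comp hψ.continuous
  have bψ' : BddMeas K (fun z => (p - 1) * |v z| ^ (p - 2)) :=
    bv.cont_comp (h := fun y => (p - 1) * |y| ^ (p - 2)) hψ.cont
  have bc := fun x : ℝ => BddMeas.const (K := K) x
  have z0 : ∀ z, z ∉ K → u z = 0 := fun z hz => hu.zero_off hz
  have zv : ∀ z, z ∉ K → v z = 0 := fun z hz => hv.zero_off hz
  have zop : ∀ z, z ∉ K → G.op c u z = 0 := fun z hz => Geo.op_zero_off hu hz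
  have zgr : ∀ z, z ∉ K → G.gradSq v z = 0 := fun z hz => Geo.gradSq_zero_off hv hz
  have zfo : ∀ z, z ∉ K → G.form c v z = 0 := fun z hz => Geo.form_zero_off hv hz
  have hz0 : (0 : ℝ) ^ p = 0 := Real.zero_rpow hp0.ne'
  have iY : Integrable (fun z => wA p γ Λ β (G.ht z) * |v z| ^ p) μ :=
    (bA.mul bvp).integrable hK.measurableSet hK.measure_lt_top.ne fun z hz => by
      rw [zv z hz, abs_zero, hz0, mul_zero]
  have iF : Integrable (fun z => G.ht z ^ γ * |G.op c u z| ^ p) μ :=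
    (bγ.mul bopp).integrable hK.measurableSet hK.measure_lt_top.ne fun z hz => by
      rw [zop z hz, abs_zero, hz0, mul_zero]
  have iZ : Integrable (fun z => wA p γ Λ β (G.ht z) * th Λ β (G.ht z) ^ p * |u z| ^ p) μ :=
    ((bA.mul bθp).mul bup).integrable hK.measurableSet hK.measure_lt_top.ne fun z hz => by
      rw [z0 z hz, abs_zero, hz0, mul_zero]
  have iX : Integrable (fun z => wt (Λ ^ p) r₀ (-2) Λ β (G.ht z) * |v z| ^ (p - 2)
      * G.gradSq v z) μ :=
    ((bQ.mul bvp2).mul bgr).integrable hK.measurableSet hK.measure_lt_top.ne fun z hz => by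
      rw [zgr z hz, mul_zero]
  have eX : ∫ z, wA p γ Λ β (G.ht z) / th Λ β (G.ht z) ^ 2 * |v z| ^ (p - 2) * G.gradSq v z ∂μ
      = ∫ z, wt (Λ ^ p) r₀ (-2) Λ β (G.ht z) * |v z| ^ (p - 2) * G.gradSq v z ∂μ := by
    congr 1; ext z
    by_cases hz : z ∈ K
    · rw [hQe z hz]
    · rw [zgr z hz, mul_zero, mul_zero]
  rw [eX]
  set X := ∫ z, wt (Λ ^ p) r₀ (-2) Λ β (G.ht z) * |v z| ^ (p - 2) * G.gradSq v z ∂μ with hX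
  set Y := ∫ z, wA p γ Λ β (G.ht z) * |v z| ^ p ∂μ with hY
  set F := ∫ z, G.ht z ^ γ * |G.op c u z| ^ p ∂μ with hF
  set Z := ∫ z, wA p γ Λ β (G.ht z) * th Λ β (G.ht z) ^ p * |u z| ^ p ∂μ with hZ
  have hgj : ∀ z, dirD (G.e j) v z ^ 2 ≤ G.gradSq v z := fun z => by
    have : dirD (G.e j) v z ^ 2 ≤ ∑ i, dirD (G.e i) v z ^ 2 :=
      Finset.single_le_sum (f := fun i => dirD (G.e i) v z ^ 2) (fun _ _ => sq_nonneg _)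
        (Finset.mem_univ j)
    have := sq_nonneg (dirD G.n v z)
    rw [Geo.gradSq]; linarith
  -- first inequality
  have I1 : α₁ * X - α₂ * Y - α₃ * F ≤ 0 := by
    have E1 := energy_identity (μ := μ) hK hpos hl hψ (Weight.one G K) hw hv
    have E2 := zeroInt_op_tan (μ := μ) hK hl hψ hw.bm hu j
    simp only [mul_zero, zero_mul, one_mul, mul_one, sub_zero, Finset.sum_const_zero,
      zero_sub] at E1
    have i1 : Integrable (fun z => wt (Λ ^ p) r₀ (-2) Λ β (G.ht z) * spow p (v z)
        * G.op c v z) μ := by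
      refine BddMeas.integrable (K := K) ((bQ.mul bψ).mul (Geo.bddMeas_op hK hl hv))
        hK.measurableSet hK.measure_lt_top.ne fun z hz => ?_
      rw [Geo.op_zero_off hv hz, mul_zero]
    have i2 : Integrable (fun z => c.q (G.ht z) * wt (Λ ^ p) r₀ (-2) Λ β (G.ht z)
          * (v z * spow p (v z)) + wt (Λ ^ p) r₀ (-2) Λ β (G.ht z) * ((p - 1) * |v z| ^ (p - 2))
          * G.form c v z + -(wt'' (Λ ^ p) r₀ (-2) Λ β (G.ht z)) * (|v z| ^ p / p)) μ := by
      refine BddMeas.integrable (K := K) ?_ hK.measurableSet hK.measure_lt_top.ne fun z hz => ?_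
      · have := bvp.mul (bc p⁻¹)
        simp only [div_eq_mul_inv]
        exact (((bq.mul bQ).mul (bv.mul bψ)).add ((bQ.mul bψ').mul bfo)).add
          (bQ''.neg.mul this)
      · rw [zfo z hz, zv z hz, abs_zero, hz0]; simp
    have i3 : Integrable (fun z => wt (Λ ^ p) r₀ (-2) Λ β (G.ht z) * ((p - 1) * |v z| ^ (p - 2))
        * dirD (G.e j) v z * G.op c u z) μ := by
      refine BddMeas.integrable (K := K) (((bQ.mul bψ').mul bvj).mul bop)
        hK.measurableSet hK.measure_lt_top.ne fun z hz => ?_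
      rw [zop z hz, mul_zero]
    have e3 : ∫ z, wt (Λ ^ p) r₀ (-2) Λ β (G.ht z) * spow p (v z) * G.op c v z ∂μ
        + ∫ z, wt (Λ ^ p) r₀ (-2) Λ β (G.ht z) * ((p - 1) * |v z| ^ (p - 2))
        * dirD (G.e j) v z * G.op c u z ∂μ = 0 := by
      rw [← integral_add i1 i3, ← E2.2]
      congr 1; ext z; ring
    rw [E1, ← integral_add i2 i3] at e3
    rw [← e3]
    refine integral_sub_sub_le iX iY iF (i2.add i3) fun z => ?_
    by_cases hz : z ∈ K
    · have ht := hpos z hz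
      have hθ := th_pos (β := β) hΛ ht
      have hwa := wA_pos (β := β) hΛ ht p γ
      have hQ'' : |wt'' (Λ ^ p) r₀ (-2) Λ β (G.ht z)| ≤ C₀ * wA p γ Λ β (G.ht z) := by
        refine (abs_wt''_le (by positivity) hΛ.le ht hβ hβ1).trans ?_
        rw [hQe z hz]
        refine mul_le_mul_of_nonneg_left ?_ hC₀0
        rw [div_div, div_le_iff₀ (by positivity)]
        have : 1 ≤ th Λ β (G.ht z) ^ 2 * G.ht z ^ 2 := by
          have hr := rho_pos (β := β) hΛ ht
          rw [← mul_pow, th, div_mul_cancel₀ _ ht.ne']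
          nlinarith
        nlinarith
      have hq0 : 0 ≤ c.q (G.ht z) := le_trans (by positivity) (hc.q_lo _ ht)
      have := tangential_pointwise (f := G.op c u z) (v := v z) hν hp hwa hθ (hQe z hz) hq0
        (Geo.form_ge hc v ht) (hgj z) hQ'' (wA_mul_th_rpow_neg hp0.le hΛ ht)
      rw [hα₁, hα₂, hα₃]
      refine this.trans (le_of_eq ?_)
      ring
    · simp [zgr z hz, zv z hz, zop z hz, zfo z hz, hz0]
  -- second inequality
  have I2 : (1 - (p - 1) / (4 * k) * η) * Y - (p - 1) * k * X - (p - 1) / (4 * k) * Cη * Z ≤ 0 := by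
    have tψ : IsTest 1 K (fun z => spow p (v z)) := (hv.of_le hle).comp hψ.contDiff hψ.zero
    have E2 := zeroInt_tan (μ := μ) hK bA (tψ.mul (hu.of_le hle)) (v := G.e j) fun z t => by
      rw [Geo.ht_add_of_zero (G.ht_e j)]
    simp only [dirD_psi_mul hψ (hv.differentiableAt hle _) (hu.differentiableAt hle _)] at E2
    rw [← E2.2]
    refine integral_sub_sub_le iY iX iZ E2.1 fun z => ?_
    by_cases hz : z ∈ K
    · have ht := hpos z hz
      have := tangential_pointwise' (v := v z) (u := u z) hp hη0 (wA_pos (β := β) hΛ ht p γ)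
        (th_pos (β := β) hΛ ht) (hQe z hz) (hgj z) hCη hk0
      rw [← hvdef]
      have e := mul_spow (p := p) (y := v z) (by linarith)
      refine le_trans (le_of_eq ?_) (this.trans (le_of_eq ?_))
      · ring
      · rw [← e]
        ring
    · simp [zgr z hz, zv z hz, z0 z hz, hz0, hψ.zero]
  have hη' : (p - 1) / (4 * k) * η = 1 / 4 := by rw [hη]; field_simp
  have hk' : (p - 1) * k * X = (α₁ * X) / (4 * α₂) := by rw [hk]; field_simp
  have hX' : (α₁ * X) / (4 * α₂) ≤ Y / 4 + α₃ / (4 * α₂) * F := by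
    rw [div_le_iff₀ (by positivity)]
    have : (Y / 4 + α₃ / (4 * α₂) * F) * (4 * α₂) = α₂ * Y + α₃ * F := by field_simp
    linarith
  have hZ' : (p - 1) / (4 * k) * Cη * Z ≤ (p - 1) / (4 * k) * Cη * (C₁ * F) := by gcongr
  have hF0 : 0 ≤ F := integral_nonneg fun z => by
    by_cases hz : z ∈ K
    · have := hpos z hz
      positivity
    · simp [zop z hz, hz0]
  rw [hη', hk'] at I2
  have hYF : Y ≤ D₁ * F := by
    have : D₁ * F = 2 * (α₃ / (4 * α₂) * F) + 2 * ((p - 1) / (4 * k) * Cη * (C₁ * F)) := by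
      rw [hD₁]; ring
    linarith
  have hXF : X ≤ D₂ * F := by
    rw [hD₂, div_mul_eq_mul_div, le_div_iff₀ a1]
    have := mul_le_mul_of_nonneg_left hYF a2.le
    linarith
  have := mul_nonneg hD₁0.le hF0
  have := mul_nonneg hD₂0.le hF0
  constructor
  · linarith
  · linarith

end TangentialEstimate

section Doubling

/-- The integrand of the doubling identity: `z` is a difference quotient over the distance `r`,
`R` its derivative in `r`, `y` the second derivative at the far end and `h`, `h''` the cut-off and
its second derivative. -/
def dblInt (p r z R y h h'' : ℝ) : ℝ :=
  -(h * spow p z * y) - r * h * ((p - 1) * |z| ^ (p - 2)) * R ^ 2 + r * h'' * (|z| ^ p / p)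

theorem abs_slope_remainder_le {g g₁ g₂ : ℝ → ℝ} {M r : ℝ} (hg : ∀ t, HasDerivAt g (g₁ t) t)
    (hg₁ : ∀ t, HasDerivAt g₁ (g₂ t) t) (hM : ∀ t, |g₂ t| ≤ M) (hr : 0 < r) :
    |(g₁ r - (g r - g 0) / r) / r| ≤ M := by
  have hc : Continuous g := continuous_iff_continuousAt.2 fun t => (hg t).continuousAt
  have hc₁ : Continuous g₁ := continuous_iff_continuousAt.2 fun t => (hg₁ t).continuousAt
  obtain ⟨s, hs, hse⟩ := exists_hasDerivAt_eq_slope g g₁ hr hc.continuousOn fun t _ => hg t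
  obtain ⟨s', hs', hse'⟩ := exists_hasDerivAt_eq_slope g₁ g₂ hs.2 hc₁.continuousOn
    fun t _ => hg₁ t
  rw [sub_zero] at hse
  have h0 : 0 < r - s := by linarith [hs.2]
  rw [← hse]
  have : g₁ r - g₁ s = g₂ s' * (r - s) := by rw [hse']; field_simp
  rw [this, abs_div, abs_mul, abs_of_pos h0, abs_of_pos hr, div_le_iff₀ hr]
  have := hM s'
  have := abs_nonneg (g₂ s')
  exact mul_le_mul (hM s') (by linarith [hs.1]) h0.le (by linarith)

theorem abs_slope_le {g g₁ : ℝ → ℝ} {M r : ℝ} (hg : ∀ t, HasDerivAt g (g₁ t) t)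
    (hM : ∀ t, |g₁ t| ≤ M) (hr : 0 < r) : |(g r - g 0) / r| ≤ M := by
  have hc : Continuous g := continuous_iff_continuousAt.2 fun t => (hg t).continuousAt
  obtain ⟨s, hs, hse⟩ := exists_hasDerivAt_eq_slope g g₁ hr hc.continuousOn fun t _ => hg t
  rw [sub_zero] at hse
  rw [← hse]
  exact hM s

theorem integral_dblInt_line {p : ℝ} (hp : 2 < p) {g g₁ g₂ h h₁ h₂ : ℝ → ℝ}
    (hg : ∀ t, HasDerivAt g (g₁ t) t) (hg₁ : ∀ t, HasDerivAt g₁ (g₂ t) t)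
    (hh : ∀ t, HasDerivAt h (h₁ t) t) (hh₁ : ∀ t, HasDerivAt h₁ (h₂ t) t) {δ : ℝ} (hδ : 0 < δ)
    (e : h δ = 0) (e₁ : h₁ δ = 0)
    (hi : IntegrableOn (fun r => dblInt p r ((g r - g 0) / r) ((g₁ r - (g r - g 0) / r) / r)
      (g₂ r) (h r) (h₂ r)) (Ioc 0 δ)) :
    ∫ r in Ioc 0 δ, dblInt p r ((g r - g 0) / r) ((g₁ r - (g r - g 0) / r) / r)
      (g₂ r) (h r) (h₂ r) = h 0 * (|g₁ 0| ^ p / p) := by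
  set D := dslope g 0 with hD
  have hDr : ∀ r, r ≠ 0 → D r = (g r - g 0) / r := fun r hr => by
    rw [hD, dslope_of_ne _ hr, slope_def_field, sub_zero]
  have hD0 : D 0 = g₁ 0 := by rw [hD, dslope_same, (hg 0).deriv]
  have hDd : ∀ r, 0 < r → HasDerivAt D ((g₁ r - (g r - g 0) / r) / r) r := fun r hr => by
    have h1 : HasDerivAt (fun r => (g r - g 0) / r) ((g₁ r * r - (g r - g 0) * 1) / r ^ 2) r :=
      ((hg r).sub_const (g 0)).div (hasDerivAt_id r) hr.ne'
    have h2 := h1.congr_of_eventuallyEq (f₁ := D) (by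
      filter_upwards [eventually_gt_nhds hr] with s hs using hDr s hs.ne')
    refine h2.congr_deriv ?_
    have := hr.ne'
    field_simp
  have hψ := primPair_spow hp
  have hDc : ContinuousOn D (Icc 0 δ) := fun r hr => by
    rcases hr.1.eq_or_lt with h0 | h0
    · rw [← h0]
      exact (continuousAt_dslope_same.2 (hg 0).differentiableAt).continuousWithinAt
    · exact (hDd r h0).continuousAt.continuousWithinAt
  have hc : Continuous g₁ := continuous_iff_continuousAt.2 fun t => (hg₁ t).continuousAt
  have hhc : Continuous h := continuous_iff_continuousAt.2 fun t => (hh t).continuousAt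
  have hhc₁ : Continuous h₁ := continuous_iff_continuousAt.2 fun t => (hh₁ t).continuousAt
  set B : ℝ → ℝ := fun r => -(h r * spow p (D r) * g₁ r) + r * h₁ r * (|D r| ^ p / p)
    + (p - 1) * (h r * (|D r| ^ p / p)) with hB
  have hΨ : ContinuousOn (fun r => |D r| ^ p / p) (Icc 0 δ) :=
    hψ.contDiff_prim.continuous.comp_continuousOn hDc
  have hBc : ContinuousOn B (Icc 0 δ) :=
    (((hhc.continuousOn.mul (hψ.continuous.comp_continuousOn hDc)).mul hc.continuousOn).neg.add
      ((continuousOn_id.mul hhc₁.continuousOn).mul hΨ)).add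
      (continuousOn_const.mul (hhc.continuousOn.mul hΨ))
  have key := intervalIntegral.integral_eq_sub_of_hasDerivAt_of_le hδ.le hBc (fun r hr => ?_)
    ((intervalIntegrable_iff_integrableOn_Ioc_of_le hδ.le).2 hi)
  · rw [intervalIntegral.integral_of_le hδ.le] at key
    rw [key]
    simp only [hB, e, e₁, hD0]
    have := mul_spow (p := p) (by linarith) (g₁ 0)
    have hp0 : p ≠ 0 := by linarith
    rw [← this]
    field_simp
    ring
  · have hr0 : 0 < r := hr.1
    have d1 := hDd r hr0
    have d2 : HasDerivAt (fun r => |D r| ^ p / p) _ r := (hψ.deriv_prim (D r)).comp r d1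
    have d3 : HasDerivAt (fun r => spow p (D r)) _ r := (hψ.deriv (D r)).comp r d1
    have d4 := ((((hh r).mul d3).mul (hg₁ r)).neg.add
      (((hasDerivAt_id r).mul (hh₁ r)).mul d2)).add (((hh r).mul d2).const_mul (p - 1))
    refine d4.congr_deriv ?_
    rw [dblInt, ← hDr r hr0.ne']
    set R := (g₁ r - D r) / r with hR
    have hg1 : g₁ r = D r + r * R := by rw [hR]; field_simp; ring
    have s1 := mul_spow (p := p) (by linarith) (D r)
    have s2 := spow_deriv_mul (p := p) (by linarith) (D r)
    have hp0 : p ≠ 0 := by linarith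
    simp only [id, Pi.mul_apply]
    rw [hg1, ← s1]
    clear_value R
    have s3 : (p - 1) * |D r| ^ (p - 2) * R * D r = (p - 1) * spow p (D r) * R := by
      rw [← s2]; ring
    field_simp
    linear_combination (-(p * h r)) * s3
  
end Doubling

section DoublingField

variable {E : Type*} [NormedAddCommGroup E] [NormedSpace ℝ E]

theorem hasDerivAt_line {u : E → ℝ} (hu : Differentiable ℝ u) (y e : E) (t : ℝ) :
    HasDerivAt (fun t : ℝ => u (y + t • e)) (dirD e u (y + t • e)) t := by
  have h1 : HasDerivAt (fun t : ℝ => y + t • e) e t := by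
    simpa using ((hasDerivAt_id t).smul_const e).const_add y
  exact (hu (y + t • e)).hasFDerivAt.comp_hasDerivAt t h1

/-- The points from which `K` can be reached in direction `e` within time `δ`. -/
def sweep (K : Set E) (e : E) (δ : ℝ) : Set E := (fun x : E × ℝ => x.1 - x.2 • e) '' (K ×ˢ Icc 0 δ)

theorem isCompact_sweep {K : Set E} (hK : IsCompact K) (e : E) (δ : ℝ) :
    IsCompact (sweep K e δ) :=
  (hK.prod isCompact_Icc).image (by fun_prop)

theorem subset_sweep (K : Set E) (e : E) {δ : ℝ} (hδ : 0 ≤ δ) : K ⊆ sweep K e δ :=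
  fun z hz => ⟨(z, 0), ⟨hz, le_rfl, hδ⟩, by simp⟩

theorem mem_sweep {K : Set E} {e : E} {δ r : ℝ} (hr : r ∈ Icc 0 δ) {y : E}
    (hy : y + r • e ∈ K) : y ∈ sweep K e δ :=
  ⟨(y + r • e, r), ⟨hy, hr⟩, by simp⟩

theorem IsTest.shift {n : WithTop ℕ∞} {K : Set E} {u : E → ℝ} (hu : IsTest n K u)
    (hK : IsCompact K) {e : E} {δ r : ℝ} (hr : r ∈ Icc 0 δ) :
    IsTest n (sweep K e δ) (fun y => u (y + r • e)) := by
  refine ⟨hu.contDiff.comp (contDiff_id.add contDiff_const), ?_⟩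
  refine closure_minimal (fun y hy => ?_) (isCompact_sweep hK e δ).isClosed
  by_contra h
  exact hy (hu.zero_off fun h' => h (mem_sweep hr h'))

theorem IsTest.mono {n : WithTop ℕ∞} {K K' : Set E} {u : E → ℝ} (hu : IsTest n K u)
    (h : K ⊆ K') : IsTest n K' u := ⟨hu.contDiff, hu.supp.trans h⟩

variable [MeasurableSpace E] [BorelSpace E]

theorem IsTest.exists_bound {n : WithTop ℕ∞} {K : Set E} {u : E → ℝ} (hu : IsTest n K u)
    (hK : IsCompact K) : ∃ M, ∀ z, |u z| ≤ M := by
  obtain ⟨M, hM⟩ := (hu.bddMeas hK).bdd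
  refine ⟨|M|, fun z => ?_⟩
  by_cases hz : z ∈ K
  · exact (hM z hz).trans (le_abs_self M)
  · rw [hu.zero_off hz, abs_zero]; exact abs_nonneg M

theorem BddMeas.of_continuous {X : Type*} [TopologicalSpace X] [MeasurableSpace X]
    [OpensMeasurableSpace X] {K S : Set X} (hK : IsCompact K) (hS : S ⊆ K) {f : X → ℝ}
    (hf : Continuous f) : BddMeas S f := by
  obtain ⟨C, hC⟩ := hK.exists_bound_of_continuousOn hf.continuousOn
  exact ⟨hf.measurable, C, fun z hz => hC z (hS hz)⟩

/-- The integrand of the doubling identity for a function `u` with cut-off `ξ` in direction `e`. -/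
def dblF (p : ℝ) (u ξ : E → ℝ) (e y : E) (r : ℝ) : ℝ :=
  dblInt p r ((u (y + r • e) - u y) / r) ((dirD e u (y + r • e) - (u (y + r • e) - u y) / r) / r)
    (dirD e (dirD e u) (y + r • e)) (ξ y * ξ (y + r • e)) (ξ y * dirD e (dirD e ξ) (y + r • e))

variable [FiniteDimensional ℝ E]

theorem bddMeas_dblF {p : ℝ} (hp : 2 < p) {K : Set E} (hK : IsCompact K) {u ξ : E → ℝ}
    (hu : IsTest (⊤ : ℕ∞) K u) (hξ : ContDiff ℝ (⊤ : ℕ∞) ξ) (e : E) {δ : ℝ} :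
    BddMeas (sweep K e δ ×ˢ Ioc 0 δ) (fun x : E × ℝ => dblF p u ξ e x.1 x.2) := by
  have hψ := primPair_spow hp
  have hc : IsCompact (sweep K e δ ×ˢ Icc 0 δ) := (isCompact_sweep hK e δ).prod isCompact_Icc
  have hS : sweep K e δ ×ˢ Ioc 0 δ ⊆ sweep K e δ ×ˢ Icc 0 δ :=
    prod_mono_right Ioc_subset_Icc_self
  have hle : (1 : WithTop ℕ∞) ≤ ((⊤ : ℕ∞) : WithTop ℕ∞) := WithTop.coe_le_coe.2 le_top
  have hu₁ := hu.dirD e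
  have hu₂ := hu₁.dirD e
  have cu := hu.contDiff.continuous
  have cu₁ := hu₁.contDiff.continuous
  have cu₂ := hu₂.contDiff.continuous
  have hd : ∀ {f : E → ℝ}, ContDiff ℝ (⊤ : ℕ∞) f → ContDiff ℝ (⊤ : ℕ∞) (dirD e f) := fun h =>
    (h.fderiv_right (m := (⊤ : ℕ∞)) (by simp)).clm_apply contDiff_const
  have cξ := hξ.continuous
  have cξ₂ := (hd (hd hξ)).continuous
  have du : Differentiable ℝ u := hu.differentiableAt hle
  have du₁ : Differentiable ℝ (dirD e u) := hu₁.differentiableAt hle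
  obtain ⟨M₁, hM₁⟩ := hu₁.exists_bound hK
  obtain ⟨M₂, hM₂⟩ := hu₂.exists_bound hK
  have mz : Measurable fun x : E × ℝ => (u (x.1 + x.2 • e) - u x.1) / x.2 :=
    Measurable.div (Continuous.measurable (by fun_prop)) measurable_snd
  have bz : BddMeas (sweep K e δ ×ˢ Ioc 0 δ)
      (fun x : E × ℝ => (u (x.1 + x.2 • e) - u x.1) / x.2) :=
    ⟨mz, M₁, fun x hx => by
      have := abs_slope_le (M := M₁) (hasDerivAt_line du x.1 e) (fun t => hM₁ _) hx.2.1
      simpa using this⟩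
  have bR : BddMeas (sweep K e δ ×ˢ Ioc 0 δ)
      (fun x : E × ℝ => (dirD e u (x.1 + x.2 • e) - (u (x.1 + x.2 • e) - u x.1) / x.2) / x.2) := by
    refine ⟨Measurable.div (Measurable.sub (Continuous.measurable (by fun_prop)) mz)
      measurable_snd, M₂, fun x hx => ?_⟩
    have := abs_slope_remainder_le (M := M₂) (hasDerivAt_line du x.1 e)
      (hasDerivAt_line du₁ x.1 e) (fun t => hM₂ _) hx.2.1
    simpa using this
  have b1 : BddMeas (sweep K e δ ×ˢ Ioc 0 δ) (fun x : E × ℝ => x.2) :=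
    BddMeas.of_continuous hc hS continuous_snd
  have b2 : BddMeas (sweep K e δ ×ˢ Ioc 0 δ)
      (fun x : E × ℝ => dirD e (dirD e u) (x.1 + x.2 • e)) :=
    BddMeas.of_continuous hc hS (by fun_prop)
  have b3 : BddMeas (sweep K e δ ×ˢ Ioc 0 δ)
      (fun x : E × ℝ => ξ x.1 * ξ (x.1 + x.2 • e)) :=
    BddMeas.of_continuous hc hS (by fun_prop)
  have b4 : BddMeas (sweep K e δ ×ˢ Ioc 0 δ)
      (fun x : E × ℝ => ξ x.1 * dirD e (dirD e ξ) (x.1 + x.2 • e)) :=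
    BddMeas.of_continuous hc hS (by fun_prop)
  have bψ := bz.cont_comp hψ.continuous
  have bψ' := bz.cont_comp hψ.cont
  have bΨ := bz.cont_comp hψ.contDiff_prim.continuous
  exact (((b3.mul bψ).mul b2).neg.sub (((b1.mul b3).mul bψ').mul (bR.pow 2))).add
    ((b1.mul b4).mul bΨ)

theorem dblF_zero_off {p : ℝ} (hp : 2 < p) {K : Set E} {u ξ : E → ℝ}
    (hu : IsTest (⊤ : ℕ∞) K u) {e : E} {δ r : ℝ} (hr : r ∈ Ioc 0 δ) {y : E}
    (hy : y ∉ sweep K e δ) : dblF p u ξ e y r = 0 := by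
  have h1 : u y = 0 := hu.zero_off fun h => hy (subset_sweep K e (hr.1.le.trans hr.2) h)
  have h2 : u (y + r • e) = 0 := hu.zero_off fun h => hy (mem_sweep ⟨hr.1.le, hr.2⟩ h)
  have hp0 : p ≠ 0 := by linarith
  have hp2 : p - 2 ≠ 0 := by linarith
  simp [dblF, dblInt, h1, h2, (primPair_spow hp).zero, Real.zero_rpow hp0, Real.zero_rpow hp2]

variable {μ : Measure E} [μ.IsAddHaarMeasure]

theorem integral_dblF {p : ℝ} (hp : 2 < p) {K : Set E} (hK : IsCompact K) {u ξ m : E → ℝ}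
    (hu : IsTest (⊤ : ℕ∞) K u) (hξ : ContDiff ℝ (⊤ : ℕ∞) ξ) (hm : ∀ S, BddMeas S m) (e : E)
    {δ : ℝ} (hδ : 0 < δ) (h0 : ∀ y, ξ y * ξ (y + δ • e) = 0)
    (h1 : ∀ y, ξ y * dirD e ξ (y + δ • e) = 0) :
    IntegrableOn (fun r => ∫ y, m y * dblF p u ξ e y r ∂μ) (Ioc 0 δ) ∧
    ∫ r in Ioc 0 δ, ∫ y, m y * dblF p u ξ e y r ∂μ
      = ∫ y, m y * (ξ y ^ 2 * (|dirD e u y| ^ p / p)) ∂μ := by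
  have hle : (1 : WithTop ℕ∞) ≤ ((⊤ : ℕ∞) : WithTop ℕ∞) := WithTop.coe_le_coe.2 le_top
  have hb := bddMeas_dblF hp hK hu hξ e (δ := δ)
  have hS := isCompact_sweep hK e δ
  obtain ⟨Cm, hCm⟩ := (hm univ).bdd
  have hmb : BddMeas (sweep K e δ ×ˢ Ioc 0 δ) (fun x : E × ℝ => m x.1 * dblF p u ξ e x.1 x.2) :=
    BddMeas.mul ⟨(hm univ).meas.comp measurable_fst, Cm, fun x _ => hCm _ (mem_univ _)⟩ hb
  have hInt : Integrable (fun x : E × ℝ => m x.1 * dblF p u ξ e x.1 x.2)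
      ((μ.restrict (sweep K e δ)).prod (volume.restrict (Ioc 0 δ))) := by
    obtain ⟨C, hC⟩ := hmb.bdd
    rw [Measure.prod_restrict]
    refine IntegrableOn.of_bound ?_ hmb.meas.aestronglyMeasurable C
      (ae_restrict_of_forall_mem (hS.measurableSet.prod measurableSet_Ioc) fun z hz => hC z hz)
    rw [Measure.prod_prod]
    exact ENNReal.mul_lt_top hS.measure_lt_top (by simp)
  have hres : ∀ r ∈ Ioc 0 δ, ∫ y in sweep K e δ, m y * dblF p u ξ e y r ∂μ
      = ∫ y, m y * dblF p u ξ e y r ∂μ := fun r hr =>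
    setIntegral_eq_integral_of_forall_compl_eq_zero fun y hy => by
      rw [dblF_zero_off hp hu hr hy, mul_zero]
  have hp0 : p ≠ 0 := by linarith
  constructor
  · exact (integrableOn_congr_fun hres measurableSet_Ioc).1 hInt.integral_prod_right
  · rw [← setIntegral_congr_fun measurableSet_Ioc hres]
    have := integral_integral_swap (f := fun y r => m y * dblF p u ξ e y r) hInt
    refine this.symm.trans ?_
    rw [← setIntegral_eq_integral_of_forall_compl_eq_zero (s := sweep K e δ)
      (f := fun y => m y * (ξ y ^ 2 * (|dirD e u y| ^ p / p)))]
    · refine setIntegral_congr_fun hS.measurableSet fun y hy => ?_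
      rw [integral_const_mul]
      congr 1
      have du : Differentiable ℝ u := hu.differentiableAt hle
      have du₁ : Differentiable ℝ (dirD e u) := (hu.dirD e).differentiableAt hle
      have hd : ∀ {f : E → ℝ}, ContDiff ℝ (⊤ : ℕ∞) f → ContDiff ℝ (⊤ : ℕ∞) (dirD e f) := fun h =>
        (h.fderiv_right (m := (⊤ : ℕ∞)) (by simp)).clm_apply contDiff_const
      have dξ : Differentiable ℝ ξ := hξ.differentiable (by simp)
      have dξ₁ : Differentiable ℝ (dirD e ξ) := (hd hξ).differentiable (by simp)
      have hi : IntegrableOn (fun r => dblF p u ξ e y r) (Ioc 0 δ) := by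
        obtain ⟨C, hC⟩ := hb.bdd
        exact IntegrableOn.of_bound (by simp)
          (hb.meas.comp measurable_prodMk_left).aestronglyMeasurable C
          (ae_restrict_of_forall_mem measurableSet_Ioc fun r hr => hC (y, r) ⟨hy, hr⟩)
      have := integral_dblInt_line hp (hasDerivAt_line du y e) (hasDerivAt_line du₁ y e)
        (fun t => (hasDerivAt_line dξ y e t).const_mul (ξ y))
        (fun t => (hasDerivAt_line dξ₁ y e t).const_mul (ξ y)) hδ (h0 y) (h1 y)
        (by simp only [zero_smul, add_zero]; exact hi)
      simp only [zero_smul, add_zero] at this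
      rw [← sq] at this
      exact this
    · intro y hy
      have : dirD e u y = 0 := (hu.dirD e).zero_off fun h => hy (subset_sweep K e hδ.le h)
      rw [this]; simp [Real.zero_rpow hp0]

end DoublingField

section DoublingPointwise

variable {ι : Type*} [Fintype ι]

theorem abs_sum_mul_le {b d : ι → ℝ} {B : ℝ} (hb : ∀ j, |b j| ≤ B) :
    |∑ j, b j * d j| ≤ B * ∑ j, |d j| := by
  refine (Finset.abs_sum_le_sum_abs _ _).trans ?_
  rw [Finset.mul_sum]
  refine Finset.sum_le_sum fun j _ => ?_
  rw [abs_mul]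
  exact mul_le_mul_of_nonneg_right (hb j) (abs_nonneg _)

theorem abs_sum_sum_mul_le {a : ι → ι → ℝ} {d x : ι → ℝ} {B : ℝ} (ha : ∀ i j, |a i j| ≤ B) :
    |∑ i, ∑ j, a i j * (d i * x j)| ≤ B * ((∑ i, |d i|) * ∑ j, |x j|) := by
  refine (Finset.abs_sum_le_sum_abs _ _).trans ?_
  rw [Finset.sum_mul, Finset.mul_sum]
  refine Finset.sum_le_sum fun i _ => ?_
  refine (Finset.abs_sum_le_sum_abs _ _).trans ?_
  rw [Finset.mul_sum, Finset.mul_sum]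
  refine Finset.sum_le_sum fun j _ => ?_
  rw [abs_mul, abs_mul]
  exact mul_le_mul_of_nonneg_right (ha i j) (by positivity)

/-- The sum of the sizes of the two families of tangential derivatives. -/
def tanSum (x x' : ι → ℝ) : ℝ := ∑ j, (|x j| + |x' j|)

theorem sum_abs_sub_le_tanSum (x x' : ι → ℝ) : ∑ j, |x' j - x j| ≤ tanSum x x' :=
  Finset.sum_le_sum fun j _ => by
    rw [add_comm]; exact abs_sub _ _

theorem cross_term_le {a : ι → ι → ℝ} {bb : ι → ℝ} {x x' y : ι → ℝ} {m M B r P : ℝ} (hr : 0 < r)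
    (hm : 0 ≤ m) (hmM : m ≤ M) (hB : 0 ≤ B) (hb : ∀ j, |bb j| ≤ B) (ha : ∀ i j, |a i j| ≤ B)
    (hy : ∀ j, |y j| ≤ |x j| + |x' j|) :
    m * (-P ^ 2 / r - (∑ j, bb j * (x' j - x j)) / r * P
      - (∑ i, ∑ j, a i j * ((x' i - x i) * y j)) / r)
      ≤ M * ((B ^ 2 + B) * ((∑ j, |x' j - x j|) * tanSum x x' / r)) := by
  set S := ∑ j, |x' j - x j| with hS
  set T := tanSum x x' with hT
  have hS0 : 0 ≤ S := Finset.sum_nonneg fun _ _ => abs_nonneg _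
  have hST : S ≤ T := sum_abs_sub_le_tanSum x x'
  have h1 := abs_sum_mul_le (d := fun j => x' j - x j) hb
  have h2 := abs_sum_sum_mul_le (d := fun j => x' j - x j) (x := y) ha
  have h3 : ∑ j, |y j| ≤ T := Finset.sum_le_sum fun j _ => hy j
  set b' := ∑ j, bb j * (x' j - x j)
  set a' := ∑ i, ∑ j, a i j * ((x' i - x i) * y j)
  have e1 : b' ^ 2 ≤ B ^ 2 * (S * T) := by
    have : b' ^ 2 ≤ (B * S) ^ 2 := sq_le_sq' (by linarith [(abs_le.1 h1).1]) (abs_le.1 h1).2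
    have h4 : S * S ≤ S * T := mul_le_mul_of_nonneg_left hST hS0
    nlinarith [sq_nonneg B, mul_le_mul_of_nonneg_left h4 (sq_nonneg B)]
  have e2 : -a' ≤ B * (S * T) :=
    (neg_le_abs a').trans (h2.trans (mul_le_mul_of_nonneg_left
      (mul_le_mul_of_nonneg_left h3 hS0) hB))
  have e3 : -P ^ 2 / r - b' / r * P - a' / r ≤ (B ^ 2 + B) * (S * T / r) := by
    have : -P ^ 2 / r - b' / r * P - a' / r = (-P ^ 2 - b' * P - a') / r := by ring
    rw [this, ← mul_div_assoc]
    refine div_le_div_of_nonneg_right ?_ hr.le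
    nlinarith [sq_nonneg (P + b' / 2), sq_nonneg b']
  have hT0 : 0 ≤ T := hS0.trans hST
  calc _ ≤ m * ((B ^ 2 + B) * (S * T / r)) := mul_le_mul_of_nonneg_left e3 hm
    _ ≤ _ := mul_le_mul_of_nonneg_right hmM (by positivity)

/-- The quantity which controls the doubling integrand at a fixed distance `r`. -/
def dblBd (p A r z F F' : ℝ) (x x' : ι → ℝ) : ℝ :=
  |z| ^ (p - 2) * ((∑ j, |x' j - x j|) * tanSum x x' / r) + |z| ^ (p - 1) * (|F| + |F'|)
    + r * A * |z| ^ p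

theorem dbl_pointwise {p : ℝ} (hp : 2 < p) {a a' : ι → ι → ℝ} {b b' x x' : ι → ℝ}
    {m m' M B r P Q z φ h h' A F F' : ℝ} (hr : 0 < r) (hm : 0 ≤ m) (hmM : m ≤ M) (hm' : 0 ≤ m')
    (hmM' : m' ≤ M) (hB : 0 ≤ B) (hb : ∀ j, |b j| ≤ B) (ha : ∀ i j, |a i j| ≤ B)
    (hb' : ∀ j, |b' j| ≤ B) (ha' : ∀ i j, |a' i j| ≤ B) (hφ : 0 ≤ φ) (hφ1 : φ ≤ 1)
    (hh : |h| ≤ A) (hh' : |h'| ≤ A) :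
    φ * ((p - 1) * |z| ^ (p - 2)) * (m * (-P ^ 2 / r - (∑ j, b' j * (x' j - x j)) / r * P
          - (∑ i, ∑ j, a' i j * ((x' i - x i) * x' j)) / r)
        + m' * (-Q ^ 2 / r - (∑ j, b j * (x' j - x j)) / r * Q
          + (∑ i, ∑ j, a i j * ((x' i - x i) * x j)) / r))
      + φ * spow p z * (m * F' - m' * F) + r * (m * h' + m' * h) * (|z| ^ p / p)
      ≤ (2 * (p - 1) * (B ^ 2 + B) + 1) * M * dblBd p A r z F F' x x' := by
  have hS : 0 ≤ ∑ j, |x' j - x j| := Finset.sum_nonneg fun _ _ => abs_nonneg _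
  have hT : 0 ≤ tanSum x x' := hS.trans (sum_abs_sub_le_tanSum x x')
  have c1 := cross_term_le (P := P) (y := x') hr hm hmM hB hb' ha'
    (fun j => by have := abs_nonneg (x j); linarith : ∀ j, |x' j| ≤ |x j| + |x' j|)
  have c2 := cross_term_le (P := Q) (y := fun j => -x j) hr hm' hmM' hB hb ha
    (fun j => by rw [abs_neg]; have := abs_nonneg (x' j); linarith :
      ∀ j, |-x j| ≤ |x j| + |x' j|)
  have e : (∑ i, ∑ j, a i j * ((x' i - x i) * -x j)) = -∑ i, ∑ j, a i j * ((x' i - x i) * x j) := by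
    rw [← Finset.sum_neg_distrib]
    refine Finset.sum_congr rfl fun i _ => ?_
    rw [← Finset.sum_neg_distrib]
    exact Finset.sum_congr rfl fun j _ => by ring
  rw [e, neg_div r (∑ i, ∑ j, a i j * ((x' i - x i) * x j)), sub_neg_eq_add] at c2
  have hM : 0 ≤ M := hm.trans hmM
  have hA : 0 ≤ A := (abs_nonneg h).trans hh
  have hV : 0 ≤ (p - 1) * |z| ^ (p - 2) := mul_nonneg (by linarith) (by positivity)
  set ST := (∑ j, |x' j - x j|) * tanSum x x' / r with hSTd
  have hST : 0 ≤ ST := by positivity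
  have t1 : φ * ((p - 1) * |z| ^ (p - 2)) * (m * (-P ^ 2 / r
          - (∑ j, b' j * (x' j - x j)) / r * P
          - (∑ i, ∑ j, a' i j * ((x' i - x i) * x' j)) / r)
        + m' * (-Q ^ 2 / r - (∑ j, b j * (x' j - x j)) / r * Q
          + (∑ i, ∑ j, a i j * ((x' i - x i) * x j)) / r))
      ≤ 2 * (p - 1) * (B ^ 2 + B) * M * (|z| ^ (p - 2) * ST) := by
    have h1 : φ * ((p - 1) * |z| ^ (p - 2)) * (2 * (M * ((B ^ 2 + B) * ST)))
        ≤ 1 * ((p - 1) * |z| ^ (p - 2)) * (2 * (M * ((B ^ 2 + B) * ST))) := by gcongr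
    refine (mul_le_mul_of_nonneg_left (add_le_add c1 c2) (by positivity)).trans ?_
    refine le_trans (le_of_eq ?_) (h1.trans (le_of_eq ?_)) <;> ring
  have t2 : φ * spow p z * (m * F' - m' * F) ≤ M * (|z| ^ (p - 1) * (|F| + |F'|)) := by
    refine (le_abs_self _).trans ?_
    rw [abs_mul, abs_mul, abs_spow (by linarith), abs_of_nonneg hφ]
    have : |m * F' - m' * F| ≤ M * (|F| + |F'|) := by
      refine (abs_sub _ _).trans ?_
      rw [abs_mul, abs_mul, abs_of_nonneg hm, abs_of_nonneg hm']
      have := mul_le_mul_of_nonneg_right hmM (abs_nonneg F')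
      have := mul_le_mul_of_nonneg_right hmM' (abs_nonneg F)
      linarith
    calc φ * |z| ^ (p - 1) * |m * F' - m' * F| ≤ 1 * |z| ^ (p - 1) * (M * (|F| + |F'|)) := by
          gcongr
      _ = _ := by ring
  have t3 : r * (m * h' + m' * h) * (|z| ^ p / p) ≤ M * (r * A * |z| ^ p) := by
    have h1 : m * h' + m' * h ≤ 2 * (M * A) := by
      have a1 : m * h' ≤ M * A := (mul_le_mul_of_nonneg_left ((le_abs_self _).trans hh') hm).trans
        (mul_le_mul_of_nonneg_right hmM hA)
      have a2 : m' * h ≤ M * A := (mul_le_mul_of_nonneg_left ((le_abs_self _).trans hh) hm').trans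
        (mul_le_mul_of_nonneg_right hmM' hA)
      linarith
    have h2 : |z| ^ p / p ≤ |z| ^ p / 2 :=
      div_le_div_of_nonneg_left (by positivity) (by norm_num) hp.le
    have hp0 : 0 < p := by linarith
    calc r * (m * h' + m' * h) * (|z| ^ p / p) ≤ r * (2 * (M * A)) * (|z| ^ p / p) := by gcongr
      _ ≤ r * (2 * (M * A)) * (|z| ^ p / 2) := by gcongr
      _ = _ := by ring
  have hz1 : 0 ≤ |z| ^ (p - 1) * (|F| + |F'|) := by positivity
  have hz2 : 0 ≤ r * A * |z| ^ p := by positivity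
  have hz3 : 0 ≤ |z| ^ (p - 2) * ST := by positivity
  have hk : 0 ≤ 2 * (p - 1) * (B ^ 2 + B) := by
    have : 0 ≤ p - 1 := by linarith
    positivity
  refine (add_le_add (add_le_add t1 t2) t3).trans ?_
  rw [dblBd, ← hSTd]
  have k1 := mul_nonneg (mul_nonneg hk hM) hz1
  have k2 := mul_nonneg (mul_nonneg hk hM) hz2
  have k3 := mul_nonneg hM hz3
  nlinarith

end DoublingPointwise

section DoublingFixed

theorem sum_kernel_mul {ι : Type*} [Fintype ι] (κ α β r w : ℝ) (b y d : ι → ℝ) :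
    ∑ j, κ * b j * (α * y j + β * (d j / r) * w)
      = κ * (α * ∑ j, b j * y j + β * ((∑ j, b j * d j) / r * w)) := by
  simp only [Finset.mul_sum, Finset.sum_div, Finset.sum_mul, ← Finset.sum_add_distrib]
  exact Finset.sum_congr rfl fun j _ => by ring

theorem sum_sum_kernel_mul {ι : Type*} [Fintype ι] (κ α β r : ℝ) (a y : ι → ι → ℝ) (d x : ι → ℝ) :
    ∑ i, ∑ j, κ * a i j * (α * y i j + β * (d i / r) * x j)
      = κ * (α * ∑ i, ∑ j, a i j * y i j + β * ((∑ i, ∑ j, a i j * (d i * x j)) / r)) := by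
  simp only [Finset.mul_sum, Finset.sum_div, ← Finset.sum_add_distrib]
  exact Finset.sum_congr rfl fun i _ => Finset.sum_congr rfl fun j _ => by ring

/-- Globally bounded coefficients without zero-order part. -/
structure Coef.Flat {ι : Type*} (c : Coef ι) (M B : ℝ) : Prop where
  meas_m : Measurable c.m
  meas_b : ∀ j, Measurable (c.b j)
  meas_a : ∀ i j, Measurable (c.a i j)
  m_nonneg : ∀ s, 0 ≤ c.m s
  m_le : ∀ s, c.m s ≤ M
  q_eq : ∀ s, c.q s = 0
  b_le : ∀ j s, |c.b j s| ≤ B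
  a_le : ∀ i j s, |c.a i j s| ≤ B

section lines

variable {E : Type*} [NormedAddCommGroup E] [NormedSpace ℝ E]

theorem dirD_shift (u : E → ℝ) (v w y : E) :
    dirD v (fun y => u (y + w)) y = dirD v u (y + w) := by
  unfold dirD
  rw [fderiv_comp_add_right]

theorem dirD_neg_dir (u : E → ℝ) (v y : E) : dirD (-v) u y = -dirD v u y := by
  simp [dirD]

theorem dirD_neg_neg (u : E → ℝ) (v y : E) :
    dirD (-v) (dirD (-v) u) y = dirD v (dirD v u) y := by
  have : dirD (-v) u = fun y => -dirD v u y := funext fun y => dirD_neg_dir u v y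
  rw [dirD_neg_dir, this]
  unfold dirD
  rw [fderiv_fun_neg]
  simp

theorem IsTest.quot {n : WithTop ℕ∞} {K : Set E} {u v : E → ℝ} (hu : IsTest n K u)
    (hv : IsTest n K v) (r : ℝ) : IsTest n K (fun y => (u y - v y) / r) := by
  refine ⟨(hu.contDiff.sub hv.contDiff).div_const r, ?_⟩
  intro y hy
  by_contra h
  have h1 : y ∉ tsupport u := fun h' => h (hu.supp h')
  have h2 : y ∉ tsupport v := fun h' => h (hv.supp h')
  rw [notMem_tsupport_iff_eventuallyEq] at h1 h2
  refine (notMem_tsupport_iff_eventuallyEq.2 ?_) hy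
  filter_upwards [h1, h2] with y e1 e2
  simp [e1, e2]

theorem dirD_quot {u v : E → ℝ} {y : E} (hu : DifferentiableAt ℝ u y)
    (hv : DifferentiableAt ℝ v y) (r : ℝ) (w : E) :
    dirD w (fun y => (u y - v y) / r) y = (dirD w u y - dirD w v y) / r := by
  simp only [dirD, div_eq_inv_mul]
  rw [fderiv_const_mul (hu.fun_sub hv), fderiv_fun_sub hu hv]
  simp

end lines

variable {E ι : Type*} [NormedAddCommGroup E] [NormedSpace ℝ E] [MeasurableSpace E] [BorelSpace E]
  [FiniteDimensional ℝ E] [Fintype ι] {μ : Measure E} [μ.IsAddHaarMeasure] {G : Geo E ι}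
  {c : Coef ι} {K : Set E}

theorem Geo.ht_add_n (y : E) (r : ℝ) : G.ht (y + r • G.n) = G.ht y + r := by
  simp [G.ht_n]

/-- The bound `dblBd` evaluated along the segment from `y` in normal direction. -/
def dblBdF (p A : ℝ) (G : Geo E ι) (c : Coef ι) (u : E → ℝ) (r : ℝ) (y : E) : ℝ :=
  dblBd p A r ((u (y + r • G.n) - u y) / r) (G.op c u y) (G.op c u (y + r • G.n))
    (fun j => dirD (G.e j) u y) (fun j => dirD (G.e j) u (y + r • G.n))

theorem op_shift_zero_off {δ r : ℝ} (hr : r ∈ Ioc 0 δ) {u : E → ℝ} (hu : IsTest (⊤ : ℕ∞) K u)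
    {y : E} (hy : y ∉ sweep K G.n δ) : y ∉ K ∧ y + r • G.n ∉ K :=
  ⟨fun h => hy (subset_sweep K G.n (hr.1.le.trans hr.2) h),
    fun h => hy (mem_sweep ⟨hr.1.le, hr.2⟩ h)⟩

theorem bddMeas_shift {f : E → ℝ} (hm : Measurable f) (hf : ∃ C, ∀ z, |f z| ≤ C) (S : Set E)
    (w : E) : BddMeas S (fun y => f (y + w)) := by
  obtain ⟨C, hC⟩ := hf
  exact ⟨hm.comp (measurable_id.add_const w), C, fun y _ => hC _⟩

theorem Coef.Flat.loc {M B : ℝ} (hc : c.Flat M B) : c.Loc G K where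
  m := ⟨hc.meas_m.comp G.ht.continuous.measurable, M, fun z _ => by
    rw [abs_of_nonneg (hc.m_nonneg _)]; exact hc.m_le _⟩
  q := ⟨by simpa only [hc.q_eq] using measurable_const, 0, fun z _ => by simp [hc.q_eq]⟩
  b j := ⟨(hc.meas_b j).comp G.ht.continuous.measurable, B, fun z _ => hc.b_le _ _⟩
  a i j := ⟨(hc.meas_a i j).comp G.ht.continuous.measurable, B, fun z _ => hc.a_le _ _ _⟩

theorem exists_bound_op (hK : IsCompact K) {M B : ℝ} (hc : c.Flat M B) {u : E → ℝ}
    (hu : IsTest (⊤ : ℕ∞) K u) : ∃ C, ∀ z, |G.op c u z| ≤ C := by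
  obtain ⟨C, hC⟩ := (Geo.bddMeas_op (G := G) hK hc.loc hu).bdd
  refine ⟨|C|, fun z => ?_⟩
  by_cases hz : z ∈ K
  · exact (hC z hz).trans (le_abs_self C)
  · rw [Geo.op_zero_off hu hz, abs_zero]; exact abs_nonneg C

theorem integrable_dblBdF {p : ℝ} (hp : 2 < p) (hK : IsCompact K) {M B : ℝ} (hc : c.Flat M B)
    {u : E → ℝ} (hu : IsTest (⊤ : ℕ∞) K u) {δ r : ℝ} (hr : r ∈ Ioc 0 δ) (A : ℝ) :
    Integrable (dblBdF p A G c u r) μ := by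
  have hK' := isCompact_sweep hK G.n δ
  have hsub := subset_sweep K G.n (hr.1.le.trans hr.2)
  have hr' : r ∈ Icc 0 δ := ⟨hr.1.le, hr.2⟩
  have bu := (hu.mono hsub).bddMeas hK'
  have bu' := (hu.shift hK (e := G.n) hr').bddMeas hK'
  have bz := ((hu.shift hK (e := G.n) hr').quot (hu.mono hsub) r).bddMeas hK'
  have bx := fun j => ((hu.dirD (G.e j)).mono hsub).bddMeas hK'
  have bx' := fun j => ((hu.dirD (G.e j)).shift hK (e := G.n) hr').bddMeas hK'
  have mo := (Geo.bddMeas_op (G := G) hK hc.loc hu).meas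
  obtain ⟨C, hC⟩ := exists_bound_op (G := G) hK hc hu
  have bF : BddMeas (sweep K G.n δ) (G.op c u) := ⟨mo, C, fun z _ => hC z⟩
  have bF' := bddMeas_shift mo ⟨C, hC⟩ (sweep K G.n δ) (r • G.n)
  have bc := fun x : ℝ => BddMeas.const (K := sweep K G.n δ) x
  refine BddMeas.integrable (K := sweep K G.n δ) ?_ hK'.measurableSet hK'.measure_lt_top.ne
    fun y hy => ?_
  · have b1 : BddMeas (sweep K G.n δ) (fun y => ∑ j, |dirD (G.e j) u (y + r • G.n)
        - dirD (G.e j) u y|) := BddMeas.sum fun j => ((bx' j).sub (bx j)).abs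
    have b2 : BddMeas (sweep K G.n δ) (fun y => ∑ j, (|dirD (G.e j) u y|
        + |dirD (G.e j) u (y + r • G.n)|)) := BddMeas.sum fun j => (bx j).abs.add (bx' j).abs
    have b3 := (b1.mul b2).mul (bc r⁻¹)
    exact (((bz.abs_rpow (show 0 ≤ p - 2 by linarith)).mul b3).add
      ((bz.abs_rpow (show 0 ≤ p - 1 by linarith)).mul (bF.abs.add bF'.abs))).add
      ((bc (r * A)).mul (bz.abs_rpow (show 0 ≤ p by linarith)))
  · obtain ⟨h1, h2⟩ := op_shift_zero_off hr hu hy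
    have e1 : p - 2 ≠ 0 := by linarith
    have e2 : p - 1 ≠ 0 := by linarith
    have e3 : p ≠ 0 := by linarith
    simp [dblBdF, dblBd, hu.zero_off h1, hu.zero_off h2, Real.zero_rpow e1, Real.zero_rpow e2,
      Real.zero_rpow e3]

end DoublingFixed

section DoublingAtDistance

variable {E ι : Type*} [NormedAddCommGroup E] [NormedSpace ℝ E] [MeasurableSpace E] [BorelSpace E]
  [FiniteDimensional ℝ E] [Fintype ι] {μ : Measure E} [μ.IsAddHaarMeasure] {G : Geo E ι}
  {c : Coef ι} {K : Set E}

omit [Fintype ι] in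
theorem zeroInt_psi_mul (hK : IsCompact K) {ψ ψ' Ψ : ℝ → ℝ} (hψ : PrimPair ψ ψ' Ψ)
    {k z w : E → ℝ} {v : E} (hk : BddMeas K k) (hz : IsTest (⊤ : ℕ∞) K z)
    (hw : IsTest (⊤ : ℕ∞) K w) (hd : ∀ y, ∀ t : ℝ, k (y + t • v) = k y) :
    ZeroInt μ (fun y => k y * (ψ (z y) * dirD v w y + ψ' (z y) * dirD v z y * w y)) := by
  have h1 : (1 : WithTop ℕ∞) ≤ ((⊤ : ℕ∞) : WithTop ℕ∞) := by exact_mod_cast le_top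
  have hg : IsTest 1 K (fun y => ψ (z y) * w y) :=
    ((hz.of_le h1).comp hψ.contDiff hψ.zero).mul (hw.of_le h1)
  have := zeroInt_tan (μ := μ) hK hk hg hd
  refine this.1.congr (Filter.Eventually.of_forall fun y => ?_) |> fun h => ⟨h, ?_⟩
  · simp only [dirD_psi_mul hψ (hz.differentiableAt h1 y) (hw.differentiableAt h1 y)]
  · rw [← this.2]
    refine integral_congr_ae (Filter.Eventually.of_forall fun y => ?_)
    simp only [dirD_psi_mul hψ (hz.differentiableAt h1 y) (hw.differentiableAt h1 y)]

omit [Fintype ι] in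
theorem zeroInt_psi (hK : IsCompact K) {ψ ψ' Ψ : ℝ → ℝ} (hψ : PrimPair ψ ψ' Ψ)
    {k z : E → ℝ} {v : E} (hk : BddMeas K k) (hz : IsTest (⊤ : ℕ∞) K z)
    (hd : ∀ y, ∀ t : ℝ, k (y + t • v) = k y) :
    ZeroInt μ (fun y => k y * (ψ (z y) * dirD v z y)) := by
  have h1 : (1 : WithTop ℕ∞) ≤ ((⊤ : ℕ∞) : WithTop ℕ∞) := by exact_mod_cast le_top
  have hg : IsTest 1 K (fun y => Ψ (z y)) :=
    (hz.of_le h1).comp hψ.contDiff_prim hψ.prim_zero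
  have := zeroInt_tan (μ := μ) hK hk hg hd
  refine this.1.congr (Filter.Eventually.of_forall fun y => ?_) |> fun h => ⟨h, ?_⟩
  · simp only [dirD_comp (hz.differentiableAt h1 y) (hψ.deriv_prim _)]
  · rw [← this.2]
    refine integral_congr_ae (Filter.Eventually.of_forall fun y => ?_)
    simp only [dirD_comp (hz.differentiableAt h1 y) (hψ.deriv_prim _)]

theorem dbl_algebra {p r m m' φ h h' z un un' unn unn' uτ uτ' : ℝ} (hp : 2 < p) (hr : 0 < r)
    {b b' x x' y y' : ι → ℝ} {a a' Y Y' : ι → ι → ℝ} :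
    m * dblInt p r z ((un' - z) / r) unn' φ h' + m' * dblInt p r (-z) ((-un - -z) / r) unn φ h
      - (-(r * (m * m' * φ * (spow p z * ((uτ' - uτ) / r))))
        + ∑ j, (m * φ * b' j * (spow p z * y' j
              + ((p - 1) * |z| ^ (p - 2)) * ((x' j - x j) / r) * un')
            - m * φ * b' j * ((p - 1) * (spow p z * ((x' j - x j) / r))))
        - ∑ j, (m' * φ * b j * (spow p z * y j
              + ((p - 1) * |z| ^ (p - 2)) * ((x' j - x j) / r) * un)
            - m' * φ * b j * ((p - 1) * (spow p z * ((x' j - x j) / r))))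
        + ∑ i, ∑ j, m * φ * a' i j * (spow p z * Y' i j
              + ((p - 1) * |z| ^ (p - 2)) * ((x' i - x i) / r) * x' j)
        - ∑ i, ∑ j, m' * φ * a i j * (spow p z * Y i j
              + ((p - 1) * |z| ^ (p - 2)) * ((x' i - x i) / r) * x j))
    = φ * ((p - 1) * |z| ^ (p - 2)) * (m * (-(un' - z) ^ 2 / r
          - (∑ j, b' j * (x' j - x j)) / r * (un' - z)
          - (∑ i, ∑ j, a' i j * ((x' i - x i) * x' j)) / r)
        + m' * (-(z - un) ^ 2 / r - (∑ j, b j * (x' j - x j)) / r * (z - un)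
          + (∑ i, ∑ j, a i j * ((x' i - x i) * x j)) / r))
      + φ * spow p z * (m * (m' * uτ' - unn' - ∑ j, b' j * y' j - ∑ i, ∑ j, a' i j * Y' i j)
          - m' * (m * uτ - unn - ∑ j, b j * y j - ∑ i, ∑ j, a i j * Y i j))
      + r * (m * h' + m' * h) * (|z| ^ p / p) := by
  have s := spow_deriv_mul (p := p) (by linarith) z
  have e1 : ∀ (κ w : ℝ) (b y : ι → ℝ), ∑ j, (κ * b j * (spow p z * y j
              + ((p - 1) * |z| ^ (p - 2)) * ((x' j - x j) / r) * w)
            - κ * b j * ((p - 1) * (spow p z * ((x' j - x j) / r))))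
      = κ * (spow p z * ∑ j, b j * y j + ((p - 1) * |z| ^ (p - 2))
          * ((∑ j, b j * (x' j - x j)) / r * (w - z))) := by
    intro κ w b y
    rw [← sum_kernel_mul]
    refine Finset.sum_congr rfl fun j _ => ?_
    linear_combination (-κ * b j * ((x' j - x j) / r)) * (-s)
  rw [e1, e1, sum_sum_kernel_mul, sum_sum_kernel_mul]
  have hodd : spow p (-z) = -spow p z := by simp [spow]
  simp only [dblInt, hodd, abs_neg]
  field_simp
  ring

theorem dbl_fixed {p : ℝ} (hp : 2 < p) (hK : IsCompact K) {M B A : ℝ} (hB : 0 ≤ B)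
    (hc : c.Flat M B) {u : E → ℝ} (hu : IsTest (⊤ : ℕ∞) K u) {ζ : ℝ → ℝ}
    (hζ : ContDiff ℝ (⊤ : ℕ∞) ζ) (hζ0 : ∀ s, 0 ≤ ζ s) (hζ1 : ∀ s, ζ s ≤ 1)
    {I : Set ℝ} (hI : MeasurableSet I) (hζI : ∀ s, s ∉ I → ζ s = 0)
    (hA : ∀ y, |dirD G.n (dirD G.n fun y => ζ (G.ht y)) y| ≤ A)
    (hAI : ∀ y, G.ht y ∉ I → dirD G.n (dirD G.n fun y => ζ (G.ht y)) y = 0)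
    {δ r : ℝ} (hr : r ∈ Ioc 0 δ) :
    (∫ y, c.m (G.ht y) * dblF p u (fun y => ζ (G.ht y)) G.n y r ∂μ)
      + ∫ y, c.m (G.ht y) * dblF p u (fun y => ζ (G.ht y)) (-G.n) y r ∂μ
      ≤ (2 * (p - 1) * (B ^ 2 + B) + 1) * M *
        ∫ y in {y | G.ht y ∈ I ∧ G.ht y + r ∈ I}, dblBdF p A G c u r y ∂μ := by
  set ξ : E → ℝ := fun y => ζ (G.ht y) with hξd
  have hξ : ContDiff ℝ (⊤ : ℕ∞) ξ := hζ.comp G.ht.contDiff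
  have hr' : r ∈ Icc 0 δ := ⟨hr.1.le, hr.2⟩
  have h1 : (1 : WithTop ℕ∞) ≤ ((⊤ : ℕ∞) : WithTop ℕ∞) := by exact_mod_cast le_top
  have hψ := primPair_spow hp
  set X : E → E := fun y => y + r • G.n with hX
  have htX : ∀ y, G.ht (X y) = G.ht y + r := fun y => Geo.ht_add_n y r
  have mht : Measurable G.ht := G.ht.continuous.measurable
  -- integrability of the two terms
  have int1 : ∀ e : E, Integrable (fun y => c.m (G.ht y) * dblF p u ξ e y r) μ := by
    intro e
    have hS := isCompact_sweep hK e δ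
    obtain ⟨C, hC⟩ := (bddMeas_dblF hp hK hu hξ e (δ := δ)).bdd
    have hm := (bddMeas_dblF hp hK hu hξ e (δ := δ)).meas
    have b1 : BddMeas (sweep K e δ) (fun y => dblF p u ξ e y r) :=
      ⟨hm.comp (measurable_id.prodMk measurable_const), C, fun y hy => hC (y, r) ⟨hy, hr⟩⟩
    exact (((hc.loc (G := G)).m).mul b1).integrable hS.measurableSet hS.measure_lt_top.ne
      fun y hy => by rw [dblF_zero_off hp hu hr hy, mul_zero]
  have tr : ∫ y, c.m (G.ht y) * dblF p u ξ (-G.n) y r ∂μ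
      = ∫ y, c.m (G.ht (X y)) * dblF p u ξ (-G.n) (X y) r ∂μ :=
    (integral_add_right_eq_self (fun y => c.m (G.ht y) * dblF p u ξ (-G.n) y r) (r • G.n)).symm
  have int2 : Integrable (fun y => c.m (G.ht (X y)) * dblF p u ξ (-G.n) (X y) r) μ :=
    (int1 (-G.n)).comp_add_right (r • G.n)
  rw [tr, ← integral_add (int1 _) int2]
  -- the vanishing integrals
  have hS := isCompact_sweep hK G.n δ
  set S := sweep K G.n δ with hSd
  have hsub : K ⊆ S := subset_sweep K G.n (hr.1.le.trans hr.2)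
  set z : E → ℝ := fun y => (u (X y) - u y) / r with hz
  have tz : IsTest (⊤ : ℕ∞) S z := (hu.shift hK hr').quot (hu.mono hsub) r
  have dz : ∀ v y, dirD v z y = (dirD v u (X y) - dirD v u y) / r := by
    intro v y
    rw [hz, dirD_quot ((hu.shift hK hr').differentiableAt h1 y) (hu.differentiableAt h1 y),
      dirD_shift]
  set m : E → ℝ := fun y => c.m (G.ht y) with hm
  set m' : E → ℝ := fun y => c.m (G.ht y + r) with hm'
  set φ : E → ℝ := fun y => ξ y * ξ (X y) with hφ
  have bm : BddMeas S m := (hc.loc (G := G)).m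
  have bm' : BddMeas S m' := ⟨hc.meas_m.comp (mht.add_const r), M, fun y _ => by
    rw [hm', abs_of_nonneg (hc.m_nonneg _)]; exact hc.m_le _⟩
  have bφ : BddMeas S φ := ⟨(hξ.continuous.measurable).mul
    (hξ.continuous.measurable.comp (measurable_id.add_const _)), 1, fun y _ => by
      rw [hφ, abs_of_nonneg (mul_nonneg (hζ0 _) (hζ0 _))]
      exact mul_le_one₀ (hζ1 _) (hζ0 _) (hζ1 _)⟩
  have bb : ∀ j, BddMeas S (fun y => c.b j (G.ht y)) := (hc.loc (G := G)).b
  have ba : ∀ i j, BddMeas S (fun y => c.a i j (G.ht y)) := (hc.loc (G := G)).a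
  have bb' : ∀ j, BddMeas S (fun y => c.b j (G.ht y + r)) := fun j =>
    ⟨(hc.meas_b j).comp (mht.add_const r), B, fun y _ => hc.b_le _ _⟩
  have ba' : ∀ i j, BddMeas S (fun y => c.a i j (G.ht y + r)) := fun i j =>
    ⟨(hc.meas_a i j).comp (mht.add_const r), B, fun y _ => hc.a_le _ _ _⟩
  have tun := (hu.dirD G.n).mono hsub
  have tun' := (hu.dirD G.n).shift hK (e := G.n) hr'
  have tx := fun j => (hu.dirD (G.e j)).mono hsub
  have tx' := fun j => (hu.dirD (G.e j)).shift hK (e := G.n) hr'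
  have inv : ∀ {v : E}, G.ht v = 0 → ∀ y (t : ℝ), G.ht (y + t • v) = G.ht y :=
    fun hv => Geo.ht_add_of_zero hv
  have invφ : ∀ {v : E}, G.ht v = 0 → ∀ y (t : ℝ), φ (y + t • v) = φ y := by
    intro v hv y t
    simp only [hφ, hξd, htX, inv hv]
  have Z1 : ZeroInt μ (fun y => m y * m' y * φ y * (spow p (z y) * dirD G.τ z y)) :=
    zeroInt_psi hS hψ ((bm.mul bm').mul bφ) tz fun y t => by
      simp only [hm, hm', inv G.ht_τ, invφ G.ht_τ]
  have Zb' : ∀ j, ZeroInt μ (fun y => m y * φ y * c.b j (G.ht y + r) * (spow p (z y)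
        * dirD (G.e j) (fun y => dirD G.n u (X y)) y + ((p - 1) * |z y| ^ (p - 2))
        * dirD (G.e j) z y * dirD G.n u (X y))
      - m y * φ y * c.b j (G.ht y + r) * ((p - 1) * (spow p (z y) * dirD (G.e j) z y))) := by
    intro j
    have hd : ∀ y (t : ℝ), (fun y => m y * φ y * c.b j (G.ht y + r)) (y + t • G.e j)
        = (fun y => m y * φ y * c.b j (G.ht y + r)) y := fun y t => by
      simp only [hm, inv (G.ht_e j), invφ (G.ht_e j)]
    have q1 := zeroInt_psi_mul (μ := μ) hS hψ ((bm.mul bφ).mul (bb' j)) tz tun' hd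
    have q2 := zeroInt_psi (μ := μ) hS hψ ((bm.mul bφ).mul (bb' j)) tz hd
    have q3 := q1.sub (⟨q2.1.const_mul (p - 1), by
      rw [integral_const_mul, q2.2, mul_zero]⟩ : ZeroInt μ _)
    convert q3 using 2 with y
    ring
  have Zb : ∀ j, ZeroInt μ (fun y => m' y * φ y * c.b j (G.ht y) * (spow p (z y)
        * dirD (G.e j) (fun y => dirD G.n u y) y + ((p - 1) * |z y| ^ (p - 2))
        * dirD (G.e j) z y * dirD G.n u y)
      - m' y * φ y * c.b j (G.ht y) * ((p - 1) * (spow p (z y) * dirD (G.e j) z y))) := by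
    intro j
    have hd : ∀ y (t : ℝ), (fun y => m' y * φ y * c.b j (G.ht y)) (y + t • G.e j)
        = (fun y => m' y * φ y * c.b j (G.ht y)) y := fun y t => by
      simp only [hm', inv (G.ht_e j), invφ (G.ht_e j)]
    have q1 := zeroInt_psi_mul (μ := μ) hS hψ ((bm'.mul bφ).mul (bb j)) tz tun hd
    have q2 := zeroInt_psi (μ := μ) hS hψ ((bm'.mul bφ).mul (bb j)) tz hd
    have q3 := q1.sub (⟨q2.1.const_mul (p - 1), by
      rw [integral_const_mul, q2.2, mul_zero]⟩ : ZeroInt μ _)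
    convert q3 using 2 with y
    ring
  have Za' : ∀ i j, ZeroInt μ (fun y => m y * φ y * c.a i j (G.ht y + r) * (spow p (z y)
        * dirD (G.e i) (fun y => dirD (G.e j) u (X y)) y + ((p - 1) * |z y| ^ (p - 2))
        * dirD (G.e i) z y * dirD (G.e j) u (X y))) := fun i j =>
    zeroInt_psi_mul hS hψ ((bm.mul bφ).mul (ba' i j)) tz (tx' j) fun y t => by
      simp only [hm, inv (G.ht_e i), invφ (G.ht_e i)]
  have Za : ∀ i j, ZeroInt μ (fun y => m' y * φ y * c.a i j (G.ht y) * (spow p (z y)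
        * dirD (G.e i) (fun y => dirD (G.e j) u y) y + ((p - 1) * |z y| ^ (p - 2))
        * dirD (G.e i) z y * dirD (G.e j) u y)) := fun i j =>
    zeroInt_psi_mul hS hψ ((bm'.mul bφ).mul (ba i j)) tz (tx j) fun y t => by
      simp only [hm', inv (G.ht_e i), invφ (G.ht_e i)]
  have Z1' : ZeroInt μ (fun y => -(r * (m y * m' y * φ y * (spow p (z y) * dirD G.τ z y)))) :=
    ⟨(Z1.1.const_mul r).neg, by rw [integral_neg, integral_const_mul, Z1.2, mul_zero, neg_zero]⟩
  have Z := (((Z1'.add (ZeroInt.sum (s := Finset.univ) Zb')).sub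
    (ZeroInt.sum (s := Finset.univ) Zb)).add (ZeroInt.sum (s := Finset.univ) fun i =>
      ZeroInt.sum (s := Finset.univ) (Za' i))).sub (ZeroInt.sum (s := Finset.univ) fun i =>
      ZeroInt.sum (s := Finset.univ) (Za i))
  have key := integral_sub ((int1 G.n).add int2) Z.1
  rw [Z.2, sub_zero] at key
  simp only [Pi.add_apply] at key
  rw [← key, ← integral_const_mul]
  have hT : MeasurableSet {y | G.ht y ∈ I ∧ G.ht y + r ∈ I} :=
    (mht hI).inter ((mht.add_const r) hI)
  rw [← integral_indicator hT]
  refine integral_mono (((int1 G.n).add int2).sub Z.1)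
    (((integrable_dblBdF hp hK hc hu hr A).const_mul _).indicator hT) fun y => ?_
  have e1 : dblF p u ξ G.n y r = dblInt p r (z y) ((dirD G.n u (X y) - z y) / r)
      (dirD G.n (dirD G.n u) (X y)) (φ y) (ξ y * dirD G.n (dirD G.n ξ) (X y)) := rfl
  have e2 : dblF p u ξ (-G.n) (X y) r = dblInt p r (-z y) ((-dirD G.n u y - -z y) / r)
      (dirD G.n (dirD G.n u) y) (φ y) (ξ (X y) * dirD G.n (dirD G.n ξ) y) := by
    have : X y + r • -G.n = y := by simp [hX]
    have e : (u y - u (X y)) / r = -z y := by simp only [hz]; ring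
    rw [dblF, this, e, dirD_neg_neg, dirD_neg_neg, dirD_neg_dir, mul_comm (ξ (X y)) (ξ y)]
  have sh : ∀ (w : E → ℝ) (v : E), dirD v (fun y => w (X y)) y = dirD v w (X y) :=
    fun w v => dirD_shift w v _ y
  simp only [e1, e2, dz, htX, sh]
  rw [dbl_algebra hp hr.1]
  have oF' : G.op c u (X y) = c.m (G.ht y + r) * dirD G.τ u (X y) - dirD G.n (dirD G.n u) (X y)
      - ∑ j, c.b j (G.ht y + r) * dirD (G.e j) (dirD G.n u) (X y)
      - ∑ i, ∑ j, c.a i j (G.ht y + r) * dirD (G.e i) (dirD (G.e j) u) (X y) := by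
    simp only [Geo.op, htX, hc.q_eq]
    ring
  have oF : G.op c u y = c.m (G.ht y) * dirD G.τ u y - dirD G.n (dirD G.n u) y
      - ∑ j, c.b j (G.ht y) * dirD (G.e j) (dirD G.n u) y
      - ∑ i, ∑ j, c.a i j (G.ht y) * dirD (G.e i) (dirD (G.e j) u) y := by
    simp only [Geo.op, hc.q_eq]
    ring
  erw [← oF', ← oF]
  have hA0 : 0 ≤ A := (abs_nonneg _).trans (hA 0)
  by_cases hy : y ∈ {y | G.ht y ∈ I ∧ G.ht y + r ∈ I}
  · rw [indicator_of_mem hy]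
    refine dbl_pointwise (F := G.op c u y) (F' := G.op c u (X y)) hp hr.1 (hc.m_nonneg _)
      (hc.m_le _) (hc.m_nonneg _) (hc.m_le _) hB
      (fun j => hc.b_le _ _) (fun i j => hc.a_le _ _ _) (fun j => hc.b_le _ _)
      (fun i j => hc.a_le _ _ _) (mul_nonneg (hζ0 _) (hζ0 _)) (mul_le_one₀ (hζ1 _) (hζ0 _) (hζ1 _))
      (A := A) ?_ ?_
    · rw [abs_mul, abs_of_nonneg (hζ0 _)]
      calc _ ≤ 1 * A := mul_le_mul (hζ1 _) (hA _) (abs_nonneg _) zero_le_one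
        _ = A := one_mul A
    · rw [abs_mul, abs_of_nonneg (hζ0 _)]
      calc _ ≤ 1 * A := mul_le_mul (hζ1 _) (hA _) (abs_nonneg _) zero_le_one
        _ = A := one_mul A
  · rw [indicator_of_notMem hy]
    have hφ0 : φ y = 0 ∧ ξ (X y) * dirD G.n (dirD G.n ξ) y = 0
        ∧ ξ y * dirD G.n (dirD G.n ξ) (X y) = 0 := by
      simp only [mem_ofPred_eq, not_and_or] at hy
      rcases hy with hy | hy
      · have : ξ y = 0 := hζI _ hy
        simp [hφ, this, hAI y hy]
      · have hy' : G.ht (X y) ∉ I := by rwa [htX]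
        have : ξ (X y) = 0 := hζI _ hy'
        simp [hφ, this, hAI _ hy']
    rw [hφ0.1, hφ0.2.1, hφ0.2.2]
    simp

end DoublingAtDistance

section Averaging

theorem abs_sub_rpow_le_integral {g g₁ : ℝ → ℝ} (hg : ∀ t, HasDerivAt g (g₁ t) t)
    (hc : Continuous g₁) {q : ℝ} (hq : 1 ≤ q) {r : ℝ} (hr : 0 ≤ r) :
    |g r - g 0| ^ q ≤ r ^ q * ∫ θ in Ioc (0 : ℝ) 1, |g₁ (θ * r)| ^ q := by
  have hq0 : 0 ≤ q := by linarith
  have hd : ∀ θ, HasDerivAt (fun θ => g (θ * r)) (g₁ (θ * r) * r) θ := fun θ => by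
    have h2 : HasDerivAt (fun θ : ℝ => θ * r) r θ := by
      simpa using (hasDerivAt_id' θ).mul_const r
    exact (hg (θ * r)).comp θ h2
  have hc' : Continuous fun θ => g₁ (θ * r) := hc.comp (continuous_id.mul continuous_const)
  have e1 : g r - g 0 = (∫ θ in Ioc (0 : ℝ) 1, g₁ (θ * r)) * r := by
    have := intervalIntegral.integral_eq_sub_of_hasDerivAt (a := 0) (b := 1) (fun θ _ => hd θ)
      ((hc'.mul continuous_const).intervalIntegrable _ _)
    rw [intervalIntegral.integral_of_le zero_le_one, integral_mul_const] at this
    rw [this]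
    simp
  have i1 : IntegrableOn (fun θ => |g₁ (θ * r)|) (Ioc (0 : ℝ) 1) :=
    (hc'.abs.integrableOn_Icc).mono_set Ioc_subset_Icc_self
  have i2 : IntegrableOn (fun θ => |g₁ (θ * r)| ^ q) (Ioc (0 : ℝ) 1) :=
    ((hc'.abs.rpow_const fun _ => Or.inr hq0).integrableOn_Icc).mono_set Ioc_subset_Icc_self
  have : IsProbabilityMeasure (volume.restrict (Ioc (0 : ℝ) 1)) := ⟨by simp⟩
  have j := (convexOn_rpow hq).map_integral_le (μ := volume.restrict (Ioc (0 : ℝ) 1))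
    (f := fun θ => |g₁ (θ * r)|) ((Real.continuous_rpow_const hq0).continuousOn) isClosed_Ici
    (Filter.Eventually.of_forall fun θ => mem_Ici.2 (abs_nonneg _)) i1 i2
  rw [e1, abs_mul, abs_of_nonneg hr, Real.mul_rpow (abs_nonneg _) hr, mul_comm]
  refine mul_le_mul_of_nonneg_left (le_trans ?_ j) (by positivity)
  exact Real.rpow_le_rpow (abs_nonneg _) (abs_integral_le_integral_abs) hq0

variable {E : Type*} [NormedAddCommGroup E] [NormedSpace ℝ E] [MeasurableSpace E] [BorelSpace E]
  [FiniteDimensional ℝ E] {μ : Measure E} [μ.IsAddHaarMeasure] {K : Set E}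

theorem integral_shift_diff_le (hK : IsCompact K) {g : E → ℝ} (hg : IsTest 1 K g) {e : E}
    {l : E →L[ℝ] ℝ} (he : l e = 1) {q : ℝ} (hq : 1 ≤ q) {r : ℝ} (hr : 0 ≤ r) (a b : ℝ) :
    ∫ y in {y | l y ∈ Icc a b ∧ l y + r ∈ Icc a b}, |g (y + r • e) - g y| ^ q ∂μ
      ≤ r ^ q * ∫ y in {y | l y ∈ Icc a b}, |dirD e g y| ^ q ∂μ := by
  have hq0 : 0 ≤ q := by linarith
  have hqp : 0 < q := by linarith
  set D := {y | l y ∈ Icc a b ∧ l y + r ∈ Icc a b} with hD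
  set S := {y | l y ∈ Icc a b} with hS
  have ml : Measurable l := l.continuous.measurable
  have mS : MeasurableSet S := ml measurableSet_Icc
  have mD : MeasurableSet D := mS.inter ((ml.add_const r) measurableSet_Icc)
  have c1 : Continuous (dirD e g) :=
    (hg.contDiff.continuous_fderiv (by simp)).clm_apply continuous_const
  have cg : Continuous g := hg.contDiff.continuous
  have bI : Integrable (fun y => |dirD e g y| ^ q) μ :=
    ((hg.bddMeas_dirD le_rfl hK e).abs_rpow hq0).integrable hK.measurableSet
      hK.measure_lt_top.ne fun y hy => by
        rw [image_eq_zero_of_notMem_tsupport fun h => hy (hg.dirD_supp e h), abs_zero,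
          Real.zero_rpow hqp.ne']
  have nn : ∀ y, 0 ≤ |dirD e g y| ^ q := fun y => by positivity
  have cs : Continuous fun y => |g (y + r • e) - g y| ^ q :=
    ((cg.comp (continuous_add_const (r • e))).sub cg).abs.rpow_const fun _ => Or.inr hq0
  rw [integral_eq_lintegral_of_nonneg_ae (Filter.Eventually.of_forall fun y => by positivity)
    cs.aestronglyMeasurable]
  refine ENNReal.toReal_le_of_le_ofReal
    (mul_nonneg (by positivity) (integral_nonneg fun y => by positivity)) ?_
  rw [ENNReal.ofReal_mul (by positivity), ofReal_integral_eq_lintegral_ofReal bI.integrableOn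
    (Filter.Eventually.of_forall nn)]
  have pt : ∀ y, ENNReal.ofReal (|g (y + r • e) - g y| ^ q) ≤ ENNReal.ofReal (r ^ q)
      * ∫⁻ θ in Ioc (0 : ℝ) 1, ENNReal.ofReal (|dirD e g (y + (θ * r) • e)| ^ q) := by
    intro y
    have h1 := abs_sub_rpow_le_integral (g := fun t => g (y + t • e))
      (g₁ := fun t => dirD e g (y + t • e))
      (fun t => hasDerivAt_line (hg.contDiff.differentiable (by simp)) y e t)
      (c1.comp (continuous_const.add (continuous_id.smul continuous_const))) hq hr
    simp only [zero_smul, add_zero] at h1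
    refine (ENNReal.ofReal_le_ofReal h1).trans_eq ?_
    rw [ENNReal.ofReal_mul (by positivity), ofReal_integral_eq_lintegral_ofReal]
    · refine (Continuous.integrableOn_Icc ?_).mono_set Ioc_subset_Icc_self
      exact (c1.comp (by fun_prop)).abs.rpow_const fun _ => Or.inr hq0
    · exact Filter.Eventually.of_forall fun y => by positivity
  have cJ : Continuous fun x : E × ℝ => |dirD e g (x.1 + (x.2 * r) • e)| ^ q :=
    (c1.comp (by fun_prop)).abs.rpow_const fun _ => Or.inr hq0
  calc ∫⁻ y in D, ENNReal.ofReal (|g (y + r • e) - g y| ^ q) ∂μ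
      ≤ ∫⁻ y in D, ENNReal.ofReal (r ^ q)
        * (∫⁻ θ in Ioc (0 : ℝ) 1, ENNReal.ofReal (|dirD e g (y + (θ * r) • e)| ^ q)) ∂μ :=
        lintegral_mono pt
    _ = ENNReal.ofReal (r ^ q) * ∫⁻ y in D,
        (∫⁻ θ in Ioc (0 : ℝ) 1, ENNReal.ofReal (|dirD e g (y + (θ * r) • e)| ^ q)) ∂μ :=
        lintegral_const_mul' _ _ ENNReal.ofReal_ne_top
    _ = ENNReal.ofReal (r ^ q) * ∫⁻ θ in Ioc (0 : ℝ) 1, ∫⁻ y in D,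
        ENNReal.ofReal (|dirD e g (y + (θ * r) • e)| ^ q) ∂μ := by
        rw [lintegral_lintegral_swap]
        exact (ENNReal.measurable_ofReal.comp cJ.measurable).aemeasurable
    _ ≤ ENNReal.ofReal (r ^ q) * ∫⁻ θ in Ioc (0 : ℝ) 1,
        ∫⁻ y in S, ENNReal.ofReal (|dirD e g y| ^ q) ∂μ := by
        refine mul_le_mul_right ?_ _
        refine setLIntegral_mono' measurableSet_Ioc fun θ hθ => ?_
        rw [← lintegral_indicator mD, ← lintegral_indicator mS,
          ← lintegral_add_right_eq_self (S.indicator _) ((θ * r) • e)]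
        refine lintegral_mono fun y => ?_
        by_cases hy : y ∈ D
        · have : y + (θ * r) • e ∈ S := by
            have h0 : 0 ≤ θ * r := mul_nonneg hθ.1.le hr
            have h1 : θ * r ≤ r := mul_le_of_le_one_left hr hθ.2
            have h2 : l (y + (θ * r) • e) = l y + θ * r := by simp [he]
            show l (y + (θ * r) • e) ∈ Icc a b
            rw [h2]
            exact ⟨by linarith [hy.1.1], by linarith [hy.2.2]⟩
          rw [indicator_of_mem hy, indicator_of_mem this]
        · rw [indicator_of_notMem hy]; exact zero_le
    _ = _ := by simp

end Averaging

section DoublingYoung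

theorem young_three {p ε : ℝ} (hp : 2 < p) (hε : 0 < ε) : ∃ C, 0 < C ∧ ∀ a b c : ℝ,
    0 ≤ a → 0 ≤ b → 0 ≤ c → a ^ (p - 2) * (b * c) ≤ ε * a ^ p + C * (b ^ p + c ^ p) := by
  obtain ⟨C, hC, h⟩ := rpow_mul_sq_le_eps hp hε
  refine ⟨C, hC, fun a b c ha hb hc => ?_⟩
  have hm : 0 ≤ max b c := hb.trans (le_max_left b c)
  have h1 : b * c ≤ max b c ^ 2 := by
    rw [sq]
    exact mul_le_mul (le_max_left b c) (le_max_right b c) hc hm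
  have h2 : max b c ^ p ≤ b ^ p + c ^ p := by
    have := Real.rpow_nonneg hb p
    have := Real.rpow_nonneg hc p
    rcases max_choice b c with h | h <;> rw [h] <;> linarith
  calc a ^ (p - 2) * (b * c) ≤ a ^ (p - 2) * max b c ^ 2 := by gcongr
    _ ≤ ε * a ^ p + C * max b c ^ p := h a _ ha hm
    _ ≤ _ := by gcongr

/-- The weight in the distance variable used for the doubling integral. -/
def dblW (p L r : ℝ) : ℝ := r ^ (-((p - 2) / (p - 1))) * L ^ (-(1 / (p - 1)))

theorem dblW_pos {p L r : ℝ} (hL : 0 < L) (hr : 0 < r) : 0 < dblW p L r := by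
  unfold dblW; positivity

theorem dblW_rpow {p L r : ℝ} (hp : 2 < p) (hL : 0 < L) (hr : 0 < r) :
    dblW p L r ^ (p - 1) * (L / r ^ 2) = r ^ (-p) := by
  have h1 : p - 1 ≠ 0 := by linarith
  have e1 : -((p - 2) / (p - 1)) * (p - 1) = 2 - p := by field_simp; ring
  have e2 : -(1 / (p - 1)) * (p - 1) = -1 := by field_simp
  rw [dblW, Real.mul_rpow (by positivity) (by positivity), ← Real.rpow_mul hr.le,
    ← Real.rpow_mul hL.le, e1, e2, Real.rpow_neg_one, Real.rpow_sub hr, Real.rpow_neg hr.le,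
    Real.rpow_two]
  field_simp

theorem young_three_weighted {p ε : ℝ} (hp : 2 < p) (hε : 0 < ε) : ∃ C, 0 < C ∧
    ∀ L r z S T : ℝ, 0 < L → 0 < r → 0 ≤ z → 0 ≤ S → 0 ≤ T →
      z ^ (p - 2) * (S * T / r)
        ≤ ε * (dblW p L r * z ^ p) + C * (dblW p L r * T ^ p + L / r ^ 2 * S ^ p) := by
  obtain ⟨C, hC, h⟩ := young_three hp hε
  refine ⟨C, hC, fun L r z S T hL hr hz hS hT => ?_⟩
  have hp0 : p ≠ 0 := by linarith
  have hω := dblW_pos (p := p) hL hr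
  have hw := dblW_rpow hp hL hr
  set ω := dblW p L r
  set w := L / r ^ 2 with hwd
  have hw0 : 0 < w := by positivity
  have key := h (ω ^ (1 / p) * z) (ω ^ (1 / p) * T) (w ^ (1 / p) * S) (by positivity)
    (by positivity) (by positivity)
  have e : ∀ x : ℝ, 0 < x → (x ^ (1 / p)) ^ p = x := fun x hx => by
    rw [← Real.rpow_mul hx.le, one_div_mul_cancel hp0, Real.rpow_one]
  rw [Real.mul_rpow (by positivity) hz, Real.mul_rpow (by positivity) hz,
    Real.mul_rpow (by positivity) hT, Real.mul_rpow (by positivity) hS, e ω hω, e w hw0] at key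
  refine le_trans (le_of_eq ?_) key
  have e2 : (ω ^ (1 / p)) ^ (p - 2) * (ω ^ (1 / p) * w ^ (1 / p)) = r⁻¹ := by
    have h1 : (ω ^ (1 / p)) ^ (p - 2) * ω ^ (1 / p) = (ω ^ (p - 1)) ^ (1 / p) := by
      rw [← Real.rpow_mul hω.le, ← Real.rpow_mul hω.le, ← Real.rpow_add hω]
      congr 1; ring
    rw [← mul_assoc, h1, ← Real.mul_rpow (by positivity) hw0.le, hw, ← Real.rpow_mul hr.le]
    have : -p * (1 / p) = -1 := by field_simp
    rw [this, Real.rpow_neg_one]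
  calc z ^ (p - 2) * (S * T / r) = r⁻¹ * (z ^ (p - 2) * (T * S)) := by ring
    _ = _ := by rw [← e2]; ring

theorem abs_sub_rpow_le {s : ℝ} (hs : 1 ≤ s) (x y : ℝ) :
    |x - y| ^ s ≤ 2 ^ s * |spow (s + 1) x - spow (s + 1) y| := by
  have hs0 : 0 ≤ s := by linarith
  have key : ∀ x y : ℝ, 0 ≤ y → y ≤ x → |x - y| ^ s ≤ 2 ^ s * |x ^ s - y ^ s| := by
    intro x y hy hxy
    have h1 := Real.add_rpow_le_rpow_add (sub_nonneg.2 hxy) hy hs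
    rw [sub_add_cancel] at h1
    rw [abs_of_nonneg (sub_nonneg.2 hxy)]
    have h2 : 0 ≤ (x - y) ^ s := Real.rpow_nonneg (sub_nonneg.2 hxy) s
    have h4 : (x - y) ^ s ≤ x ^ s - y ^ s := by linarith
    have h3 : 1 ≤ (2 : ℝ) ^ s := Real.one_le_rpow (by norm_num) hs0
    rw [abs_of_nonneg (h2.trans h4)]
    nlinarith
  have keyopp : ∀ x y : ℝ, 0 ≤ x → 0 ≤ y → |x + y| ^ s ≤ 2 ^ s * |x ^ s + y ^ s| := by
    intro x y hx hy
    rw [abs_of_nonneg (add_nonneg hx hy), abs_of_nonneg (by positivity)]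
    exact add_rpow_le_two_rpow hs0 hx hy
  have sp : ∀ x : ℝ, 0 ≤ x → spow (s + 1) x = x ^ s := by
    intro x hx
    rcases hx.eq_or_lt with rfl | hx
    · rw [spow, mul_zero, Real.zero_rpow (by linarith)]
    · rw [spow, abs_of_pos hx, ← Real.rpow_add_one hx.ne']
      congr 1; ring
  have sn : ∀ x : ℝ, x ≤ 0 → spow (s + 1) x = -(-x) ^ s := by
    intro x hx
    have := sp (-x) (by linarith)
    rw [← this]
    simp [spow]
  rcases le_total 0 x with hx | hx <;> rcases le_total 0 y with hy | hy
  · rw [sp x hx, sp y hy]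
    rcases le_total x y with h | h
    · rw [abs_sub_comm, abs_sub_comm (x ^ s)]; exact key y x hx h
    · exact key x y hy h
  · rw [sp x hx, sn y hy]
    have := keyopp x (-y) hx (by linarith)
    rwa [← sub_eq_add_neg, ← sub_neg_eq_add] at this
  · rw [sn x hx, sp y hy]
    have := keyopp (-x) y (by linarith) hy
    rw [← abs_neg, ← abs_neg (_ - _)]
    convert this using 3 <;> ring
  · rw [sn x hx, sn y hy]
    rcases le_total x y with h | h
    · have := key (-x) (-y) (by linarith) (by linarith)
      rw [← abs_neg, ← abs_neg (_ - _)]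
      convert this using 3 <;> ring
    · have := key (-y) (-x) (by linarith) (by linarith)
      convert this using 3 <;> ring

theorem abs_sub_rpow_le_sq {p : ℝ} (hp : 2 < p) (x y : ℝ) :
    |x - y| ^ p ≤ 2 ^ p * |spow (p / 2 + 1) x - spow (p / 2 + 1) y| ^ (2 : ℝ) := by
  have h := abs_sub_rpow_le (s := p / 2) (by linarith) x y
  have h2 := Real.rpow_le_rpow (by positivity) h (z := 2) (by norm_num)
  rw [Real.mul_rpow (by positivity) (abs_nonneg _), ← Real.rpow_mul (abs_nonneg _),
    ← Real.rpow_mul (by norm_num)] at h2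
  rwa [div_mul_cancel₀ p (by norm_num : (2 : ℝ) ≠ 0)] at h2

theorem slope_term_le {p ε A : ℝ} (hp : 2 < p) (hε : 0 < ε) (hA : 0 < A) : ∃ C, 0 < C ∧
    ∀ L r U U' : ℝ, 0 < L → 0 < r → r ≤ 2 * L →
      r * (A / L ^ 2) * |(U' - U) / r| ^ p
        ≤ ε / L * |(U' - U) / r| ^ p + C * (L⁻¹ * L ^ (-p) * (|U| ^ p + |U'| ^ p)) := by
  have hp0 : 0 ≤ p := by linarith
  refine ⟨2 * A * (2 ^ p * (ε / A) ^ (-p)), by positivity, fun L r U U' hL hr hrL => ?_⟩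
  rcases le_total (r * A) (ε * L) with h | h
  · have h1 : r * (A / L ^ 2) ≤ ε / L := by
      rw [← mul_div_assoc, div_le_div_iff₀ (by positivity) hL]
      nlinarith
    have : 0 ≤ 2 * A * (2 ^ p * (ε / A) ^ (-p)) * (L⁻¹ * L ^ (-p) * (|U| ^ p + |U'| ^ p)) := by
      positivity
    have := mul_le_mul_of_nonneg_right h1 (by positivity : 0 ≤ |(U' - U) / r| ^ p)
    linarith
  · have h1 : ε / A * L ≤ r := by
      rw [div_mul_eq_mul_div, div_le_iff₀ hA]; exact h
    have h2 : |(U' - U) / r| ^ p ≤ (ε / A) ^ (-p) * L ^ (-p) * (2 ^ p * (|U| ^ p + |U'| ^ p)) := by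
      rw [abs_div, Real.div_rpow (abs_nonneg _) (abs_nonneg _), abs_of_pos hr, div_eq_mul_inv,
        ← Real.rpow_neg hr.le, mul_comm]
      have h3 : r ^ (-p) ≤ (ε / A) ^ (-p) * L ^ (-p) := by
        rw [← Real.mul_rpow (by positivity) hL.le]
        exact Real.rpow_le_rpow_of_nonpos (by positivity) h1 (by linarith)
      have h4 : |U' - U| ^ p ≤ 2 ^ p * (|U| ^ p + |U'| ^ p) := by
        refine le_trans (Real.rpow_le_rpow (abs_nonneg _) (abs_sub _ _) hp0) ?_
        rw [add_comm (|U| ^ p)]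
        exact add_rpow_le_two_rpow hp0 (abs_nonneg _) (abs_nonneg _)
      exact mul_le_mul h3 h4 (by positivity) (by positivity)
    have h5 : r * (A / L ^ 2) ≤ 2 * A * L⁻¹ := by
      have : 2 * A * L⁻¹ = 2 * L * (A / L ^ 2) := by field_simp
      rw [this]
      gcongr
    have h6 := mul_le_mul h5 h2 (by positivity) (by positivity)
    have : 0 ≤ ε / L * |(U' - U) / r| ^ p := by positivity
    refine h6.trans ?_
    refine le_trans (le_of_eq ?_) (le_add_of_nonneg_left this)
    ring

variable {ι : Type*} [Fintype ι]

theorem dblBd_le (ι : Type*) [Fintype ι] {p ε A : ℝ} (hp : 2 < p) (hε : 0 < ε) (hA : 0 < A) :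
    ∃ C, 0 < C ∧ ∀ (L r U U' F F' : ℝ) (x x' : ι → ℝ), 0 < L → 0 < r → r ≤ 2 * L →
      dblBd p (A / L ^ 2) r ((U' - U) / r) F F' x x'
        ≤ ε * (dblW p L r + L⁻¹) * |(U' - U) / r| ^ p
          + C * (dblW p L r * (∑ j, |x j| ^ p + ∑ j, |x' j| ^ p)
            + L ^ (p - 1) * (|F| ^ p + |F'| ^ p) + L⁻¹ * L ^ (-p) * (|U| ^ p + |U'| ^ p))
          + C * (L / r ^ 2 * ∑ j, |spow (p / 2 + 1) (x' j) - spow (p / 2 + 1) (x j)| ^ (2 : ℝ)) := by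
  obtain ⟨C1, hC1, h1⟩ := young_three_weighted hp hε
  obtain ⟨C3, hC3, h3⟩ := slope_term_le hp (half_pos hε) hA
  have hp0 : 0 ≤ p := by linarith
  set k : ℝ := (Fintype.card ι : ℝ) ^ (p - 1) with hk
  have hk0 : 0 ≤ k := by positivity
  set C2 : ℝ := (ε / 2) ^ (1 - p) * 2 ^ p with hC2d
  have hC2 : 0 < C2 := by positivity
  refine ⟨C1 * k * 2 ^ p + C2 + C3, by positivity, fun L r U U' F F' x x' hL hr hrL => ?_⟩
  set z := (U' - U) / r with hz
  have hω := dblW_pos (p := p) hL hr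
  set ω := dblW p L r
  have hS : 0 ≤ ∑ j, |x' j - x j| := Finset.sum_nonneg fun _ _ => abs_nonneg _
  have hT : 0 ≤ tanSum x x' := hS.trans (sum_abs_sub_le_tanSum x x')
  have t1 := h1 L r |z| _ _ hL hr (abs_nonneg z) hS hT
  have t3 := h3 L r U U' hL hr hrL
  rw [← hz] at t3
  have hST : (∑ j, |x' j - x j|) ^ p
      ≤ k * 2 ^ p * ∑ j, |spow (p / 2 + 1) (x' j) - spow (p / 2 + 1) (x j)| ^ (2 : ℝ) := by
    have := Real.rpow_sum_le_const_mul_sum_rpow Finset.univ (fun j => x' j - x j)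
      (p := p) (by linarith)
    refine this.trans ?_
    rw [mul_assoc]
    refine mul_le_mul_of_nonneg_left ?_ hk0
    rw [Finset.mul_sum]
    exact Finset.sum_le_sum fun j _ => abs_sub_rpow_le_sq hp _ _
  have hTT : tanSum x x' ^ p ≤ k * 2 ^ p * (∑ j, |x j| ^ p + ∑ j, |x' j| ^ p) := by
    have := Real.rpow_sum_le_const_mul_sum_rpow Finset.univ (fun j => |x j| + |x' j|)
      (p := p) (by linarith)
    simp only [abs_of_nonneg (add_nonneg (abs_nonneg (x _)) (abs_nonneg (x' _)))] at this
    refine (show tanSum x x' ^ p ≤ _ from this).trans ?_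
    rw [mul_assoc]
    refine mul_le_mul_of_nonneg_left ?_ hk0
    rw [← Finset.sum_add_distrib, Finset.mul_sum]
    exact Finset.sum_le_sum fun j _ => add_rpow_le_two_rpow hp0 (abs_nonneg _) (abs_nonneg _)
  have t2 : |z| ^ (p - 1) * (|F| + |F'|)
      ≤ ε / 2 / L * |z| ^ p + C2 * (L ^ (p - 1) * (|F| ^ p + |F'| ^ p)) := by
    have h := young_eps (p := p) (η := ε / 2 / L) (A := |z| ^ (p - 1)) (B := |F| + |F'|)
      (by linarith) (by positivity) (by positivity) (by positivity)
    have e1 : (|z| ^ (p - 1)) ^ (p / (p - 1)) = |z| ^ p := by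
      rw [← Real.rpow_mul (abs_nonneg z)]
      congr 1
      have : p - 1 ≠ 0 := by linarith
      field_simp
    have e2 : (ε / 2 / L) ^ (1 - p) = (ε / 2) ^ (1 - p) * L ^ (p - 1) := by
      rw [Real.div_rpow (by positivity) hL.le, div_eq_mul_inv, ← Real.rpow_neg hL.le, neg_sub]
    rw [e1, e2] at h
    refine h.trans (add_le_add le_rfl ?_)
    have := add_rpow_le_two_rpow hp0 (abs_nonneg F) (abs_nonneg F')
    calc _ ≤ (ε / 2) ^ (1 - p) * L ^ (p - 1) * (2 ^ p * (|F| ^ p + |F'| ^ p)) := by gcongr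
      _ = _ := by rw [hC2d]; ring
  set Sx := ∑ j, |x j| ^ p + ∑ j, |x' j| ^ p
  set Sg := ∑ j, |spow (p / 2 + 1) (x' j) - spow (p / 2 + 1) (x j)| ^ (2 : ℝ)
  have hSx : 0 ≤ Sx := add_nonneg (Finset.sum_nonneg fun _ _ => by positivity)
    (Finset.sum_nonneg fun _ _ => by positivity)
  have hSg : 0 ≤ Sg := Finset.sum_nonneg fun _ _ => by positivity
  have t1' : |z| ^ (p - 2) * ((∑ j, |x' j - x j|) * tanSum x x' / r)
      ≤ ε * (ω * |z| ^ p) + C1 * k * 2 ^ p * (ω * Sx + L / r ^ 2 * Sg) := by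
    refine t1.trans (add_le_add le_rfl ?_)
    calc _ ≤ C1 * (ω * (k * 2 ^ p * Sx) + L / r ^ 2 * (k * 2 ^ p * Sg)) := by gcongr
      _ = _ := by ring
  have nF : 0 ≤ L ^ (p - 1) * (|F| ^ p + |F'| ^ p) := by positivity
  have nU : 0 ≤ L⁻¹ * L ^ (-p) * (|U| ^ p + |U'| ^ p) := by positivity
  have nx : 0 ≤ ω * Sx := by positivity
  have ng : 0 ≤ L / r ^ 2 * Sg := by positivity
  have k1 : 0 ≤ C1 * k * 2 ^ p := by positivity
  unfold dblBd
  set QF := L ^ (p - 1) * (|F| ^ p + |F'| ^ p)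
  set QU := L⁻¹ * L ^ (-p) * (|U| ^ p + |U'| ^ p)
  set Qx := ω * Sx
  set Qg := L / r ^ 2 * Sg
  set K1 := C1 * k * 2 ^ p
  have e : ε / 2 / L * |z| ^ p = ε / 2 * (L⁻¹ * |z| ^ p) := by ring
  rw [e] at t2 t3
  have m1 := mul_nonneg hC2.le nx
  have m2 := mul_nonneg hC3.le nx
  have m3 := mul_nonneg k1 nF
  have m4 := mul_nonneg hC3.le nF
  have m5 := mul_nonneg k1 nU
  have m6 := mul_nonneg hC2.le nU
  have m7 := mul_nonneg hC2.le ng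
  have m8 := mul_nonneg hC3.le ng
  nlinarith

end DoublingYoung

section DoublingIntegrated

variable {E ι : Type*} [NormedAddCommGroup E] [NormedSpace ℝ E] [MeasurableSpace E] [BorelSpace E]
  [FiniteDimensional ℝ E] [Fintype ι] {μ : Measure E} [μ.IsAddHaarMeasure] {G : Geo E ι}
  {c : Coef ι} {K : Set E}

theorem integrable_op_rpow (hK : IsCompact K) (hc : c.Loc G K) {u : E → ℝ}
    (hu : IsTest (⊤ : ℕ∞) K u) {p : ℝ} (hp : 0 < p) : Integrable (fun y => |G.op c u y| ^ p) μ :=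
  ((Geo.bddMeas_op hK hc hu).abs_rpow hp.le).integrable hK.measurableSet hK.measure_lt_top.ne
    fun y hy => by rw [Geo.op_zero_off hu hy, abs_zero, Real.zero_rpow hp.ne']

theorem IsTest.integrable_rpow (hK : IsCompact K) {u : E → ℝ} {n : WithTop ℕ∞}
    (hu : IsTest n K u) {p : ℝ} (hp : 0 < p) : Integrable (fun y => |u y| ^ p) μ :=
  ((hu.bddMeas hK).abs_rpow hp.le).integrable hK.measurableSet hK.measure_lt_top.ne
    fun y hy => by rw [hu.zero_off hy, abs_zero, Real.zero_rpow hp.ne']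

theorem IsTest.integrable_rpow_mul_sq (hK : IsCompact K) {u w : E → ℝ} {n : WithTop ℕ∞}
    (hu : IsTest n K u) (hw : IsTest n K w) {p : ℝ} (hp : 2 < p) :
    Integrable (fun y => |u y| ^ (p - 2) * w y ^ 2) μ :=
  (((hu.bddMeas hK).abs_rpow (by linarith)).mul ((hw.bddMeas hK).pow 2)).integrable
    hK.measurableSet hK.measure_lt_top.ne fun y hy => by simp [hw.zero_off hy]

theorem abs_dirD_spow_rpow {p : ℝ} (hp : 2 < p) {v : E → ℝ} {y : E}
    (hv : DifferentiableAt ℝ v y) (w : E) :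
    |dirD w (fun y => spow (p / 2 + 1) (v y)) y| ^ (2 : ℝ)
      = (p / 2) ^ 2 * (|v y| ^ (p - 2) * dirD w v y ^ 2) := by
  rw [dirD_comp hv (hasDerivAt_spow (by linarith) _), Real.rpow_two, sq_abs, mul_pow, mul_pow]
  have : (|v y| ^ (p / 2 + 1 - 2)) ^ 2 = |v y| ^ (p - 2) := by
    rw [← Real.rpow_mul_natCast (abs_nonneg _)]
    congr 1; push_cast; ring
  rw [this]
  ring

theorem setIntegral_shift_le {h : E → ℝ} (hh : Integrable h μ) (h0 : ∀ y, 0 ≤ h y) {D S : Set E}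
    (hD : MeasurableSet D) (hS : MeasurableSet S) (w : E) (hDS : ∀ y ∈ D, y + w ∈ S) :
    ∫ y in D, h (y + w) ∂μ ≤ ∫ y in S, h y ∂μ := by
  rw [← integral_indicator hD, ← integral_indicator hS,
    ← integral_add_right_eq_self (S.indicator h) w]
  refine integral_mono ((hh.comp_add_right w).indicator hD)
    ((hh.indicator hS).comp_add_right w) fun y => ?_
  by_cases hy : y ∈ D
  · simp only [indicator_of_mem hy, indicator_of_mem (hDS y hy), le_refl]
  · rw [indicator_of_notMem hy]
    exact indicator_nonneg (fun y _ => h0 y) _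

theorem integral_dblBdF_le (ι : Type*) [Fintype ι] {p ε A : ℝ} (hp : 2 < p) (hε : 0 < ε)
    (hA : 0 < A) : ∃ C, 0 < C ∧ ∀ (G : Geo E ι) (c : Coef ι) (K : Set E), IsCompact K →
      ∀ M B, c.Flat M B → ∀ u : E → ℝ, IsTest (⊤ : ℕ∞) K u → ∀ a b L r : ℝ,
      0 < L → r ∈ Ioc 0 (2 * L) →
      ∫ y in {y | G.ht y ∈ Icc a b ∧ G.ht y + r ∈ Icc a b}, dblBdF p (A / L ^ 2) G c u r y ∂μ
        ≤ ε * (dblW p L r + L⁻¹) * (∫ y in {y | G.ht y ∈ Icc a b}, |dirD G.n u y| ^ p ∂μ)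
          + C * (dblW p L r * (∫ y in {y | G.ht y ∈ Icc a b}, ∑ j, |dirD (G.e j) u y| ^ p ∂μ)
            + L ^ (p - 1) * (∫ y in {y | G.ht y ∈ Icc a b}, |G.op c u y| ^ p ∂μ)
            + L⁻¹ * L ^ (-p) * (∫ y in {y | G.ht y ∈ Icc a b}, |u y| ^ p ∂μ)
            + L * ∫ y in {y | G.ht y ∈ Icc a b},
                ∑ j, |dirD (G.e j) u y| ^ (p - 2) * dirD G.n (dirD (G.e j) u) y ^ 2 ∂μ) := by
  obtain ⟨C, hC, h⟩ := dblBd_le ι hp hε hA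
  refine ⟨2 * C + C * (p / 2) ^ 2, by positivity, ?_⟩
  intro G c K hK M B hc u hu a b L r hL hr
  have hp0 : 0 < p := by linarith
  have hr0 := hr.1
  set D := {y | G.ht y ∈ Icc a b ∧ G.ht y + r ∈ Icc a b} with hD
  set S := {y | G.ht y ∈ Icc a b} with hS
  have ml : Measurable G.ht := G.ht.continuous.measurable
  have mS : MeasurableSet S := ml measurableSet_Icc
  have mD : MeasurableSet D := mS.inter ((ml.add_const r) measurableSet_Icc)
  have hDS : D ⊆ S := fun y hy => hy.1
  have hDS' : ∀ y ∈ D, y + r • G.n ∈ S := fun y hy => by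
    show G.ht (y + r • G.n) ∈ Icc a b
    rw [Geo.ht_add_n]; exact hy.2
  have hω := dblW_pos (p := p) hL hr0
  set ω := dblW p L r
  have h1 : (1 : WithTop ℕ∞) ≤ ((⊤ : ℕ∞) : WithTop ℕ∞) := by exact_mod_cast le_top
  have hu1 := hu.of_le h1
  have tj := fun j => hu.dirD (G.e j)
  have iF := integrable_op_rpow (μ := μ) (G := G) hK hc.loc hu hp0
  have iu := hu.integrable_rpow (μ := μ) hK hp0
  have iT : Integrable (fun y => ∑ j, |dirD (G.e j) u y| ^ p) μ :=
    integrable_finsetSum _ fun j _ => (tj j).integrable_rpow hK hp0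
  set H : E → ℝ := fun y => ω * (∑ j, |dirD (G.e j) u y| ^ p) + L ^ (p - 1) * |G.op c u y| ^ p
    + L⁻¹ * L ^ (-p) * |u y| ^ p with hH
  have iTF : Integrable (fun y => ω * (∑ j, |dirD (G.e j) u y| ^ p)
      + L ^ (p - 1) * |G.op c u y| ^ p) μ := (iT.const_mul _).add (iF.const_mul _)
  have iH : Integrable H μ := iTF.add (iu.const_mul _)
  have H0 : ∀ y, 0 ≤ H y := fun y => by
    have : 0 ≤ ∑ j, |dirD (G.e j) u y| ^ p := Finset.sum_nonneg fun _ _ => by positivity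
    simp only [hH]; positivity
  have intH : ∫ y in S, H y ∂μ = ω * (∫ y in S, ∑ j, |dirD (G.e j) u y| ^ p ∂μ)
      + L ^ (p - 1) * (∫ y in S, |G.op c u y| ^ p ∂μ)
      + L⁻¹ * L ^ (-p) * (∫ y in S, |u y| ^ p ∂μ) := by
    simp only [hH]
    rw [integral_add iTF.integrableOn
      (iu.const_mul _).integrableOn, integral_add (iT.const_mul _).integrableOn
      (iF.const_mul _).integrableOn, integral_const_mul, integral_const_mul, integral_const_mul]
  have hr' : r ∈ Icc 0 (2 * L) := ⟨hr.1.le, hr.2⟩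
  have hK' := isCompact_sweep hK G.n (2 * L)
  have hsub := subset_sweep K G.n (hr.1.le.trans hr.2)
  have tz := (hu.shift hK (e := G.n) hr').quot (hu.mono hsub) r
  have iz := tz.integrable_rpow (μ := μ) hK' hp0
  have hψ : PrimPair (spow (p / 2 + 1)) _ _ := primPair_spow (by linarith)
  have tg : ∀ j, IsTest 1 K (fun y => spow (p / 2 + 1) (dirD (G.e j) u y)) := fun j =>
    ((tj j).of_le h1).comp hψ.contDiff hψ.zero
  have ig : ∀ j, Integrable (fun y => |spow (p / 2 + 1) (dirD (G.e j) u (y + r • G.n))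
      - spow (p / 2 + 1) (dirD (G.e j) u y)| ^ (2 : ℝ)) μ := fun j => by
    have t1 := ((tg j).shift hK (e := G.n) hr').quot ((tg j).mono hsub) 1
    have := t1.integrable_rpow (μ := μ) hK' (p := 2) (by norm_num)
    simpa only [div_one] using this
  have pt : ∀ y ∈ D, dblBdF p (A / L ^ 2) G c u r y
      ≤ (ε * (ω + L⁻¹) * |(u (y + r • G.n) - u y) / r| ^ p + C * (H y + H (y + r • G.n)))
        + C * (L / r ^ 2 * ∑ j, |spow (p / 2 + 1) (dirD (G.e j) u (y + r • G.n))
          - spow (p / 2 + 1) (dirD (G.e j) u y)| ^ (2 : ℝ)) := by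
    intro y _
    refine (h L r (u y) (u (y + r • G.n)) (G.op c u y) (G.op c u (y + r • G.n)) _ _ hL hr0
      hr.2).trans (le_of_eq ?_)
    simp only [hH]
    ring
  have iHH : Integrable (fun y => H y + H (y + r • G.n)) μ :=
    iH.add (iH.comp_add_right (r • G.n))
  have iP1 : Integrable (fun y => ε * (ω + L⁻¹) * |(u (y + r • G.n) - u y) / r| ^ p
      + C * (H y + H (y + r • G.n))) μ :=
    (iz.const_mul (ε * (ω + L⁻¹))).add (iHH.const_mul C)
  have iP2 : Integrable (fun y => C * (L / r ^ 2 *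
      ∑ j, |spow (p / 2 + 1) (dirD (G.e j) u (y + r • G.n))
        - spow (p / 2 + 1) (dirD (G.e j) u y)| ^ (2 : ℝ))) μ :=
    ((integrable_finsetSum Finset.univ fun j _ => ig j).const_mul (L / r ^ 2)).const_mul C
  refine (setIntegral_mono_on (integrable_dblBdF hp hK hc hu hr _).integrableOn
    (iP1.add iP2).integrableOn mD pt).trans ?_
  have s1 : ∫ y in D, |(u (y + r • G.n) - u y) / r| ^ p ∂μ ≤ ∫ y in S, |dirD G.n u y| ^ p ∂μ := by
    have := integral_shift_diff_le (μ := μ) hK hu1 G.ht_n (q := p) (by linarith) hr0.le a b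
    have e : ∀ y, |(u (y + r • G.n) - u y) / r| ^ p
        = (r ^ p)⁻¹ * |u (y + r • G.n) - u y| ^ p := fun y => by
      rw [abs_div, Real.div_rpow (abs_nonneg _) (abs_nonneg _), abs_of_pos hr0, div_eq_inv_mul]
    simp only [e]
    rw [integral_const_mul, inv_mul_le_iff₀ (by positivity)]
    exact this
  have s2 : ∫ y in D, (H y + H (y + r • G.n)) ∂μ ≤ 2 * ∫ y in S, H y ∂μ := by
    rw [integral_add iH.integrableOn (iH.comp_add_right (r • G.n)).integrableOn, two_mul]
    exact add_le_add (setIntegral_mono_set iH.integrableOn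
      (Filter.Eventually.of_forall H0) hDS.eventuallyLE) (setIntegral_shift_le iH H0 mD mS _ hDS')
  have s3 : ∫ y in D, ∑ j, |spow (p / 2 + 1) (dirD (G.e j) u (y + r • G.n))
          - spow (p / 2 + 1) (dirD (G.e j) u y)| ^ (2 : ℝ) ∂μ
      ≤ r ^ 2 * ((p / 2) ^ 2 * ∫ y in S,
          ∑ j, |dirD (G.e j) u y| ^ (p - 2) * dirD G.n (dirD (G.e j) u) y ^ 2 ∂μ) := by
    rw [integral_finsetSum _ fun j _ => (ig j).integrableOn, integral_finsetSum _ fun j _ =>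
      ((tj j).integrable_rpow_mul_sq hK ((tj j).dirD G.n) hp).integrableOn, Finset.mul_sum,
      Finset.mul_sum]
    refine Finset.sum_le_sum fun j _ => ?_
    have := integral_shift_diff_le (μ := μ) hK (tg j) G.ht_n (q := 2) (by norm_num) hr0.le a b
    simp only [abs_dirD_spow_rpow hp ((tj j).differentiableAt h1 _), Real.rpow_two r] at this
    rwa [integral_const_mul] at this
  simp only [Pi.add_apply]
  rw [integral_add iP1.integrableOn iP2.integrableOn,
    integral_add (iz.const_mul _).integrableOn (iHH.const_mul C).integrableOn]
  rw [integral_const_mul, integral_const_mul, integral_const_mul, integral_const_mul]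
  rw [intH] at s2
  set V := ∫ y in S, ∑ j, |dirD (G.e j) u y| ^ (p - 2) * dirD G.n (dirD (G.e j) u) y ^ 2 ∂μ
  set T := ∫ y in S, ∑ j, |dirD (G.e j) u y| ^ p ∂μ
  set FI := ∫ y in S, |G.op c u y| ^ p ∂μ
  set W := ∫ y in S, |u y| ^ p ∂μ
  have V0 : 0 ≤ V := integral_nonneg fun y => Finset.sum_nonneg fun j _ => by positivity
  have T0 : 0 ≤ T := integral_nonneg fun y => Finset.sum_nonneg fun j _ => by positivity
  have F0 : 0 ≤ FI := integral_nonneg fun y => by positivity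
  have W0 : 0 ≤ W := integral_nonneg fun y => by positivity
  have a1 := mul_le_mul_of_nonneg_left s1 (by positivity : 0 ≤ ε * (ω + L⁻¹))
  have a2 := mul_le_mul_of_nonneg_left s2 hC.le
  have a3 := mul_le_mul_of_nonneg_left s3 (by positivity : 0 ≤ C * (L / r ^ 2))
  have e3 : C * (L / r ^ 2) * (r ^ 2 * ((p / 2) ^ 2 * V)) = C * (p / 2) ^ 2 * (L * V) := by
    field_simp
  rw [e3] at a3
  have b1 : 0 ≤ C * (p / 2) ^ 2 * (ω * T + L ^ (p - 1) * FI + L⁻¹ * L ^ (-p) * W) := by positivity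
  have b2 : 0 ≤ 2 * C * (L * V) := by positivity
  refine (add_le_add (add_le_add a1 a2) (le_trans (le_of_eq (mul_assoc _ _ _).symm) a3)).trans ?_
  nlinarith

end DoublingIntegrated

section LocalNormal

theorem exists_cutoff : ∃ (χ : ℝ → ℝ) (A : ℝ), 0 < A ∧ ContDiff ℝ (⊤ : ℕ∞) χ ∧ (∀ s, 0 ≤ χ s) ∧
    (∀ s, χ s ≤ 1) ∧ (∀ s, |s| ≤ 1 / 2 → χ s = 1) ∧
    (∀ s, 1 ≤ |s| → χ s = 0 ∧ deriv χ s = 0 ∧ deriv (deriv χ) s = 0) ∧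
    ∀ s, |deriv (deriv χ) s| ≤ A := by
  let f : ContDiffBump (0 : ℝ) := ⟨1 / 2, 3 / 4, by norm_num, by norm_num⟩
  have hc : ContDiff ℝ (⊤ : ℕ∞) (f : ℝ → ℝ) := f.contDiff
  have hz : ∀ s : ℝ, 1 ≤ |s| → (f : ℝ → ℝ) =ᶠ[nhds s] fun _ => 0 := by
    intro s hs
    have : {x : ℝ | 3 / 4 < |x|} ∈ nhds s :=
      (isOpen_lt continuous_const continuous_abs).mem_nhds
        (show (3 / 4 : ℝ) < |s| by linarith)
    filter_upwards [this] with x hx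
    exact f.zero_of_le_dist (by simpa [Real.dist_eq] using (show (3 / 4 : ℝ) < |x| from hx).le)
  have hc1 : ContDiff ℝ (⊤ : ℕ∞) (deriv f) := (contDiff_infty_iff_deriv.1 hc).2
  have hc2 : Continuous (deriv (deriv f)) := (contDiff_infty_iff_deriv.1 hc1).2.continuous
  obtain ⟨A, hA⟩ := f.hasCompactSupport.deriv.deriv.exists_bound_of_continuous hc2
  refine ⟨f, |A| + 1, by positivity, hc, fun s => f.nonneg, fun s => f.le_one, fun s hs => ?_,
    fun s hs => ⟨(hz s hs).eq_of_nhds, ?_, ?_⟩, fun s => ?_⟩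
  · exact f.one_of_mem_closedBall (by
      rw [Metric.mem_closedBall, Real.dist_eq, sub_zero]; exact hs)
  · rw [(hz s hs).deriv_eq]; simp
  · rw [(hz s hs).deriv.deriv_eq]; simp
  · have := hA s
    rw [Real.norm_eq_abs] at this
    exact this.trans ((le_abs_self A).trans (by linarith))

theorem integral_dblW {p L : ℝ} (hp : 2 < p) (hL : 0 < L) :
    IntegrableOn (fun r => dblW p L r) (Ioc 0 (2 * L)) ∧
      ∫ r in Ioc 0 (2 * L), dblW p L r = 2 ^ (1 / (p - 1)) * (p - 1) := by
  have h1 : 0 < p - 1 := by linarith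
  have h3 : -((p - 2) / (p - 1)) + 1 = 1 / (p - 1) := by field_simp; ring
  have h4 : 0 < 1 / (p - 1) := by positivity
  have h2 : -1 < -((p - 2) / (p - 1)) := by linarith
  have h0 : (0 : ℝ) ≤ 2 * L := by linarith
  have hi : IntervalIntegrable (fun x : ℝ => x ^ (-((p - 2) / (p - 1)))) volume 0 (2 * L) :=
    intervalIntegral.intervalIntegrable_rpow' h2
  refine ⟨((intervalIntegrable_iff_integrableOn_Ioc_of_le h0).1 hi).mul_const _, ?_⟩
  simp only [dblW]
  rw [integral_mul_const, ← intervalIntegral.integral_of_le h0, integral_rpow (Or.inl h2), h3,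
    Real.zero_rpow h4.ne', Real.mul_rpow (by norm_num) hL.le, Real.rpow_neg hL.le]
  have : L ^ (1 / (p - 1)) ≠ 0 := (Real.rpow_pos_of_pos hL _).ne'
  field_simp
  ring

variable {E ι : Type*} [NormedAddCommGroup E] [NormedSpace ℝ E] [MeasurableSpace E] [BorelSpace E]
  [FiniteDimensional ℝ E] [Fintype ι] {μ : Measure E} [μ.IsAddHaarMeasure] {G : Geo E ι}
  {c : Coef ι} {K : Set E}

theorem dirD_comp_ht {g : ℝ → ℝ} (hg : Differentiable ℝ g) (G : Geo E ι) (κ L : ℝ) (w y : E) :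
    dirD w (fun y => g ((G.ht y - κ) / L)) y = G.ht w / L * deriv g ((G.ht y - κ) / L) := by
  have h : HasDerivAt (fun s => g ((s - κ) / L)) (deriv g ((G.ht y - κ) / L) * (1 / L)) (G.ht y) :=
    (hg _).hasDerivAt.comp (G.ht y) (((hasDerivAt_id _).sub_const κ).div_const L)
  rw [dirD_comp (u := G.ht) (h := fun s => g ((s - κ) / L)) G.ht.differentiableAt h w, dirD,
    G.ht.fderiv]
  ring

theorem normal_local (ι : Type*) [Fintype ι] {p ε ν B : ℝ} (hp : 2 < p) (hε : 0 < ε) (hν : 0 < ν)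
    (hB : 0 ≤ B) : ∃ C, 0 < C ∧ ∀ (G : Geo E ι) (c : Coef ι) (K : Set E), IsCompact K →
      ∀ M, 0 < M → c.Flat M B → (∀ s, ν * M ≤ c.m s) → ∀ u : E → ℝ, IsTest (⊤ : ℕ∞) K u →
      ∀ κ L : ℝ, 0 < L →
      ∫ y in {y | G.ht y ∈ Icc (κ - L / 2) (κ + L / 2)}, |dirD G.n u y| ^ p ∂μ
        ≤ ε * (∫ y in {y | G.ht y ∈ Icc (κ - L) (κ + L)}, |dirD G.n u y| ^ p ∂μ)
          + C * ((∫ y in {y | G.ht y ∈ Icc (κ - L) (κ + L)}, ∑ j, |dirD (G.e j) u y| ^ p ∂μ)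
            + L ^ p * (∫ y in {y | G.ht y ∈ Icc (κ - L) (κ + L)}, |G.op c u y| ^ p ∂μ)
            + L ^ (-p) * (∫ y in {y | G.ht y ∈ Icc (κ - L) (κ + L)}, |u y| ^ p ∂μ)
            + L ^ 2 * ∫ y in {y | G.ht y ∈ Icc (κ - L) (κ + L)},
                ∑ j, |dirD (G.e j) u y| ^ (p - 2) * dirD G.n (dirD (G.e j) u) y ^ 2 ∂μ) := by
  obtain ⟨χ, A, hA, hχ, χ0, χ1, χeq, χz, χA⟩ := exists_cutoff
  set w := (2 : ℝ) ^ (1 / (p - 1)) * (p - 1) with hw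
  have h1 : 0 < p - 1 := by linarith
  have hw0 : 0 < w := by positivity
  set C₁ := (p / (2 * ν)) * (2 * (p - 1) * (B ^ 2 + B) + 1) with hC₁
  have hC₁0 : 0 < C₁ := by positivity
  obtain ⟨C, hC, h⟩ := integral_dblBdF_le (E := E) (μ := μ) ι hp
    (div_pos hε (mul_pos hC₁0 (by linarith : 0 < w + 2))) hA
  set ε' := ε / (C₁ * (w + 2)) with hε'
  refine ⟨C₁ * C * (w + 2), by positivity, ?_⟩
  intro G c K hK M hM hc hcm u hu κ L hL
  have hd1 : Differentiable ℝ χ := hχ.differentiable (by simp)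
  have hc1 : ContDiff ℝ (⊤ : ℕ∞) (deriv χ) := (contDiff_infty_iff_deriv.1 hχ).2
  have hd2 : Differentiable ℝ (deriv χ) := hc1.differentiable (by simp)
  set ζ : ℝ → ℝ := fun s => χ ((s - κ) / L) with hζd
  have hζ : ContDiff ℝ (⊤ : ℕ∞) ζ := hχ.comp ((contDiff_id.sub contDiff_const).div_const L)
  set ξ : E → ℝ := fun y => ζ (G.ht y) with hξd
  have hξ : ContDiff ℝ (⊤ : ℕ∞) ξ := hζ.comp G.ht.contDiff
  have dξ : ∀ v y, dirD v ξ y = G.ht v / L * deriv χ ((G.ht y - κ) / L) := fun v y =>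
    dirD_comp_ht hd1 G κ L v y
  have ddξ : ∀ y, dirD G.n (dirD G.n ξ) y = (1 / L) * (1 / L) * deriv (deriv χ) ((G.ht y - κ) / L) := by
    intro y
    have e : dirD G.n ξ = fun y => (fun s => 1 / L * deriv χ s) ((G.ht y - κ) / L) :=
      funext fun y => by rw [dξ, G.ht_n]
    rw [e, dirD_comp_ht (hd2.const_mul _), G.ht_n, deriv_const_mul _ (hd2 _)]
    ring
  have far : ∀ s, s ∉ Icc (κ - L) (κ + L) → 1 ≤ |(s - κ) / L| := by
    intro s hs
    rw [abs_div, abs_of_pos hL, le_div_iff₀ hL, one_mul]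
    by_contra hlt
    rw [not_le, abs_lt] at hlt
    exact hs ⟨by linarith, by linarith⟩
  have two : ∀ s σ : ℝ, |σ| = 1 → 1 ≤ |s| ∨ 1 ≤ |s + 2 * σ| := by
    intro s σ hσ
    by_contra! hcon
    have := abs_sub_abs_le_abs_sub (2 * σ) (-s)
    rw [abs_mul, hσ, abs_neg] at this
    have e : 2 * σ - -s = s + 2 * σ := by ring
    rw [e] at this
    norm_num at this
    linarith [hcon.1, hcon.2]
  have van : ∀ e : E, |G.ht e| = 1 → ∀ y, ξ y * ξ (y + (2 * L) • e) = 0 ∧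
      ξ y * dirD e ξ (y + (2 * L) • e) = 0 := by
    intro e he y
    have e1 : (G.ht (y + (2 * L) • e) - κ) / L = (G.ht y - κ) / L + 2 * G.ht e := by
      simp; field_simp; ring
    rw [dξ]
    simp only [hξd, hζd, e1]
    rcases two ((G.ht y - κ) / L) _ he with h | h
    · simp [(χz _ h).1]
    · simp [(χz _ h).1, (χz _ h).2.1]
  have hn : |G.ht G.n| = 1 := by simp [G.ht_n]
  have hn' : |G.ht (-G.n)| = 1 := by simp [G.ht_n]
  have hm : ∀ S, BddMeas S fun y => c.m (G.ht y) := fun S => (hc.loc (G := G) (K := S)).m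
  have h2L : 0 < 2 * L := by positivity
  obtain ⟨i1, v1⟩ := integral_dblF (μ := μ) hp hK hu hξ hm G.n h2L (fun y => (van _ hn y).1)
    fun y => (van _ hn y).2
  obtain ⟨i2, v2⟩ := integral_dblF (μ := μ) hp hK hu hξ hm (-G.n) h2L (fun y => (van _ hn' y).1)
    fun y => (van _ hn' y).2
  simp only [dirD_neg_dir, abs_neg] at v2
  set S := {y | G.ht y ∈ Icc (κ - L) (κ + L)} with hS
  set U := ∫ y in S, |dirD G.n u y| ^ p ∂μ
  set V := ∫ y in S, ∑ j, |dirD (G.e j) u y| ^ (p - 2) * dirD G.n (dirD (G.e j) u) y ^ 2 ∂μ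
  set T := ∫ y in S, ∑ j, |dirD (G.e j) u y| ^ p ∂μ
  set FI := ∫ y in S, |G.op c u y| ^ p ∂μ
  set W := ∫ y in S, |u y| ^ p ∂μ
  have V0 : 0 ≤ V := integral_nonneg fun y => Finset.sum_nonneg fun j _ => by positivity
  have T0 : 0 ≤ T := integral_nonneg fun y => Finset.sum_nonneg fun j _ => by positivity
  have F0 : 0 ≤ FI := integral_nonneg fun y => by positivity
  have W0 : 0 ≤ W := integral_nonneg fun y => by positivity
  have U0 : 0 ≤ U := integral_nonneg fun y => by positivity
  set k := ε' * L⁻¹ * U + C * (L ^ (p - 1) * FI + L⁻¹ * L ^ (-p) * W + L * V) with hk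
  set D := 2 * (p - 1) * (B ^ 2 + B) + 1 with hD
  have hD0 : 0 < D := by positivity
  have pt : ∀ r ∈ Ioc 0 (2 * L), (∫ y, c.m (G.ht y) * dblF p u ξ G.n y r ∂μ)
      + ∫ y, c.m (G.ht y) * dblF p u ξ (-G.n) y r ∂μ
      ≤ D * M * (dblW p L r * (ε' * U + C * T) + k) := by
    intro r hr
    refine (dbl_fixed (A := A / L ^ 2) hp hK hB hc hu hζ (fun s => χ0 _) (fun s => χ1 _)
      measurableSet_Icc (fun s hs => (χz _ (far s hs)).1) (fun y => ?_) (fun y hy => ?_) hr).trans ?_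
    · rw [ddξ, abs_mul, abs_of_nonneg (by positivity)]
      have := χA ((G.ht y - κ) / L)
      calc 1 / L * (1 / L) * _ ≤ 1 / L * (1 / L) * A := by gcongr
        _ = _ := by field_simp
    · rw [ddξ, (χz _ (far _ hy)).2.2, mul_zero]
    · refine mul_le_mul_of_nonneg_left ((h G c K hK M B hc u hu (κ - L) (κ + L) L r hL hr).trans
        (le_of_eq ?_)) (by positivity)
      simp only [hk]
      ring
  obtain ⟨iw, vw⟩ := integral_dblW hp hL
  have ik : IntegrableOn (fun _ : ℝ => k) (Ioc 0 (2 * L)) := integrableOn_const measure_Ioc_lt_top.ne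
  have iΦ : IntegrableOn (fun r => dblW p L r * (ε' * U + C * T) + k) (Ioc 0 (2 * L)) :=
    (iw.mul_const _).add ik
  have tot := setIntegral_mono_on (i1.add i2) (iΦ.const_mul (D * M)) measurableSet_Ioc pt
  have e1 : ∫ r in Ioc 0 (2 * L), D * M * (dblW p L r * (ε' * U + C * T) + k)
      = D * M * (w * (ε' * U + C * T) + 2 * L * k) := by
    rw [integral_const_mul, integral_add (iw.mul_const _) ik, integral_mul_const, vw, setIntegral_const,
      Real.volume_real_Ioc_of_le h2L.le, sub_zero, smul_eq_mul]
  simp only [Pi.add_apply] at tot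
  rw [integral_add i1 i2, v1, v2, e1] at tot
  have low : ν * M / p * ∫ y in {y | G.ht y ∈ Icc (κ - L / 2) (κ + L / 2)}, |dirD G.n u y| ^ p ∂μ
      ≤ ∫ y, c.m (G.ht y) * (ξ y ^ 2 * (|dirD G.n u y| ^ p / p)) ∂μ := by
    have ml : Measurable G.ht := G.ht.continuous.measurable
    have mH : MeasurableSet {y | G.ht y ∈ Icc (κ - L / 2) (κ + L / 2)} := ml measurableSet_Icc
    have iN := (hu.dirD G.n).integrable_rpow (μ := μ) hK (p := p) (by linarith)
    rw [← integral_const_mul, ← integral_indicator mH]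
    refine integral_mono ((iN.const_mul _).indicator mH) ?_ fun y => ?_
    · refine BddMeas.integrable (K := K) ?_ hK.measurableSet hK.measure_lt_top.ne fun y hy => ?_
      · have b1 := ((hu.dirD G.n).bddMeas hK).abs_rpow (p := p) (by linarith)
        have b2 : BddMeas K ξ := ⟨hξ.continuous.measurable, 1, fun y _ => by
          rw [abs_of_nonneg (χ0 _)]; exact χ1 _⟩
        simp only [div_eq_mul_inv]
        exact (hm K).mul ((b2.pow 2).mul (b1.mul (BddMeas.const _)))
      · rw [(hu.dirD G.n).zero_off hy, abs_zero, Real.zero_rpow (by linarith)]; simp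
    · have p0 : 0 < p := by linarith
      by_cases hy : y ∈ {y | G.ht y ∈ Icc (κ - L / 2) (κ + L / 2)}
      · rw [indicator_of_mem hy]
        have hy' : G.ht y ∈ Icc (κ - L / 2) (κ + L / 2) := hy
        have : ξ y = 1 := χeq _ (by
          rw [abs_div, abs_of_pos hL, div_le_iff₀ hL, abs_le]
          constructor <;> linarith [hy'.1, hy'.2])
        rw [this]
        have := mul_le_mul_of_nonneg_right (hcm (G.ht y))
          (by positivity : 0 ≤ |dirD G.n u y| ^ p / p)
        calc ν * M / p * |dirD G.n u y| ^ p = ν * M * (|dirD G.n u y| ^ p / p) := by ring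
          _ ≤ _ := by linarith
      · rw [indicator_of_notMem hy]
        have := hc.m_nonneg (G.ht y)
        positivity
  have fin := (mul_le_mul_of_nonneg_left low (by norm_num : (0 : ℝ) ≤ 2)).trans
    ((le_of_eq (two_mul _)).trans tot)
  set Q := ∫ y in {y | G.ht y ∈ Icc (κ - L / 2) (κ + L / 2)}, |dirD G.n u y| ^ p ∂μ
  have p0 : 0 < p := by linarith
  have q1 : Q ≤ C₁ * (w * (ε' * U + C * T) + 2 * L * k) := by
    have e : 2 * (ν * M / p * Q) = (2 * ν / p * M) * Q := by ring
    have e2 : D * M * (w * (ε' * U + C * T) + 2 * L * k)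
        = (2 * ν / p * M) * (C₁ * (w * (ε' * U + C * T) + 2 * L * k)) := by
      rw [hC₁]; field_simp
    rw [e, e2] at fin
    exact le_of_mul_le_mul_left fin (by positivity)
  have hLp : L * L ^ (p - 1) = L ^ p := by
    rw [mul_comm, ← Real.rpow_add_one hL.ne', sub_add_cancel]
  have hk2 : 2 * L * k = 2 * ε' * U + 2 * C * (L ^ p * FI + L ^ (-p) * W + L ^ 2 * V) := by
    rw [← hLp, hk]; field_simp
  have he : C₁ * (w + 2) * ε' = ε := by rw [hε']; field_simp
  have hP := Real.rpow_pos_of_pos hL p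
  have hP' := Real.rpow_pos_of_pos hL (-p)
  set Y := L ^ p * FI + L ^ (-p) * W + L ^ 2 * V with hY
  have Y0 : 0 ≤ Y := by positivity
  have : ε * U + C₁ * C * (w + 2) * (T + L ^ p * FI + L ^ (-p) * W + L ^ 2 * V)
      - C₁ * (w * (ε' * U + C * T) + 2 * L * k) = C₁ * C * (2 * T + w * Y) := by
    rw [hk2, ← he, hY]; ring
  have : 0 ≤ C₁ * C * (2 * T + w * Y) := by positivity
  linarith

end LocalNormal

section Averaging

theorem mem_Icc_double_comm {s t : ℝ} : s ∈ Icc (t / 2) (2 * t) ↔ t ∈ Icc (s / 2) (2 * s) := by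
  simp only [mem_Icc]
  constructor <;> rintro ⟨h1, h2⟩ <;> constructor <;> linarith

theorem rpow_le_two_rpow_abs {s t : ℝ} (ht : 0 < t) (hs : s ∈ Icc (t / 2) (2 * t)) (r : ℝ) :
    s ^ r ≤ 2 ^ |r| * t ^ r := by
  have hs0 : 0 < s := by linarith [hs.1]
  rw [← div_le_iff₀ (by positivity), ← Real.div_rpow hs0.le ht.le]
  rcases le_total 0 r with hr | hr
  · rw [abs_of_nonneg hr]
    exact Real.rpow_le_rpow (by positivity) (by rw [div_le_iff₀ ht]; exact hs.2) hr
  · rw [abs_of_nonpos hr, ← inv_div, Real.inv_rpow (by positivity), ← Real.rpow_neg (by positivity)]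
    refine Real.rpow_le_rpow (by positivity) ?_ (by linarith)
    rw [div_le_iff₀ hs0]; linarith [hs.1]

variable {Λ β : ℝ} (hΛ : 0 < Λ) (hβ : 0 ≤ β) (hβ1 : β ≤ 1)
include hΛ hβ hβ1

theorem rho_le_double {s t : ℝ} (ht : 0 < t) (hs : s ∈ Icc (t / 2) (2 * t)) :
    rho Λ β s ≤ 2 * rho Λ β t := by
  have h := rpow_le_two_rpow_abs ht hs β
  rw [abs_of_nonneg hβ] at h
  have h2 : (2 : ℝ) ^ β ≤ 2 := by
    simpa using Real.rpow_le_rpow_of_exponent_le (by norm_num : (1 : ℝ) ≤ 2) hβ1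
  have := mul_le_mul_of_nonneg_right h2 (Real.rpow_pos_of_pos ht β).le
  unfold rho
  nlinarith

theorem th_le_double {s t : ℝ} (ht : 0 < t) (hs : s ∈ Icc (t / 2) (2 * t)) :
    th Λ β s ≤ 4 * th Λ β t := by
  have hs0 : 0 < s := by linarith [hs.1]
  have h := rho_le_double hΛ hβ hβ1 ht hs
  have h0 := rho_pos (β := β) hΛ ht
  unfold th
  rw [div_le_iff₀ hs0]
  have : 4 * ((1 + rho Λ β t) / t) * (t / 2) = 2 * (1 + rho Λ β t) := by field_simp; ring
  have h3 := mul_le_mul_of_nonneg_left hs.1 (by positivity : 0 ≤ 4 * ((1 + rho Λ β t) / t))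
  linarith

theorem wA_le_double {p γ s t : ℝ} (hp : 0 ≤ p) (ht : 0 < t) (hs : s ∈ Icc (t / 2) (2 * t)) :
    wA p γ Λ β s ≤ 2 ^ (|γ - p| + p) * wA p γ Λ β t := by
  have hs0 : 0 < s := by linarith [hs.1]
  have h := rpow_le_two_rpow_abs ht hs (γ - p)
  have h0 := rho_pos (β := β) hΛ ht
  have hs1 := rho_pos (β := β) hΛ hs0
  have h2 := Real.rpow_le_rpow hs1.le (rho_le_double hΛ hβ hβ1 ht hs) hp
  rw [Real.mul_rpow (by norm_num) h0.le] at h2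
  unfold wA
  rw [Real.rpow_add (by norm_num)]
  calc _ ≤ (2 ^ |γ - p| * t ^ (γ - p)) * (2 ^ p * rho Λ β t ^ p) :=
        mul_le_mul h h2 (by positivity) (by positivity)
    _ = _ := by ring

theorem mem_double_of_abs_le {t κ a : ℝ} (ha : a ≤ 1 / 4) (hκ : 0 < κ)
    (h : |t - κ| ≤ a / th Λ β κ) : κ ∈ Icc (t / 2) (2 * t) := by
  have h0 := rho_pos (β := β) hΛ hκ
  have h1 : a / th Λ β κ ≤ κ / 4 := by
    have hθ := th_pos (β := β) hΛ hκ
    rw [div_le_iff₀ hθ, th]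
    have : κ / 4 * ((1 + rho Λ β κ) / κ) = (1 + rho Λ β κ) / 4 := by field_simp
    linarith
  have := abs_le.1 (h.trans h1)
  constructor <;> linarith [this.1, this.2]

omit hβ hβ1 in
theorem one_div_th_le {t : ℝ} (ht : 0 < t) : 1 / th Λ β t ≤ t := by
  have h0 := rho_pos (β := β) hΛ ht
  have hθ := th_pos (β := β) hΛ ht
  rw [div_le_iff₀ hθ, th]
  have : t * ((1 + rho Λ β t) / t) = 1 + rho Λ β t := by field_simp
  linarith

variable {E : Type*} [NormedAddCommGroup E] [NormedSpace ℝ E] [MeasurableSpace E] [BorelSpace E]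
  [FiniteDimensional ℝ E] {μ : Measure E} [μ.IsAddHaarMeasure]

/-- Integrating local inequalities at scale `1 / th` against the weight. -/
theorem weighted_of_local {p : ℝ} (γ : ℝ) (hp : 0 ≤ p) {l : E → ℝ} (ml : Measurable l)
    {N R : E → ℝ} (mN : Measurable N) (mR : Measurable R) (N0 : ∀ y, 0 ≤ N y) (R0 : ∀ y, 0 ≤ R y)
    (N1 : ∀ y, l y ≤ 0 → N y = 0) (R1 : ∀ y, l y ≤ 0 → R y = 0)
    (iN : Integrable N μ) (iR : Integrable R μ)
    (iN' : Integrable (fun y => wA p γ Λ β (l y) * N y) μ)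
    (iR' : Integrable (fun y => wA p γ Λ β (l y) * R y) μ)
    (h : ∀ κ, 0 < κ → ∫ y in {y | |l y - κ| ≤ (1 / 8) / th Λ β κ}, N y ∂μ
      ≤ ∫ y in {y | |l y - κ| ≤ (1 / 4) / th Λ β κ}, R y ∂μ) :
    ∫ y, wA p γ Λ β (l y) * N y ∂μ
      ≤ 512 * (2 ^ (|γ - p| + p)) ^ 2 * ∫ y, wA p γ Λ β (l y) * R y ∂μ := by
  set C₀ : ℝ := 2 ^ (|γ - p| + p) with hC₀
  have hC₀0 : 0 < C₀ := by positivity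
  set P : ℝ → Set (E × ℝ) := fun a => {x | 0 < x.2 ∧ |l x.1 - x.2| ≤ a / th Λ β x.2} with hP
  have mth : Measurable (th Λ β) := by unfold th rho; fun_prop
  have mwA : Measurable (wA p γ Λ β) := by unfold wA rho; fun_prop
  have mP : ∀ a, MeasurableSet (P a) := fun a => by
    refine MeasurableSet.inter (s₁ := {x : E × ℝ | 0 < x.2})
      (s₂ := {x : E × ℝ | |l x.1 - x.2| ≤ a / th Λ β x.2})
      (measurableSet_lt measurable_const measurable_snd) (measurableSet_le ?_ ?_)
    · have : Measurable fun x : E × ℝ => l x.1 - x.2 :=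
        (ml.comp measurable_fst).sub measurable_snd
      exact (continuous_abs.measurable).comp this
    · exact (measurable_const.div (mth.comp measurable_snd))
  set g : ℝ → ℝ≥0∞ := fun κ => ENNReal.ofReal (wA p γ Λ β κ * th Λ β κ) with hg
  have mg : Measurable g := (mwA.mul mth).ennreal_ofReal
  set F : ℝ → (E → ℝ) → E × ℝ → ℝ≥0∞ := fun a f =>
    (P a).indicator fun x => g x.2 * ENNReal.ofReal (f x.1) with hF
  have Fmem : ∀ a f y κ, (y, κ) ∈ P a → F a f (y, κ) = g κ * ENNReal.ofReal (f y) :=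
    fun a f y κ h => indicator_of_mem h _
  have Fnot : ∀ a f y κ, (y, κ) ∉ P a → F a f (y, κ) = 0 :=
    fun a f y κ h => indicator_of_notMem h _
  have mF : ∀ a f, Measurable f → Measurable (F a f) := fun a f hf =>
    Measurable.indicator ((mg.comp measurable_snd).mul (hf.comp measurable_fst).ennreal_ofReal)
      (mP a)
  have inner : ∀ a f, ∀ κ, 0 < κ → Measurable f → (∀ y, 0 ≤ f y) → Integrable f μ →
      ∫⁻ y, F a f (y, κ) ∂μ
        = g κ * ENNReal.ofReal (∫ y in {y | |l y - κ| ≤ a / th Λ β κ}, f y ∂μ) := by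
    intro a f κ hκ mf f0 hf
    have mS : MeasurableSet {y | |l y - κ| ≤ a / th Λ β κ} :=
      measurableSet_le ((continuous_abs.measurable).comp (ml.sub_const κ)) measurable_const
    rw [ofReal_integral_eq_lintegral_ofReal hf.integrableOn
      (Filter.Eventually.of_forall fun y => f0 y),
      ← lintegral_const_mul _ mf.ennreal_ofReal, ← lintegral_indicator mS]
    refine lintegral_congr fun y => ?_
    by_cases hy : |l y - κ| ≤ a / th Λ β κ
    · rw [Fmem _ _ _ _ ⟨hκ, hy⟩,
        indicator_of_mem (show y ∈ {y | |l y - κ| ≤ a / th Λ β κ} from hy)]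
    · rw [Fnot _ _ _ _ fun h => hy h.2, indicator_of_notMem (s := {y | |l y - κ| ≤ a / th Λ β κ}) hy]
  have neg : ∀ a f, ∀ κ, κ ≤ 0 → ∫⁻ y, F a f (y, κ) ∂μ = 0 := by
    intro a f κ hκ
    refine (lintegral_congr fun y => ?_).trans lintegral_zero
    exact indicator_of_notMem (fun h => absurd h.1 (not_lt.2 hκ)) _
  have mid : ∫⁻ y, ∫⁻ κ, F (1 / 8) N (y, κ) ∂volume ∂μ
      ≤ ∫⁻ y, ∫⁻ κ, F (1 / 4) R (y, κ) ∂volume ∂μ := by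
    have a1 : AEMeasurable (Function.uncurry fun y κ => F (1 / 8) N (y, κ)) (μ.prod volume) :=
      (mF (1 / 8) N mN).aemeasurable
    have a2 : AEMeasurable (Function.uncurry fun y κ => F (1 / 4) R (y, κ)) (μ.prod volume) :=
      (mF (1 / 4) R mR).aemeasurable
    rw [lintegral_lintegral_swap a1, lintegral_lintegral_swap a2]
    refine lintegral_mono fun κ => ?_
    rcases le_or_gt κ 0 with hκ | hκ
    · rw [neg _ _ κ hκ]; exact zero_le
    · rw [inner _ _ κ hκ mN N0 iN, inner _ _ κ hκ mR R0 iR]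
      gcongr
      exact h κ hκ
  have low : ∀ y, ENNReal.ofReal (wA p γ Λ β (l y) * N y)
      ≤ ENNReal.ofReal (64 * C₀) * ∫⁻ κ, F (1 / 8) N (y, κ) := by
    intro y
    rcases le_or_gt (l y) 0 with hy | hy
    · rw [N1 y hy, mul_zero, ofReal_zero]; exact zero_le
    set t := l y
    have hθ := th_pos (β := β) hΛ hy
    have hw := wA_pos (β := β) hΛ hy p γ
    have b := one_div_th_le (β := β) hΛ hy
    have hsub : ∀ κ ∈ Icc (t - 1 / 32 * (1 / th Λ β t)) (t + 1 / 32 * (1 / th Λ β t)),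
        ENNReal.ofReal (wA p γ Λ β t / C₀ * (th Λ β t / 4)) * ENNReal.ofReal (N y)
          ≤ F (1 / 8) N (y, κ) := by
      intro κ hκ
      have hκt : κ ∈ Icc (t / 2) (2 * t) := ⟨by linarith [hκ.1], by linarith [hκ.2]⟩
      have hκ0 : 0 < κ := by linarith [hκt.1]
      have htκ := mem_Icc_double_comm.1 hκt
      have hθκ := th_pos (β := β) hΛ hκ0
      have e1 := th_le_double hΛ hβ hβ1 hy hκt
      have e2 := th_le_double hΛ hβ hβ1 hκ0 htκ
      have e3 := wA_le_double (p := p) (γ := γ) hΛ hβ hβ1 hp hκ0 htκ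
      have hmem : (y, κ) ∈ P (1 / 8) := by
        refine ⟨hκ0, ?_⟩
        show |t - κ| ≤ _
        rw [abs_le]
        have : 1 / 32 * (1 / th Λ β t) ≤ 1 / 8 / th Λ β κ := by
          rw [div_div, ← div_eq_mul_one_div, div_div,
            div_le_div_iff₀ (by positivity) (by positivity)]
          linarith
        constructor <;> linarith [hκ.1, hκ.2]
      rw [Fmem _ _ _ _ hmem]
      have e5 : wA p γ Λ β t / C₀ ≤ wA p γ Λ β κ := by rw [div_le_iff₀ hC₀0]; linarith
      have e6 : th Λ β t / 4 ≤ th Λ β κ := by linarith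
      exact mul_le_mul_left (ENNReal.ofReal_le_ofReal (mul_le_mul e5 e6 (by positivity)
        (wA_pos hΛ hκ0 p γ).le)) _
    calc ENNReal.ofReal (wA p γ Λ β t * N y)
        = ENNReal.ofReal (64 * C₀) * (ENNReal.ofReal (wA p γ Λ β t / C₀ * (th Λ β t / 4))
            * ENNReal.ofReal (N y) * ENNReal.ofReal (1 / 16 * (1 / th Λ β t))) := by
          rw [← ENNReal.ofReal_mul (by positivity), ← ENNReal.ofReal_mul (by have := N0 y; positivity),
            ← ENNReal.ofReal_mul (by positivity)]
          congr 1
          field_simp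
          ring
      _ = ENNReal.ofReal (64 * C₀) * ∫⁻ κ in
            Icc (t - 1 / 32 * (1 / th Λ β t)) (t + 1 / 32 * (1 / th Λ β t)),
            ENNReal.ofReal (wA p γ Λ β t / C₀ * (th Λ β t / 4)) * ENNReal.ofReal (N y) := by
          rw [setLIntegral_const, Real.volume_Icc]
          congr 4
          ring
      _ ≤ ENNReal.ofReal (64 * C₀) * ∫⁻ κ, F (1 / 8) N (y, κ) := by
          exact mul_le_mul' le_rfl
            ((setLIntegral_mono' measurableSet_Icc hsub).trans (setLIntegral_le_lintegral _ _))
  have up : ∀ y, ∫⁻ κ, F (1 / 4) R (y, κ)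
      ≤ ENNReal.ofReal (8 * C₀) * ENNReal.ofReal (wA p γ Λ β (l y) * R y) := by
    intro y
    rcases le_or_gt (l y) 0 with hy | hy
    · refine (le_of_eq ((lintegral_congr fun κ => ?_).trans lintegral_zero)).trans zero_le
      by_cases hmem : (y, κ) ∈ P (1 / 4)
      · rw [Fmem _ _ _ _ hmem, R1 y hy, ofReal_zero, mul_zero]
      · exact Fnot _ _ _ _ hmem
    set t := l y
    have hθ := th_pos (β := β) hΛ hy
    have hw := wA_pos (β := β) hΛ hy p γ
    have hsub : ∀ κ, F (1 / 4) R (y, κ) ≤ (Icc (t - 1 / th Λ β t) (t + 1 / th Λ β t)).indicator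
        (fun _ => ENNReal.ofReal (C₀ * wA p γ Λ β t * (4 * th Λ β t)) * ENNReal.ofReal (R y)) κ := by
      intro κ
      by_cases hmem : (y, κ) ∈ P (1 / 4)
      · have hκ0 : 0 < κ := hmem.1
        have hk : |t - κ| ≤ 1 / 4 / th Λ β κ := hmem.2
        have hκt := mem_double_of_abs_le hΛ hβ hβ1 le_rfl hκ0 hk
        have htκ := mem_Icc_double_comm.1 hκt
        have hθκ := th_pos (β := β) hΛ hκ0
        have e1 := th_le_double hΛ hβ hβ1 hy hκt
        have e2 := th_le_double hΛ hβ hβ1 hκ0 htκ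
        have e3 := wA_le_double (p := p) (γ := γ) hΛ hβ hβ1 hp hy hκt
        have hwκ := wA_pos (β := β) hΛ hκ0 p γ
        have e4 : 1 / 4 / th Λ β κ ≤ 1 / th Λ β t := by
          rw [div_div, div_le_div_iff₀ (by positivity) (by positivity)]
          linarith
        have e5 := abs_le.1 (hk.trans e4)
        rw [Fmem _ _ _ _ hmem, indicator_of_mem
          (show κ ∈ Icc (t - 1 / th Λ β t) (t + 1 / th Λ β t) from
            ⟨by linarith [e5.2], by linarith [e5.1]⟩)]
        exact mul_le_mul' (ENNReal.ofReal_le_ofReal (mul_le_mul e3 e1 hθκ.le (by positivity))) le_rfl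
      · rw [Fnot _ _ _ _ hmem]; exact zero_le
    calc ∫⁻ κ, F (1 / 4) R (y, κ) ≤ _ := lintegral_mono hsub
      _ = ENNReal.ofReal (C₀ * wA p γ Λ β t * (4 * th Λ β t)) * ENNReal.ofReal (R y)
            * ENNReal.ofReal (2 * (1 / th Λ β t)) := by
          rw [lintegral_indicator measurableSet_Icc, setLIntegral_const, Real.volume_Icc]
          congr 2
          ring
      _ = _ := by
          have := R0 y
          rw [← ENNReal.ofReal_mul (by positivity), ← ENNReal.ofReal_mul (by positivity),
            ← ENNReal.ofReal_mul (by positivity)]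
          congr 1
          field_simp
          ring
  have wN0 : ∀ y, 0 ≤ wA p γ Λ β (l y) * N y := fun y => by
    rcases le_or_gt (l y) 0 with hy | hy
    · rw [N1 y hy, mul_zero]
    · exact mul_nonneg (wA_pos hΛ hy p γ).le (N0 y)
  have wR0 : ∀ y, 0 ≤ wA p γ Λ β (l y) * R y := fun y => by
    rcases le_or_gt (l y) 0 with hy | hy
    · rw [R1 y hy, mul_zero]
    · exact mul_nonneg (wA_pos hΛ hy p γ).le (R0 y)
  have mwR : Measurable fun y => wA p γ Λ β (l y) * R y := (mwA.comp ml).mul mR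
  have fin : ENNReal.ofReal (∫ y, wA p γ Λ β (l y) * N y ∂μ)
      ≤ ENNReal.ofReal (512 * C₀ ^ 2 * ∫ y, wA p γ Λ β (l y) * R y ∂μ) := by
    rw [ENNReal.ofReal_mul (by positivity), ofReal_integral_eq_lintegral_ofReal iN'
      (Filter.Eventually.of_forall wN0), ofReal_integral_eq_lintegral_ofReal iR'
      (Filter.Eventually.of_forall wR0)]
    calc _ ≤ ∫⁻ y, ENNReal.ofReal (64 * C₀) * ∫⁻ κ, F (1 / 8) N (y, κ) ∂volume ∂μ :=
          lintegral_mono low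
      _ = ENNReal.ofReal (64 * C₀) * ∫⁻ y, ∫⁻ κ, F (1 / 8) N (y, κ) ∂volume ∂μ :=
          lintegral_const_mul _ (mF _ _ mN).lintegral_prod_right'
      _ ≤ ENNReal.ofReal (64 * C₀) * ∫⁻ y, ENNReal.ofReal (8 * C₀) *
            ENNReal.ofReal (wA p γ Λ β (l y) * R y) ∂μ := by
          exact mul_le_mul' le_rfl (mid.trans (lintegral_mono up))
      _ = ENNReal.ofReal (64 * C₀) * (ENNReal.ofReal (8 * C₀) * ∫⁻ y,
            ENNReal.ofReal (wA p γ Λ β (l y) * R y) ∂μ) := by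
          rw [lintegral_const_mul _ mwR.ennreal_ofReal]
      _ = _ := by
          rw [← mul_assoc, ← ENNReal.ofReal_mul (by positivity)]
          congr 2
          ring
  exact (ENNReal.ofReal_le_ofReal_iff (mul_nonneg (by positivity) (integral_nonneg wR0))).1 fin

end Averaging

section NormalEstimate

theorem BddMeas.const_mul {X : Type*} [MeasurableSpace X] {K : Set X} {f : X → ℝ}
    (hf : BddMeas K f) (a : ℝ) : BddMeas K (fun z => a * f z) :=
  (BddMeas.const a).mul hf

/-- The coefficients without zero-order term, modified outside of `I`. -/
def Coef.trunc {ι : Type*} (c : Coef ι) (I : Set ℝ) (M : ℝ) : Coef ι where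
  m := fun s => I.indicator (fun s => c.m s - M) s + M
  q := fun _ => 0
  b := fun j => I.indicator (c.b j)
  a := fun i j => I.indicator (c.a i j)

theorem Geo.op_trunc {E ι : Type*} [NormedAddCommGroup E] [NormedSpace ℝ E] [Fintype ι]
    (G : Geo E ι) (c : Coef ι) {I : Set ℝ} (M : ℝ) (u : E → ℝ) {y : E} (hy : G.ht y ∈ I) :
    G.op (c.trunc I M) u y = G.op c u y - c.q (G.ht y) * u y := by
  simp only [Geo.op, Coef.trunc, indicator_of_mem hy]
  ring

section

variable {ι : Type*} {c : Coef ι} {ν β Λ κ : ℝ} {I : Set ℝ}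

theorem rpow_le_four {r s t : ℝ} (hr : |r| ≤ 2) (ht : 0 < t) (hs : s ∈ Icc (t / 2) (2 * t)) :
    s ^ r ≤ 4 * t ^ r := by
  refine (rpow_le_two_rpow_abs ht hs r).trans ?_
  gcongr
  calc (2 : ℝ) ^ |r| ≤ 2 ^ (2 : ℝ) := Real.rpow_le_rpow_of_exponent_le (by norm_num) hr
    _ = 4 := by norm_num

theorem Coef.Ell.trunc [Fintype ι] (hν : 0 < ν) (hν1 : ν < 1) (hβ : 0 < β) (hβ1 : β < 1) (hκ : 0 < κ)
    (hI : MeasurableSet I) (hsub : I ⊆ Icc (κ / 2) (2 * κ)) (hc : c.Ell ν β Λ) :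
    (c.trunc I (4 * ν⁻¹ * κ ^ (2 * β - 2))).Flat (4 * ν⁻¹ * κ ^ (2 * β - 2)) ν⁻¹ ∧
      ∀ s, ν ^ 2 / 16 * (4 * ν⁻¹ * κ ^ (2 * β - 2))
        ≤ (c.trunc I (4 * ν⁻¹ * κ ^ (2 * β - 2))).m s := by
  have hr : |2 * β - 2| ≤ 2 := by rw [abs_le]; constructor <;> linarith
  have hk := Real.rpow_pos_of_pos hκ (2 * β - 2)
  set k := κ ^ (2 * β - 2) with hkd
  have hp : ∀ s ∈ I, 0 < s := fun s hs => by linarith [(hsub hs).1]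
  have hi := inv_pos.2 hν
  have low : ∀ s, ν ^ 2 / 16 * (4 * ν⁻¹ * k) ≤ (c.trunc I (4 * ν⁻¹ * k)).m s := by
    intro s
    have e : ν ^ 2 / 16 * (4 * ν⁻¹ * k) = ν / 4 * k := by field_simp; norm_num
    rw [e]
    by_cases hs : s ∈ I
    · simp only [Coef.trunc, indicator_of_mem hs, sub_add_cancel]
      have h1 := hc.m_lo s (hp s hs)
      have h2 := rpow_le_four hr (hp s hs) (mem_Icc_double_comm.1 (hsub hs))
      nlinarith
    · simp only [Coef.trunc, indicator_of_notMem hs, zero_add]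
      have : 1 ≤ ν⁻¹ := (one_le_inv₀ hν).2 hν1.le
      gcongr
      linarith
  refine ⟨⟨?_, fun j => (hc.meas_b j).indicator hI, fun i j => (hc.meas_a i j).indicator hI,
    fun s => le_trans (by positivity) (low s), fun s => ?_, fun s => rfl, fun j s => ?_,
    fun i j s => ?_⟩, low⟩
  · exact ((hc.meas_m.sub_const _).indicator hI).add_const _
  · by_cases hs : s ∈ I
    · simp only [Coef.trunc, indicator_of_mem hs, sub_add_cancel]
      have h1 := hc.m_hi s (hp s hs)
      have h2 := rpow_le_four hr hκ (hsub hs)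
      nlinarith
    · simp only [Coef.trunc, indicator_of_notMem hs, zero_add, le_refl]
  · by_cases hs : s ∈ I
    · simpa only [Coef.trunc, indicator_of_mem hs] using hc.b_bd s (hp s hs) j
    · simp only [Coef.trunc, indicator_of_notMem hs, abs_zero, hi.le]
  · by_cases hs : s ∈ I
    · simpa only [Coef.trunc, indicator_of_mem hs] using hc.a_bd s (hp s hs) i j
    · simp only [Coef.trunc, indicator_of_notMem hs, abs_zero, hi.le]

end

theorem normal_gt_two {ν β p γ : ℝ} (hν : 0 < ν) (hν1 : ν < 1) (hβ : 0 < β) (hβ1 : β < 1)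
    (hp : 2 < p) (h1 : p - p * β - 1 < γ) (h2 : γ < 2 * p - 1)
    (E ι : Type) [NormedAddCommGroup E] [NormedSpace ℝ E] [MeasurableSpace E] [BorelSpace E]
    [FiniteDimensional ℝ E] [Fintype ι] (μ : Measure E) [μ.IsAddHaarMeasure] : ∃ C : ℝ, 0 < C ∧
    ∀ (G : Geo E ι) (K : Set E), IsCompact K → (∀ z ∈ K, 0 < G.ht z) → ∀ Λ, 0 < Λ →
      ∀ c : Coef ι, c.Ell ν β Λ → ∀ u : E → ℝ, IsTest (⊤ : ℕ∞) K u →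
      ∫ z, wA p γ Λ β (G.ht z) * |dirD G.n u z| ^ p ∂μ
        ≤ C * ∫ z, G.ht z ^ γ * |G.op c u z| ^ p ∂μ := by
  set C₀ : ℝ := 512 * (2 ^ (|γ - p| + p)) ^ 2 with hC₀
  have hC₀0 : 0 < C₀ := by positivity
  obtain ⟨C₁, hC₁, H₁⟩ := tangential_gt_two hν hβ hβ1 hp h1 h2
  obtain ⟨C₂, hC₂, H₂⟩ := zero_order_gt_two hν hβ hβ1 hp h1 h2
  have hε : 0 < 1 / (2 * C₀) := by positivity
  obtain ⟨C₃, hC₃, H₃⟩ := normal_local (E := E) (μ := μ) ι (B := ν⁻¹) (ν := ν ^ 2 / 16) hp hε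
    (by positivity) (inv_pos.2 hν).le
  set ε := 1 / (2 * C₀) with hεd
  have hp0 : 0 < p := by linarith
  set D : ℝ := 2 ^ p * (ν⁻¹) ^ p + 16 ^ p with hD
  have hD0 : 0 < D := by positivity
  have hi := inv_pos.2 hν
  refine ⟨2 * C₀ * C₃ * (Fintype.card ι * (2 * C₁) + 2 ^ p + D * C₂), by positivity, ?_⟩
  intro G K hK hpos Λ hΛ c hc u hu
  have tan := H₁ E ι μ G K hK hpos Λ hΛ c hc u hu
  have zer := H₂ E ι μ G K hK hpos Λ hΛ c hc u hu
  have loc := hc.loc (G := G) hK hpos hν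
  set θ : E → ℝ := fun y => th Λ β (G.ht y) with hθ
  set w : E → ℝ := fun y => wA p γ Λ β (G.ht y) with hw
  set N : E → ℝ := fun y => |dirD G.n u y| ^ p with hN
  set T : E → ℝ := fun y => ∑ j, |dirD (G.e j) u y| ^ p with hT
  set V : E → ℝ := fun y => ∑ j, |dirD (G.e j) u y| ^ (p - 2) * dirD G.n (dirD (G.e j) u) y ^ 2
    with hV
  set X : E → ℝ := fun y => ∑ j, |dirD (G.e j) u y| ^ (p - 2) * G.gradSq (dirD (G.e j) u) y
    with hX
  set F : E → ℝ := fun y => |G.op c u y| ^ p with hF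
  set W : E → ℝ := fun y => |u y| ^ p with hW
  have bN : BddMeas K N := ((hu.dirD G.n).bddMeas hK).abs_rpow hp0.le
  have bT : BddMeas K T := BddMeas.sum fun j => ((hu.dirD (G.e j)).bddMeas hK).abs_rpow hp0.le
  have bV : BddMeas K V := BddMeas.sum fun j =>
    (((hu.dirD (G.e j)).bddMeas hK).abs_rpow (by linarith)).mul
      ((((hu.dirD (G.e j)).dirD G.n).bddMeas hK).pow 2)
  have bX : BddMeas K X := BddMeas.sum fun j =>
    (((hu.dirD (G.e j)).bddMeas hK).abs_rpow (by linarith)).mul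
      (Geo.bddMeas_gradSq hK (hu.dirD (G.e j)))
  have bF : BddMeas K F := (Geo.bddMeas_op hK loc hu).abs_rpow hp0.le
  have bW : BddMeas K W := (hu.bddMeas hK).abs_rpow hp0.le
  have bθ : ∀ r : ℝ, BddMeas K fun y => θ y ^ r := fun r => bddMeas_th hK hpos hΛ r
  have bw : BddMeas K w := bddMeas_wA hK hpos hΛ p γ
  have zN : ∀ y ∉ K, N y = 0 := fun y hy => by
    simp only [hN, (hu.dirD G.n).zero_off hy, abs_zero, Real.zero_rpow hp0.ne']
  have zT : ∀ y ∉ K, T y = 0 := fun y hy => Finset.sum_eq_zero fun j _ => by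
    rw [(hu.dirD (G.e j)).zero_off hy, abs_zero, Real.zero_rpow hp0.ne']
  have zV : ∀ y ∉ K, V y = 0 := fun y hy => Finset.sum_eq_zero fun j _ => by
    rw [((hu.dirD (G.e j)).dirD G.n).zero_off hy]; simp
  have zX : ∀ y ∉ K, X y = 0 := fun y hy => Finset.sum_eq_zero fun j _ => by
    rw [Geo.gradSq_zero_off (hu.dirD (G.e j)) hy]; simp
  have zF : ∀ y ∉ K, F y = 0 := fun y hy => by
    simp only [hF, Geo.op_zero_off hu hy, abs_zero, Real.zero_rpow hp0.ne']
  have zW : ∀ y ∉ K, W y = 0 := fun y hy => by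
    simp only [hW, hu.zero_off hy, abs_zero, Real.zero_rpow hp0.ne']
  have N0 : ∀ y, 0 ≤ N y := fun y => by positivity
  have T0 : ∀ y, 0 ≤ T y := fun y => Finset.sum_nonneg fun j _ => by positivity
  have V0 : ∀ y, 0 ≤ V y := fun y => Finset.sum_nonneg fun j _ => by positivity
  have F0 : ∀ y, 0 ≤ F y := fun y => by positivity
  have W0 : ∀ y, 0 ≤ W y := fun y => by positivity
  set R : E → ℝ := fun y => ε * N y + C₃ * (T y + θ y ^ (-2 : ℝ) * V y
    + 2 ^ p * (θ y ^ (-p) * F y) + D * (θ y ^ p * W y)) with hR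
  have int : ∀ {f : E → ℝ}, BddMeas K f → (∀ y ∉ K, f y = 0) → Integrable f μ := fun hf h0 =>
    hf.integrable hK.measurableSet hK.measure_lt_top.ne h0
  have bR : BddMeas K R := (bN.const_mul ε).add ((((bT.add ((bθ _).mul bV)).add
    (((bθ _).mul bF).const_mul _)).add (((bθ _).mul bW).const_mul _)).const_mul _)
  have zR : ∀ y ∉ K, R y = 0 := fun y hy => by
    simp only [hR, zN y hy, zT y hy, zV y hy, zF y hy, zW y hy, mul_zero, add_zero]
  have notK : ∀ y, G.ht y ≤ 0 → y ∉ K := fun y hy h => absurd (hpos y h) (not_lt.2 hy)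
  have R0 : ∀ y, 0 ≤ R y := fun y => by
    by_cases hy : y ∈ K
    · have := th_pos (β := β) hΛ (hpos y hy)
      have := N0 y; have := T0 y; have := V0 y; have := F0 y; have := W0 y
      have : 0 < θ y := th_pos hΛ (hpos y hy)
      simp only [hR]; positivity
    · rw [zR y hy]
  have ball : ∀ κ a : ℝ, {y | |G.ht y - κ| ≤ a} = {y | G.ht y ∈ Icc (κ - a) (κ + a)} :=
    fun κ a => Set.ext fun y => by
      change |G.ht y - κ| ≤ a ↔ κ - a ≤ G.ht y ∧ G.ht y ≤ κ + a
      rw [abs_sub_le_iff]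
      constructor <;> rintro ⟨h1, h2⟩ <;> constructor <;> linarith
  have hloc : ∀ κ, 0 < κ → ∫ y in {y | |G.ht y - κ| ≤ (1 / 8) / th Λ β κ}, N y ∂μ
      ≤ ∫ y in {y | |G.ht y - κ| ≤ (1 / 4) / th Λ β κ}, R y ∂μ := by
    intro κ hκ
    have hθκ := th_pos (β := β) hΛ hκ
    set L := (1 / 4) / th Λ β κ with hL
    have hL0 : 0 < L := by positivity
    have e8 : (1 / 8) / th Λ β κ = L / 2 := by rw [hL]; ring
    rw [e8, ball, ball]
    have hsub : Icc (κ - L) (κ + L) ⊆ Icc (κ / 2) (2 * κ) := fun s hs =>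
      mem_Icc_double_comm.1 (mem_double_of_abs_le (a := 1 / 4) hΛ hβ.le hβ1.le le_rfl hκ (by
        rw [abs_sub_le_iff]; constructor <;> linarith [hs.1, hs.2]))
    obtain ⟨hflat, hlow⟩ := hc.trunc hν hν1 hβ hβ1 hκ
      (measurableSet_Icc (a := κ - L) (b := κ + L)) hsub
    have hk := Real.rpow_pos_of_pos hκ (2 * β - 2)
    set M := 4 * ν⁻¹ * κ ^ (2 * β - 2)
    have hM : 0 < M := by positivity
    set c' := c.trunc (Icc (κ - L) (κ + L)) M
    refine (H₃ G c' K hK M hM hflat hlow u hu κ L hL0).trans ?_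
    set S := {y | G.ht y ∈ Icc (κ - L) (κ + L)} with hS
    have mS : MeasurableSet S := G.ht.continuous.measurable measurableSet_Icc
    set F' : E → ℝ := fun y => |G.op c' u y| ^ p with hF'
    have iF' : Integrable F' μ := integrable_op_rpow hK (hflat.loc (G := G)) hu hp0
    have iN := int bN zN
    have iT := int bT zT
    have iV := int bV zV
    have iW := int bW zW
    have iTF : Integrable (fun y => T y + L ^ p * F' y) μ := iT.add (iF'.const_mul _)
    have iTFW : Integrable (fun y => T y + L ^ p * F' y + L ^ (-p) * W y) μ :=
      iTF.add (iW.const_mul _)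
    have iTFWV : Integrable (fun y => T y + L ^ p * F' y + L ^ (-p) * W y + L ^ 2 * V y) μ :=
      iTFW.add (iV.const_mul _)
    have iall : Integrable (fun y => ε * N y
        + C₃ * (T y + L ^ p * F' y + L ^ (-p) * W y + L ^ 2 * V y)) μ :=
      (iN.const_mul _).add (iTFWV.const_mul _)
    have comb : ∫ y in S, (ε * N y + C₃ * (T y + L ^ p * F' y + L ^ (-p) * W y + L ^ 2 * V y)) ∂μ
        = ε * (∫ y in S, N y ∂μ) + C₃ * ((∫ y in S, T y ∂μ) + L ^ p * (∫ y in S, F' y ∂μ)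
          + L ^ (-p) * (∫ y in S, W y ∂μ) + L ^ 2 * ∫ y in S, V y ∂μ) := by
      rw [integral_add (iN.const_mul _).integrableOn (iTFWV.const_mul _).integrableOn,
        integral_const_mul, integral_const_mul,
        integral_add iTFW.integrableOn (iV.const_mul _).integrableOn,
        integral_add iTF.integrableOn (iW.const_mul _).integrableOn,
        integral_add iT.integrableOn (iF'.const_mul _).integrableOn,
        integral_const_mul, integral_const_mul, integral_const_mul]
    refine comb.symm.le.trans (setIntegral_mono_on iall.integrableOn (int bR zR).integrableOn mS
      fun y hy => ?_)
    have hs := hsub hy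
    have hy0 : 0 < G.ht y := by linarith [hs.1]
    have hθy : 0 < θ y := th_pos hΛ hy0
    have t1 : θ y ≤ 4 * th Λ β κ := th_le_double hΛ hβ.le hβ1.le hκ hs
    have t2 : th Λ β κ ≤ 4 * θ y := th_le_double hΛ hβ.le hβ1.le hy0 (mem_Icc_double_comm.1 hs)
    have l1 : L ≤ (θ y)⁻¹ := by
      rw [hL, div_div, ← one_div]
      exact one_div_le_one_div_of_le hθy t1
    have l2 : L⁻¹ ≤ 16 * θ y := by
      rw [hL, inv_div]; linarith
    have f1 : L ^ p ≤ θ y ^ (-p) := by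
      rw [Real.rpow_neg hθy.le, ← Real.inv_rpow hθy.le]
      exact Real.rpow_le_rpow hL0.le l1 hp0.le
    have f2 : L ^ (-p) ≤ 16 ^ p * θ y ^ p := by
      rw [Real.rpow_neg hL0.le, ← Real.inv_rpow hL0.le, ← Real.mul_rpow (by norm_num) hθy.le]
      exact Real.rpow_le_rpow (by positivity) l2 hp0.le
    have f3 : L ^ 2 ≤ θ y ^ (-2 : ℝ) := by
      rw [Real.rpow_neg hθy.le, ← Real.inv_rpow hθy.le, Real.rpow_two]
      exact pow_le_pow_left₀ hL0.le l1 2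
    have f4 : F' y ≤ 2 ^ p * (F y + (ν⁻¹) ^ p * (θ y ^ p * θ y ^ p) * W y) := by
      have hq : |c.q (G.ht y) * u y| ≤ ν⁻¹ * (θ y * θ y) * |u y| := by
        have hρ := rho_pos (β := β) hΛ hy0
        have hq0 : 0 ≤ c.q (G.ht y) := le_trans (by positivity) (hc.q_lo _ hy0)
        rw [abs_mul, abs_of_nonneg hq0]
        refine mul_le_mul_of_nonneg_right ((hc.q_hi _ hy0).trans ?_) (abs_nonneg _)
        rw [← sq]
        have : rho Λ β (G.ht y) / G.ht y ≤ θ y := by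
          simp only [hθ, th]
          gcongr
          linarith
        gcongr
      have e : G.op c' u y = G.op c u y - c.q (G.ht y) * u y := G.op_trunc c M u hy
      have := Real.rpow_le_rpow (abs_nonneg _)
        ((abs_sub (G.op c u y) (c.q (G.ht y) * u y)).trans (add_le_add le_rfl hq)) hp0.le
      simp only [hF', e]
      refine this.trans ((add_rpow_le_two_rpow hp0.le (abs_nonneg _) (by positivity)).trans
        (le_of_eq ?_))
      rw [Real.mul_rpow (by positivity) (abs_nonneg _), Real.mul_rpow hi.le (by positivity),
        Real.mul_rpow hθy.le hθy.le]
    have F'0 : 0 ≤ F' y := by positivity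
    have hW0 := W0 y
    have hV0 := V0 y
    have hF0 := F0 y
    have hp1 := Real.rpow_pos_of_pos hθy (-p)
    have hp2 := Real.rpow_pos_of_pos hθy p
    have hpp : θ y ^ (-p) * θ y ^ p = 1 := by rw [← Real.rpow_add hθy]; simp
    have g1 : L ^ p * F' y ≤ 2 ^ p * (θ y ^ (-p) * F y) + 2 ^ p * (ν⁻¹) ^ p * (θ y ^ p * W y) := by
      refine (mul_le_mul f1 f4 F'0 hp1.le).trans (le_of_eq ?_)
      linear_combination (2 ^ p * (ν⁻¹) ^ p * θ y ^ p * W y) * hpp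
    have g2 := mul_le_mul_of_nonneg_right f2 hW0
    have g3 := mul_le_mul_of_nonneg_right f3 hV0
    simp only [hR]
    gcongr ε * N y + C₃ * ?_
    have : D * (θ y ^ p * W y) = 2 ^ p * (ν⁻¹) ^ p * (θ y ^ p * W y) + 16 ^ p * θ y ^ p * W y := by
      rw [hD]; ring
    linarith
  have iwN : Integrable (fun y => w y * N y) μ := int (bw.mul bN) fun y hy => by
    rw [zN y hy, mul_zero]
  have iwR : Integrable (fun y => w y * R y) μ := int (bw.mul bR) fun y hy => by
    rw [zR y hy, mul_zero]
  have avg := weighted_of_local hΛ hβ.le hβ1.le γ hp0.le G.ht.continuous.measurable bN.meas bR.meas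
    N0 R0 (fun y hy => zN y (notK y hy)) (fun y hy => zR y (notK y hy)) (int bN zN) (int bR zR)
    iwN iwR hloc
  set I := ∫ z, G.ht z ^ γ * |G.op c u z| ^ p ∂μ with hI
  set J := ∫ y, w y * N y ∂μ with hJ
  have iwT : ∀ j, Integrable (fun y => w y * |dirD (G.e j) u y| ^ p) μ := fun j =>
    int (bw.mul (((hu.dirD (G.e j)).bddMeas hK).abs_rpow hp0.le)) fun y hy => by
      rw [(hu.dirD (G.e j)).zero_off hy, abs_zero, Real.zero_rpow hp0.ne', mul_zero]
  have iwX : ∀ j, Integrable (fun y => w y / θ y ^ 2 * |dirD (G.e j) u y| ^ (p - 2)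
      * G.gradSq (dirD (G.e j) u) y) μ := fun j => by
    refine (int (f := fun y => w y * θ y ^ (-2 : ℝ) * |dirD (G.e j) u y| ^ (p - 2)
      * G.gradSq (dirD (G.e j) u) y) (((bw.mul (bθ _)).mul
      (((hu.dirD (G.e j)).bddMeas hK).abs_rpow (by linarith))).mul
      (Geo.bddMeas_gradSq hK (hu.dirD (G.e j)))) fun y hy => by
        rw [Geo.gradSq_zero_off (hu.dirD (G.e j)) hy, mul_zero]).congr
      (Filter.Eventually.of_forall fun y => ?_)
    by_cases hy : y ∈ K
    · have hθy : 0 < θ y := th_pos hΛ (hpos y hy)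
      simp only [Real.rpow_neg hθy.le, Real.rpow_two, div_eq_mul_inv]
    · simp only [Geo.gradSq_zero_off (hu.dirD (G.e j)) hy, mul_zero]
  have iwF : Integrable (fun y => G.ht y ^ γ * F y) μ :=
    int ((bddMeas_ht_rpow hK hpos γ).mul bF) fun y hy => by rw [zF y hy, mul_zero]
  have iwW : Integrable (fun y => w y * θ y ^ p * W y) μ :=
    int ((bw.mul (bθ p)).mul bW) fun y hy => by rw [zW y hy, mul_zero]
  have iST := integrable_finsetSum Finset.univ fun j (_ : j ∈ Finset.univ) => iwT j
  have iSX := integrable_finsetSum Finset.univ fun j (_ : j ∈ Finset.univ) => iwX j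
  have i1 : Integrable (fun y => (∑ j, w y * |dirD (G.e j) u y| ^ p)
      + ∑ j, w y / θ y ^ 2 * |dirD (G.e j) u y| ^ (p - 2) * G.gradSq (dirD (G.e j) u) y) μ :=
    iST.add iSX
  have i2 : Integrable (fun y => (∑ j, w y * |dirD (G.e j) u y| ^ p)
      + (∑ j, w y / θ y ^ 2 * |dirD (G.e j) u y| ^ (p - 2) * G.gradSq (dirD (G.e j) u) y)
      + 2 ^ p * (G.ht y ^ γ * F y)) μ := i1.add (iwF.const_mul _)
  have i3 : Integrable (fun y => (∑ j, w y * |dirD (G.e j) u y| ^ p)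
      + (∑ j, w y / θ y ^ 2 * |dirD (G.e j) u y| ^ (p - 2) * G.gradSq (dirD (G.e j) u) y)
      + 2 ^ p * (G.ht y ^ γ * F y) + D * (w y * θ y ^ p * W y)) μ := i2.add (iwW.const_mul _)
  have i4 : Integrable (fun y => ε * (w y * N y) + C₃ * ((∑ j, w y * |dirD (G.e j) u y| ^ p)
      + (∑ j, w y / θ y ^ 2 * |dirD (G.e j) u y| ^ (p - 2) * G.gradSq (dirD (G.e j) u) y)
      + 2 ^ p * (G.ht y ^ γ * F y) + D * (w y * θ y ^ p * W y))) μ :=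
    (iwN.const_mul _).add (i3.const_mul _)
  have up : ∫ y, w y * R y ∂μ ≤ ε * J + C₃ * (Fintype.card ι * (2 * C₁) * I + 2 ^ p * I
      + D * (C₂ * I)) := by
    have step : ∫ y, w y * R y ∂μ ≤ ∫ y, (ε * (w y * N y)
        + C₃ * ((∑ j, w y * |dirD (G.e j) u y| ^ p)
      + (∑ j, w y / θ y ^ 2 * |dirD (G.e j) u y| ^ (p - 2) * G.gradSq (dirD (G.e j) u) y)
      + 2 ^ p * (G.ht y ^ γ * F y) + D * (w y * θ y ^ p * W y))) ∂μ := by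
      refine integral_mono iwR i4 fun y => ?_
      by_cases hy : y ∈ K
      · have hy0 := hpos y hy
        have hθy : 0 < θ y := th_pos hΛ hy0
        have hwy : 0 < w y := wA_pos hΛ hy0 p γ
        have x1 : w y * (θ y ^ (-2 : ℝ) * V y)
            ≤ ∑ j, w y / θ y ^ 2 * |dirD (G.e j) u y| ^ (p - 2) * G.gradSq (dirD (G.e j) u) y := by
          rw [Real.rpow_neg hθy.le, Real.rpow_two, ← mul_assoc, ← div_eq_mul_inv]
          simp only [hV]
          rw [Finset.mul_sum]
          refine Finset.sum_le_sum fun j _ => ?_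
          rw [mul_assoc]
          gcongr
          exact le_add_of_nonneg_right (Finset.sum_nonneg fun _ _ => sq_nonneg _)
        have x2 : w y * (θ y ^ (-p) * F y) ≤ G.ht y ^ γ * F y := by
          rw [Real.rpow_neg hθy.le, ← mul_assoc]
          exact mul_le_mul_of_nonneg_right (wA_mul_th_rpow_neg hp0.le hΛ hy0) (F0 y)
        have x2' := mul_le_mul_of_nonneg_left x2 (by positivity : (0 : ℝ) ≤ 2 ^ p)
        have x3 : w y * T y = ∑ j, w y * |dirD (G.e j) u y| ^ p := by
          simp only [hT]; rw [Finset.mul_sum]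
        have e : w y * R y = ε * (w y * N y) + C₃ * (w y * T y + w y * (θ y ^ (-2 : ℝ) * V y)
            + 2 ^ p * (w y * (θ y ^ (-p) * F y)) + D * (w y * θ y ^ p * W y)) := by
          simp only [hR]; ring
        show w y * R y ≤ _
        rw [e, x3]
        gcongr
      · have x3 : ∑ j, w y * |dirD (G.e j) u y| ^ p = w y * T y := by
          simp only [hT]; rw [Finset.mul_sum]
        have x4 : ∑ j, w y / θ y ^ 2 * |dirD (G.e j) u y| ^ (p - 2) * G.gradSq (dirD (G.e j) u) y
            = 0 := Finset.sum_eq_zero fun j _ => by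
          rw [Geo.gradSq_zero_off (hu.dirD (G.e j)) hy, mul_zero]
        simp only [x3, x4, zR y hy, zT y hy, zN y hy, zF y hy, zW y hy, mul_zero, add_zero, le_refl]
    refine step.trans ?_
    rw [integral_add (iwN.const_mul _) (i3.const_mul _), integral_const_mul, integral_const_mul,
      integral_add i2 (iwW.const_mul _), integral_add i1 (iwF.const_mul _), integral_add iST iSX,
      integral_const_mul, integral_const_mul, integral_finsetSum _ fun j _ => iwT j,
      integral_finsetSum _ fun j _ => iwX j]
    have s1 : ∑ j, ∫ y, w y * |dirD (G.e j) u y| ^ p ∂μ ≤ Fintype.card ι * (C₁ * I) :=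
      (Finset.sum_le_sum fun j _ => (tan j).1).trans (by simp)
    have s2 : ∑ j, ∫ y, w y / θ y ^ 2 * |dirD (G.e j) u y| ^ (p - 2)
        * G.gradSq (dirD (G.e j) u) y ∂μ ≤ Fintype.card ι * (C₁ * I) :=
      (Finset.sum_le_sum fun j _ => (tan j).2).trans (by simp)
    have e : Fintype.card ι * (2 * C₁) * I
      = Fintype.card ι * (C₁ * I) + Fintype.card ι * (C₁ * I) := by ring
    rw [e]
    gcongr
  have e1 : C₀ * ε = 1 / 2 := by rw [hεd]; field_simp
  have := mul_le_mul_of_nonneg_left up hC₀0.le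
  have e2 : C₀ * (ε * J + C₃ * (Fintype.card ι * (2 * C₁) * I + 2 ^ p * I + D * (C₂ * I)))
      = 1 / 2 * J + 1 / 2 * (2 * C₀ * C₃ * (Fintype.card ι * (2 * C₁) + 2 ^ p + D * C₂) * I) := by
    linear_combination J * e1
  show J ≤ _
  have avg' : J ≤ C₀ * ∫ y, w y * R y ∂μ := avg
  linarith

end NormalEstimate

section HalfSpace

/-- All the spatial first derivatives are controlled by the operator. -/
theorem grad_all {ν β p γ : ℝ} (hν : 0 < ν) (hν1 : ν < 1) (hβ : 0 < β) (hβ1 : β < 1)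
    (hp : 1 < p) (h1 : p - p * β - 1 < γ) (h2 : γ < 2 * p - 1)
    (E ι : Type) [NormedAddCommGroup E] [NormedSpace ℝ E] [MeasurableSpace E] [BorelSpace E]
    [FiniteDimensional ℝ E] [Fintype ι] (μ : Measure E) [μ.IsAddHaarMeasure] : ∃ C : ℝ, 0 < C ∧
    ∀ (G : Geo E ι) (K : Set E), IsCompact K → (∀ z ∈ K, 0 < G.ht z) → ∀ Λ, 0 < Λ →
      ∀ c : Coef ι, c.Ell ν β Λ → ∀ u : E → ℝ, IsTest (⊤ : ℕ∞) K u →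
      (∫ z, wA p γ Λ β (G.ht z) * |dirD G.n u z| ^ p ∂μ
        ≤ C * ∫ z, G.ht z ^ γ * |G.op c u z| ^ p ∂μ) ∧
      ∀ j, ∫ z, wA p γ Λ β (G.ht z) * |dirD (G.e j) u z| ^ p ∂μ
        ≤ C * ∫ z, G.ht z ^ γ * |G.op c u z| ^ p ∂μ := by
  rcases le_or_gt p 2 with hp2 | hp2
  · obtain ⟨C, hC, H⟩ := grad_le_two hν hβ hβ1 hp hp2 h1 h2
    refine ⟨C, hC, fun G K hK hpos Λ hΛ c hc u hu => ⟨?_, fun j => ?_⟩⟩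
    · refine H E ι μ G K hK hpos Λ hΛ c hc u hu _ (by simp [G.ht_n]) fun y z => ?_
      exact le_add_of_nonneg_right (Finset.sum_nonneg fun _ _ => sq_nonneg _)
    · refine H E ι μ G K hK hpos Λ hΛ c hc u hu _ (by simp [G.ht_e]) fun y z => ?_
      have : dirD (G.e j) y z ^ 2 ≤ ∑ j, dirD (G.e j) y z ^ 2 :=
        Finset.single_le_sum (f := fun j => dirD (G.e j) y z ^ 2)
          (fun _ _ => sq_nonneg _) (Finset.mem_univ j)
      exact this.trans (le_add_of_nonneg_left (sq_nonneg _))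
  · obtain ⟨C₁, hC₁, H₁⟩ := tangential_gt_two hν hβ hβ1 hp2 h1 h2
    obtain ⟨C₂, hC₂, H₂⟩ := normal_gt_two hν hν1 hβ hβ1 hp2 h1 h2 E ι μ
    refine ⟨C₁ + C₂, by positivity, fun G K hK hpos Λ hΛ c hc u hu => ?_⟩
    have hF : 0 ≤ ∫ z, G.ht z ^ γ * |G.op c u z| ^ p ∂μ := by
      refine integral_nonneg fun z => ?_
      by_cases hz : z ∈ K
      · have := hpos z hz
        positivity
      · simp [G.op_zero_off hu hz, Real.zero_rpow (show p ≠ 0 by linarith)]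
    refine ⟨(H₂ G K hK hpos Λ hΛ c hc u hu).trans ?_, fun j =>
      (H₁ E ι μ G K hK hpos Λ hΛ c hc u hu j).1.trans ?_⟩
    · exact mul_le_mul_of_nonneg_right (by linarith) hF
    · exact mul_le_mul_of_nonneg_right (by linarith) hF

instance {d : ℕ} : (volume : Measure (ℝ × Ed d)).IsAddHaarMeasure := by
  rw [Measure.volume_eq_prod]
  infer_instance

variable {d : ℕ}

/-- The spatial coordinate directions of `ℝ × ℝ^d`. -/
def spDir (i : Fin d) : ℝ × Ed d := (0, EuclideanSpace.single i 1)

/-- The half space `{x_L > 0}` in the variables `(t, x)`. -/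
def halfGeo (L : Fin d) : Geo (ℝ × Ed d) {i : Fin d // i ≠ L} where
  ht := (EuclideanSpace.proj L).comp (ContinuousLinearMap.snd ℝ ℝ (Ed d))
  τ := (1, 0)
  n := spDir L
  e := fun i => spDir i
  ht_τ := by simp
  ht_n := by simp [spDir]
  ht_e := fun i => by simp [spDir, i.2.symm]

/-- The coefficients of the operator divided by `a_{LL}`. -/
def halfCoef (L : Fin d) (μc a0 c0 : ℝ → ℝ) (aij : Fin d → Fin d → ℝ → ℝ) (lam : ℝ) :
    Coef {i : Fin d // i ≠ L} where
  m := fun t => (μc t)⁻¹ * a0 t / aij L L t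
  q := fun t => (μc t)⁻¹ * (lam * c0 t) / aij L L t
  b := fun j t => (aij j L t + aij L j t) / aij L L t
  a := fun i j t => aij i j t / aij L L t

theorem halfCoef_ell (L : Fin d) {ν α lam : ℝ} (hν : 0 < ν) (hν1 : ν < 1) (hlam : 0 < lam)
    {μc a0 c0 : ℝ → ℝ} {aij : Fin d → Fin d → ℝ → ℝ} (h : CoeffOK d ν α μc a0 c0 aij) :
    (halfCoef L μc a0 c0 aij lam).Ell (ν ^ 3 / 2) (1 - α / 2) (√lam) := by
  obtain ⟨hμm, ham, hcm, haijm, hb, hell, hbd⟩ := h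
  have hi : 0 < ν⁻¹ := inv_pos.2 hν
  have hνi : ν * ν⁻¹ = 1 := mul_inv_cancel₀ hν.ne'
  have hA : ∀ t, 0 < t → ν ≤ aij L L t ∧ aij L L t ≤ ν⁻¹ := by
    intro t ht
    refine ⟨?_, (abs_le.1 (hbd t ht L L)).2⟩
    have := hell t ht (Pi.single L 1)
    simpa [Pi.single_apply] using this
  have hexp : 2 * (1 - α / 2) - 2 = -α := by ring
  have hrho : ∀ t, 0 < t → (rho (√lam) (1 - α / 2) t / t) ^ 2 = lam * t ^ (-α) := by
    intro t ht
    have : rho (√lam) (1 - α / 2) t / t = √lam * t ^ (-(α / 2)) := by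
      rw [rho, mul_div_assoc, ← Real.rpow_sub_one ht.ne']
      congr 2; ring
    rw [this, mul_pow, Real.sq_sqrt hlam.le, ← Real.rpow_natCast, ← Real.rpow_mul ht.le]
    congr 2; push_cast; ring
  have hn2 : (ν ^ 3 / 2)⁻¹ = 2 * ν⁻¹ ^ 3 := by field_simp
  have hpos3 : 0 < ν ^ 3 := by positivity
  have hposi3 : 0 < ν⁻¹ ^ 3 := by positivity
  -- bounds for the zero-order coefficients
  have key : ∀ t, 0 < t → ∀ x, ν ≤ x → x ≤ ν⁻¹ →
      ν ^ 3 / 2 * t ^ (-α) ≤ (μc t)⁻¹ * x / aij L L t ∧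
      (μc t)⁻¹ * x / aij L L t ≤ (ν ^ 3 / 2)⁻¹ * t ^ (-α) := by
    intro t ht x hx1 hx2
    obtain ⟨A1, A2⟩ := hA t ht
    obtain ⟨g1, g2⟩ := (hb t ht).2.2
    set g := μc t / t ^ α with hg
    have ht' : 0 < t ^ α := by positivity
    have hμ : μc t = g * t ^ α := by rw [hg]; field_simp
    have hg0 : 0 < g := hν.trans_le g1
    have hA0 : 0 < aij L L t := hν.trans_le A1
    have e : (μc t)⁻¹ * x / aij L L t = x * (g⁻¹ * (aij L L t)⁻¹) * t ^ (-α) := by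
      rw [hμ, Real.rpow_neg ht.le]; field_simp
    have gi1 : ν ≤ g⁻¹ := (le_inv_comm₀ hν hg0).2 g2
    have gi2 : g⁻¹ ≤ ν⁻¹ := inv_anti₀ hν g1
    have Ai1 : ν ≤ (aij L L t)⁻¹ := (le_inv_comm₀ hν hA0).2 A2
    have Ai2 : (aij L L t)⁻¹ ≤ ν⁻¹ := inv_anti₀ hν A1
    have hx0 : 0 ≤ x := hν.le.trans hx1
    have l : ν ^ 3 ≤ x * (g⁻¹ * (aij L L t)⁻¹) := by
      calc ν ^ 3 = ν * (ν * ν) := by ring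
        _ ≤ _ := by gcongr
    have r : x * (g⁻¹ * (aij L L t)⁻¹) ≤ ν⁻¹ ^ 3 := by
      calc x * (g⁻¹ * (aij L L t)⁻¹) ≤ ν⁻¹ * (ν⁻¹ * ν⁻¹) := by gcongr
        _ = _ := by ring
    have hta : 0 < t ^ (-α) := by positivity
    rw [e, hn2]
    constructor
    · exact mul_le_mul_of_nonneg_right (by linarith) hta.le
    · exact mul_le_mul_of_nonneg_right (by linarith) hta.le
  have hquot : ∀ t, 0 < t → ∀ x, |x| ≤ 2 * ν⁻¹ → |x / aij L L t| ≤ (ν ^ 3 / 2)⁻¹ := by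
    intro t ht x hx
    obtain ⟨A1, A2⟩ := hA t ht
    have hA0 : 0 < aij L L t := hν.trans_le A1
    have hi1 : 1 ≤ ν⁻¹ := (one_le_inv₀ hν).2 hν1.le
    rw [abs_div, abs_of_pos hA0, hn2, div_eq_mul_inv]
    calc |x| * (aij L L t)⁻¹ ≤ 2 * ν⁻¹ * ν⁻¹ := by gcongr
      _ ≤ 2 * ν⁻¹ * ν⁻¹ * ν⁻¹ := le_mul_of_one_le_right (by positivity) hi1
      _ = _ := by ring
  constructor
  · exact (hμm.inv.mul ham).div (haijm L L)
  · exact (hμm.inv.mul (hcm.const_mul lam)).div (haijm L L)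
  · exact fun j => ((haijm j L).add (haijm L j)).div (haijm L L)
  · exact fun i j => (haijm i j).div (haijm L L)
  · intro t ht
    rw [hexp]
    exact (key t ht _ (hb t ht).1.1 (hb t ht).1.2).1
  · intro t ht
    rw [hexp]
    exact (key t ht _ (hb t ht).1.1 (hb t ht).1.2).2
  · intro t ht
    rw [hrho t ht]
    have := mul_le_mul_of_nonneg_left (key t ht _ (hb t ht).2.1.1 (hb t ht).2.1.2).1 hlam.le
    refine (le_of_eq ?_).trans (this.trans (le_of_eq ?_))
    · ring
    · simp only [halfCoef]; ring
  · intro t ht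
    rw [hrho t ht]
    have := mul_le_mul_of_nonneg_left (key t ht _ (hb t ht).2.1.1 (hb t ht).2.1.2).2 hlam.le
    refine (le_of_eq ?_).trans (this.trans (le_of_eq ?_))
    · simp only [halfCoef]; ring
    · ring
  · intro t ht j
    refine hquot t ht _ ((abs_add_le _ _).trans ?_)
    linarith [hbd t ht j L, hbd t ht L j]
  · intro t ht i j
    exact hquot t ht _ ((hbd t ht i j).trans (by linarith))
  · intro t ht ξ₀ ξ
    obtain ⟨A1, A2⟩ := hA t ht
    have hA0 : 0 < aij L L t := hν.trans_le A1
    set η : Fin d → ℝ := fun i => if h : i = L then ξ₀ else ξ ⟨i, h⟩ with hη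
    have ηL : η L = ξ₀ := by simp [hη]
    have ηi : ∀ i : {i : Fin d // i ≠ L}, η i = ξ i := fun i => by simp [hη, i.2]
    have H := hell t ht η
    have e1 : ∑ i, η i ^ 2 = ξ₀ ^ 2 + ∑ j, ξ j ^ 2 := by
      rw [Fintype.sum_eq_add_sum_subtype_ne _ L, ηL]
      simp only [ηi]
    have e2 : ∑ i, ∑ j, aij i j t * η i * η j = aij L L t * (ξ₀ ^ 2
        + ∑ j, (halfCoef L μc a0 c0 aij lam).b j t * (ξ j * ξ₀)
        + ∑ i, ∑ j, (halfCoef L μc a0 c0 aij lam).a i j t * (ξ i * ξ j)) := by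
      have f1 : ∀ x y : ℝ, aij L L t * (x / aij L L t * y) = x * y := fun x y => by field_simp
      have f3 : ∀ j : {i : Fin d // i ≠ L}, aij L j t * ξ₀ * ξ j = aij L j t * (ξ j * ξ₀) :=
        fun j => by ring
      have f4 : ∀ (x : ℝ) (i j : {i : Fin d // i ≠ L}), x * ξ i * ξ j = x * (ξ i * ξ j) :=
        fun x i j => by ring
      have f5 : ∀ (x : ℝ) (i : {i : Fin d // i ≠ L}), x * ξ i * ξ₀ = x * (ξ i * ξ₀) :=
        fun x i => by ring
      simp only [Fintype.sum_eq_add_sum_subtype_ne _ L, ηL, ηi, Finset.sum_add_distrib, mul_add,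
        Finset.mul_sum, halfCoef, f1, add_mul, f3, f4, f5]
      ring
    rw [e1, e2] at H
    set Q := ξ₀ ^ 2 + ∑ j, (halfCoef L μc a0 c0 aij lam).b j t * (ξ j * ξ₀)
        + ∑ i, ∑ j, (halfCoef L μc a0 c0 aij lam).a i j t * (ξ i * ξ j) with hQ
    have hS : 0 ≤ ξ₀ ^ 2 + ∑ j, ξ j ^ 2 := by positivity
    set S := ξ₀ ^ 2 + ∑ j, ξ j ^ 2
    have hQ0 : 0 ≤ Q := by
      have : 0 ≤ aij L L t * Q := (by positivity : 0 ≤ ν * S).trans H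
      exact nonneg_of_mul_nonneg_right this hA0
    have h3 : ν * S ≤ ν⁻¹ * Q := H.trans (mul_le_mul_of_nonneg_right A2 hQ0)
    have h4 : ν * (ν * S) ≤ Q := by
      calc ν * (ν * S) ≤ ν * (ν⁻¹ * Q) := mul_le_mul_of_nonneg_left h3 hν.le
        _ = Q := by rw [← mul_assoc, hνi, one_mul]
    refine le_trans ?_ h4
    rw [← mul_assoc]
    refine mul_le_mul_of_nonneg_right ?_ hS
    nlinarith [sq_nonneg ν]

theorem ut_eq {u : ℝ × Ed d → ℝ} {z : ℝ × Ed d} (hu : DifferentiableAt ℝ u z) :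
    ut u z = dirD (1, 0) u z := by
  have h1 : HasDerivAt (fun s : ℝ => (s, z.2)) ((1 : ℝ), (0 : Ed d)) z.1 :=
    (hasDerivAt_id z.1).prodMk (hasDerivAt_const z.1 z.2)
  exact (hu.hasFDerivAt.comp_hasDerivAt z.1 h1).deriv

theorem Du_apply {u : ℝ × Ed d → ℝ} {z : ℝ × Ed d} (hu : DifferentiableAt ℝ u z) (v : Ed d) :
    Du u z v = dirD (0, v) u z := by
  have h1 : HasFDerivAt (fun y : Ed d => (z.1, y)) (ContinuousLinearMap.inr ℝ ℝ (Ed d)) z.2 :=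
    hasFDerivAt_prodMk_right z.1 z.2
  have := (hu.hasFDerivAt.comp z.2 h1).fderiv
  unfold Du
  change fderiv ℝ (u ∘ fun y => (z.1, y)) z.2 v = _
  rw [this]
  simp [dirD]

theorem D2u_apply {u : ℝ × Ed d → ℝ} (hu : ContDiff ℝ (⊤ : ℕ∞) u) (z : ℝ × Ed d) (v w : Ed d) :
    D2u u z v w = dirD (0, v) (dirD (0, w) u) z := by
  have hd : Differentiable ℝ u := hu.differentiable (by simp)
  have hs : ContDiff ℝ (⊤ : ℕ∞) (dirD (0, w) u) :=
    (hu.fderiv_right (m := (⊤ : ℕ∞)) (by simp)).clm_apply contDiff_const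
  have hDu : ∀ y, Du u (z.1, y)
      = (fderiv ℝ u (z.1, y)).comp (ContinuousLinearMap.inr ℝ ℝ (Ed d)) := by
    intro y
    ext v
    rw [Du_apply (hd _)]
    simp [dirD]
  have hc : ContDiff ℝ (⊤ : ℕ∞) (fun y : Ed d => (z.1, y)) := contDiff_const.prodMk contDiff_id
  have hD : DifferentiableAt ℝ (fun y => Du u (z.1, y)) z.2 := by
    simp only [hDu]
    have h2 : ContDiff ℝ (⊤ : ℕ∞) (fun y => fderiv ℝ u (z.1, y)) :=
      (hu.fderiv_right (m := (⊤ : ℕ∞)) (by simp)).comp hc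
    exact ((h2.clm_comp contDiff_const).differentiable (by simp)) z.2
  have e : D2u u z v w = fderiv ℝ (fun y => Du u (z.1, y) w) z.2 v := by
    rw [fderiv_clm_apply hD (differentiableAt_const w)]
    simp [D2u]
  rw [e, ← Du_apply (hs.differentiable (by simp) z) v]
  unfold Du
  congr 2
  ext y
  exact Du_apply (u := u) (z := (z.1, y)) (hd _) w

theorem fL0_eq (L : Fin d) {μc a0 c0 : ℝ → ℝ} {aij : Fin d → Fin d → ℝ → ℝ} {lam : ℝ}
    {u : ℝ × Ed d → ℝ} (hu : ContDiff ℝ (⊤ : ℕ∞) u) (z : ℝ × Ed d)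
    (hL : (halfGeo L).ht z = xd z.2) (hA : aij L L (xd z.2) ≠ 0) :
    fL0 μc a0 c0 aij lam u z
      = aij L L (xd z.2) * (halfGeo L).op (halfCoef L μc a0 c0 aij lam) u z := by
  unfold fL0 Geo.op
  rw [hL, ut_eq (hu.differentiable (by simp) z)]
  simp only [D2u_apply hu]
  change _ - (∑ i : Fin d, ∑ j : Fin d, aij i j (xd z.2) * dirD (spDir i) (dirD (spDir j) u) z) = _
  set A := aij L L (xd z.2) with hAd
  simp only [Fintype.sum_eq_add_sum_subtype_ne _ L, Finset.sum_add_distrib, halfCoef, halfGeo]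
  rw [← hAd]
  have f1 : ∀ x y : ℝ, A * (x / A * y) = x * y := fun x y => by field_simp
  simp only [mul_sub, mul_add, Finset.mul_sum, f1, add_mul, Finset.sum_add_distrib]
  have f3 : ∀ j : {i : Fin d // i ≠ L}, dirD (spDir L) (dirD (spDir j) u) z
      = dirD (spDir j) (dirD (spDir L) u) z := fun j => dirD_comm hu _ _ _
  simp only [f3]
  ring

theorem norm_le_sum_single (φ : Ed d →L[ℝ] ℝ) :
    ‖φ‖ ≤ ∑ i, |φ (EuclideanSpace.single i 1)| := by
  refine φ.opNorm_le_bound (Finset.sum_nonneg fun _ _ => abs_nonneg _) fun x => ?_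
  have hx : x = ∑ i, x i • (EuclideanSpace.single i (1 : ℝ) : Ed d) := by
    ext j
    simp [Finset.sum_apply, Pi.single_apply]
  conv_lhs => rw [hx]
  rw [map_sum, Finset.sum_mul]
  refine (norm_sum_le _ _).trans (Finset.sum_le_sum fun i _ => ?_)
  rw [map_smul, norm_smul, mul_comm, Real.norm_eq_abs]
  exact mul_le_mul_of_nonneg_left (PiLp.norm_apply_le x i) (abs_nonneg _)

end HalfSpace

section Norms

theorem measurable_xd {d : ℕ} : Measurable (fun z : ℝ × Ed d => xd z.2) := by
  unfold xd
  split_ifs with h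
  · fun_prop
  · fun_prop

theorem measurableSet_OmegaT (d : ℕ) (T : EReal) : MeasurableSet (OmegaT d T) :=
  (measurableSet_lt (measurable_coe_real_ereal.comp measurable_fst) measurable_const).inter
    (measurableSet_lt measurable_const measurable_xd)

theorem wA_eq {p γ α Λ t : ℝ} (hΛ : 0 ≤ Λ) (ht : 0 < t) :
    wA p γ Λ (1 - α / 2) t = Λ ^ p * ((t ^ (-(α / 2))) ^ p * t ^ γ) := by
  rw [wA, rho, Real.mul_rpow hΛ (by positivity), ← Real.rpow_mul ht.le, ← Real.rpow_mul ht.le,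
    mul_left_comm, ← Real.rpow_add ht, ← Real.rpow_add ht]
  congr 2; ring

theorem gradient_integrand_le {d : ℕ} {p γ α Λ : ℝ} (hp : 1 < p) (hΛ : 0 ≤ Λ) (L : Fin d)
    {u : ℝ × Ed d → ℝ} {z : ℝ × Ed d} (hu : DifferentiableAt ℝ u z)
    (hL : (halfGeo L).ht z = xd z.2) (hz : 0 < xd z.2) :
    Λ ^ p * (|xd z.2 ^ (-(α / 2)) * ‖Du u z‖| ^ p * xd z.2 ^ γ)
      ≤ (d : ℝ) ^ (p - 1) * ∑ i, wA p γ Λ (1 - α / 2) ((halfGeo L).ht z)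
          * |dirD (spDir i) u z| ^ p := by
  have hp0 : 0 < p := by linarith
  rw [hL, ← Finset.mul_sum, wA_eq hΛ hz, abs_mul, abs_norm,
    abs_of_pos (Real.rpow_pos_of_pos hz _), Real.mul_rpow (by positivity) (norm_nonneg _)]
  have h1 : ‖Du u z‖ ^ p ≤ (d : ℝ) ^ (p - 1) * ∑ i, |dirD (spDir i) u z| ^ p := by
    have h2 : ‖Du u z‖ ≤ ∑ i, |dirD (spDir i) u z| := by
      refine (norm_le_sum_single _).trans (le_of_eq ?_)
      simp only [Du_apply hu]
      rfl
    refine (Real.rpow_le_rpow (norm_nonneg _) h2 hp0.le).trans ?_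
    simpa using Real.rpow_sum_le_const_mul_sum_rpow Finset.univ
      (fun i => dirD (spDir i) u z) hp.le
  have h3 : 0 ≤ Λ ^ p * ((xd z.2 ^ (-(α / 2))) ^ p * xd z.2 ^ γ) := by positivity
  refine (le_of_eq ?_).trans ((mul_le_mul_of_nonneg_left h1 h3).trans (le_of_eq ?_)) <;> ring

theorem halfSpace_estimate {d : ℕ} (hd : 1 ≤ d) {ν α p γ : ℝ}
    (hν : ν ∈ Set.Ioo (0 : ℝ) 1) (hα : α ∈ Set.Ioo (0 : ℝ) 2) (hp : 1 < p)
    (hγ₁ : α * p / 2 - 1 < γ) (hγ₂ : γ < 2 * p - 1) :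
    ∃ M : ℝ, 0 < M ∧
      ∀ (T : EReal) (lam : ℝ), 0 < lam →
        ∀ (μc a0 c0 : ℝ → ℝ) (aij : Fin d → Fin d → ℝ → ℝ),
          CoeffOK d ν α μc a0 c0 aij →
          ∀ u : ℝ × Ed d → ℝ, ContDiff ℝ (⊤ : ℕ∞) u → HasCompactSupport u →
            tsupport u ⊆ OmegaT d T →
            ENNReal.ofReal (√lam ^ p) * ∫⁻ z in OmegaT d T,
                ENNReal.ofReal (|xd z.2 ^ (-(α / 2)) * ‖Du u z‖| ^ p * xd z.2 ^ γ)
            ≤ ENNReal.ofReal M * ∫⁻ z in OmegaT d T,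
                ENNReal.ofReal (|fL0 μc a0 c0 aij lam u z| ^ p * xd z.2 ^ γ) := by
  obtain ⟨hν0, hν1⟩ := hν
  obtain ⟨hα0, hα2⟩ := hα
  have hp0 : 0 < p := by linarith
  have hd0 : (0 : ℝ) < d := by exact_mod_cast hd
  set L : Fin d := ⟨d - 1, Nat.sub_lt hd one_pos⟩ with hLd
  have hν3 : 0 < ν ^ 3 / 2 := by positivity
  have hν3' : ν ^ 3 / 2 < 1 := by
    have : ν ^ 3 < 1 := pow_lt_one₀ hν0.le hν1 (by norm_num)
    linarith
  obtain ⟨C, hC, H⟩ := grad_all (β := 1 - α / 2) hν3 hν3' (by linarith) (by linarith) hp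
    (by linarith) hγ₂ (ℝ × Ed d) {i : Fin d // i ≠ L} volume
  refine ⟨(d : ℝ) ^ (p - 1) * (d * C) * (ν⁻¹) ^ p, by positivity, ?_⟩
  intro T lam hlam μc a0 c0 aij hco u hu hcs hsupp
  have hΛ : 0 < √lam := Real.sqrt_pos.2 hlam
  have hht : ∀ z, (halfGeo L).ht z = xd z.2 := by
    intro z
    have : 0 < d := hd
    simp [halfGeo, xd, this, hLd]
  set K := tsupport u with hKd
  have hK : IsCompact K := hcs
  have hpos : ∀ z ∈ K, 0 < (halfGeo L).ht z := fun z hz => by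
    rw [hht]; exact (hsupp hz).2
  have hut : IsTest (⊤ : ℕ∞) K u := ⟨hu, Subset.rfl⟩
  have hell := halfCoef_ell L hν0 hν1 hlam hco
  set c := halfCoef L μc a0 c0 aij lam with hcd
  obtain ⟨Hn, Ht⟩ := H (halfGeo L) K hK hpos (√lam) hΛ c hell u hut
  set F : ℝ := ∫ z, (halfGeo L).ht z ^ γ * |(halfGeo L).op c u z| ^ p with hF
  have hall : ∀ i : Fin d, ∫ z, wA p γ (√lam) (1 - α / 2) ((halfGeo L).ht z)
      * |dirD (spDir i) u z| ^ p ≤ C * F := by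
    intro i
    by_cases hi : i = L
    · rw [hi]; exact Hn
    · exact Ht ⟨i, hi⟩
  have hKm := hK.measurableSet
  have hKf : volume K ≠ ∞ := hK.measure_lt_top.ne
  have hp0' : p ≠ 0 := hp0.ne'
  have hInt : ∀ i : Fin d, Integrable (fun z => wA p γ (√lam) (1 - α / 2) ((halfGeo L).ht z)
      * |dirD (spDir i) u z| ^ p) := fun i => by
    refine BddMeas.integrable (K := K) ((bddMeas_wA hK hpos hΛ p γ).mul
      (((hut.dirD (spDir i)).bddMeas hK).abs_rpow hp0.le)) hKm hKf fun z hz => ?_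
    rw [(hut.dirD (spDir i)).zero_off hz]
    simp [Real.zero_rpow hp0']
  have hintF : Integrable
      (fun z => (halfGeo L).ht z ^ γ * |(halfGeo L).op c u z| ^ p) := by
    refine BddMeas.integrable (K := K) ((bddMeas_ht_rpow hK hpos γ).mul
      ((Geo.bddMeas_op hK (hell.loc hK hpos hν3) hut).abs_rpow hp0.le)) hKm hKf fun z hz => ?_
    rw [Geo.op_zero_off hut hz]
    simp [Real.zero_rpow hp0']
  have hF0 : ∀ z, 0 ≤ (halfGeo L).ht z ^ γ * |(halfGeo L).op c u z| ^ p := by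
    intro z
    by_cases hz : z ∈ K
    · have := hpos z hz
      positivity
    · rw [Geo.op_zero_off hut hz]
      simp [Real.zero_rpow hp0']
  have hG0 : ∀ z, 0 ≤ (d : ℝ) ^ (p - 1) * ∑ i, wA p γ (√lam) (1 - α / 2) ((halfGeo L).ht z)
      * |dirD (spDir i) u z| ^ p := by
    intro z
    refine mul_nonneg (by positivity) (Finset.sum_nonneg fun i _ => ?_)
    by_cases hz : z ∈ K
    · have := hpos z hz
      unfold wA rho
      positivity
    · rw [(hut.dirD (spDir i)).zero_off hz]
      simp [Real.zero_rpow hp0']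
  have hGint : Integrable (fun z => (d : ℝ) ^ (p - 1) * ∑ i,
      wA p γ (√lam) (1 - α / 2) ((halfGeo L).ht z) * |dirD (spDir i) u z| ^ p) :=
    (integrable_finsetSum _ fun i _ => hInt i).const_mul _
  have hL1 : ENNReal.ofReal (√lam ^ p) * ∫⁻ z in OmegaT d T,
      ENNReal.ofReal (|xd z.2 ^ (-(α / 2)) * ‖Du u z‖| ^ p * xd z.2 ^ γ)
      ≤ ENNReal.ofReal ((d : ℝ) ^ (p - 1) * (d * C) * F) := by
    rw [← lintegral_const_mul' _ _ ENNReal.ofReal_ne_top]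
    calc ∫⁻ z in OmegaT d T, ENNReal.ofReal (√lam ^ p) *
          ENNReal.ofReal (|xd z.2 ^ (-(α / 2)) * ‖Du u z‖| ^ p * xd z.2 ^ γ)
        ≤ ∫⁻ z in OmegaT d T, ENNReal.ofReal ((d : ℝ) ^ (p - 1) * ∑ i,
          wA p γ (√lam) (1 - α / 2) ((halfGeo L).ht z) * |dirD (spDir i) u z| ^ p) := by
          refine setLIntegral_mono' (measurableSet_OmegaT d T) fun z hz => ?_
          rw [← ENNReal.ofReal_mul (by positivity)]
          exact ENNReal.ofReal_le_ofReal (gradient_integrand_le hp hΛ.le L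
            (hu.differentiable (by simp) z) (hht z) hz.2)
      _ ≤ ∫⁻ z, ENNReal.ofReal ((d : ℝ) ^ (p - 1) * ∑ i,
          wA p γ (√lam) (1 - α / 2) ((halfGeo L).ht z) * |dirD (spDir i) u z| ^ p) :=
          setLIntegral_le_lintegral _ _
      _ = ENNReal.ofReal (∫ z, (d : ℝ) ^ (p - 1) * ∑ i,
          wA p γ (√lam) (1 - α / 2) ((halfGeo L).ht z) * |dirD (spDir i) u z| ^ p) :=
          (ofReal_integral_eq_lintegral_ofReal hGint (Filter.Eventually.of_forall hG0)).symm
      _ ≤ _ := by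
          refine ENNReal.ofReal_le_ofReal ?_
          rw [integral_const_mul, integral_finsetSum _ fun i _ => hInt i, mul_assoc]
          refine mul_le_mul_of_nonneg_left ?_ (by positivity)
          refine (Finset.sum_le_sum fun i _ => hall i).trans (le_of_eq ?_)
          simp [mul_assoc]
  have hL2 : ENNReal.ofReal F ≤ ENNReal.ofReal ((ν⁻¹) ^ p) * ∫⁻ z in OmegaT d T,
      ENNReal.ofReal (|fL0 μc a0 c0 aij lam u z| ^ p * xd z.2 ^ γ) := by
    rw [hF, ofReal_integral_eq_lintegral_ofReal hintF (Filter.Eventually.of_forall hF0),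
      ← lintegral_const_mul' _ _ ENNReal.ofReal_ne_top]
    refine le_trans ?_ (lintegral_indicator_le _ _)
    refine lintegral_mono fun z => ?_
    by_cases hz : z ∈ K
    · have hzO := hsupp hz
      have hz0 : 0 < xd z.2 := hzO.2
      have hA : ν ≤ aij L L (xd z.2) := by
        have := hco.2.2.2.2.2.1 _ hz0 (Pi.single L 1)
        simpa [Pi.single_apply] using this
      have hA0 := hν0.trans_le hA
      rw [indicator_of_mem hzO, ← ENNReal.ofReal_mul (by positivity)]
      refine ENNReal.ofReal_le_ofReal ?_
      rw [hht, fL0_eq L hu z (hht z) hA0.ne', ← hcd]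
      have h1 : |(halfGeo L).op c u z|
          ≤ ν⁻¹ * |aij L L (xd z.2) * (halfGeo L).op c u z| := by
        rw [abs_mul, abs_of_pos hA0, ← mul_assoc]
        refine le_mul_of_one_le_left (abs_nonneg _) ?_
        rw [inv_mul_eq_div, one_le_div hν0]
        exact hA
      have h2 := Real.rpow_le_rpow (abs_nonneg _) h1 hp0.le
      rw [Real.mul_rpow (by positivity) (abs_nonneg _)] at h2
      have h3 : 0 ≤ xd z.2 ^ γ := by positivity
      refine (mul_le_mul_of_nonneg_left h2 h3).trans (le_of_eq ?_)
      ring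
    · rw [Geo.op_zero_off hut hz]
      simp [Real.zero_rpow hp0']
  refine hL1.trans ?_
  have hN : 0 ≤ (d : ℝ) ^ (p - 1) * (d * C) := by positivity
  rw [ENNReal.ofReal_mul hN, ENNReal.ofReal_mul hN, mul_assoc]
  exact mul_le_mul_right hL2 _

end Norms

/-- Gradient estimate (3.4) of Theorem 3.1: equations with coefficients
depending only on `x_d`. -/
theorem stmt3 (d : ℕ) (hd : 1 ≤ d) (ν α p γ : ℝ)
    (hν : ν ∈ Set.Ioo (0 : ℝ) 1) (hα : α ∈ Set.Ioo (0 : ℝ) 2) (hp : 1 < p)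
    (hγ₁ : α * p / 2 - 1 < γ) (hγ₂ : γ < 2 * p - 1) :
    ∃ N : ℝ, 0 < N ∧
      ∀ (T : EReal) (lam : ℝ), 0 < lam →
        ∀ (μc a0 c0 : ℝ → ℝ) (aij : Fin d → Fin d → ℝ → ℝ),
          CoeffOK d ν α μc a0 c0 aij →
          ∀ u : ℝ × Ed d → ℝ, ContDiff ℝ (⊤ : ℕ∞) u → HasCompactSupport u →
            tsupport u ⊆ OmegaT d T →
            ENNReal.ofReal (Real.sqrt lam) *
                wLp d T p γ (fun z => xd z.2 ^ (-(α / 2)) * ‖Du u z‖)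
            ≤ ENNReal.ofReal N * wLp d T p γ (fL0 μc a0 c0 aij lam u) := by
  have hp0 : 0 < p := by linarith
  obtain ⟨M, hM, H⟩ := halfSpace_estimate hd hν hα hp hγ₁ hγ₂
  refine ⟨M ^ (1 / p), by positivity, ?_⟩
  intro T lam hlam μc a0 c0 aij hco u hu hcs hsupp
  have h := ENNReal.rpow_le_rpow (H T lam hlam μc a0 c0 aij hco u hu hcs hsupp)
    (z := 1 / p) (by positivity)
  rw [ENNReal.mul_rpow_of_nonneg _ _ (by positivity), ENNReal.mul_rpow_of_nonneg _ _ (by positivity),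
    ENNReal.ofReal_rpow_of_nonneg (by positivity) (by positivity),
    ENNReal.ofReal_rpow_of_nonneg hM.le (by positivity), ← Real.rpow_mul (Real.sqrt_nonneg _),
    mul_one_div_cancel hp0.ne', Real.rpow_one] at h
  exact h
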